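/- arXiv:1503.08487 — 10 statements merged into one kernel-verified Lean document; each statement's English description precedes it below -/
import Mathlib

section
/- Let A be a finite abelian group. The clone Comp(A) of all congruence preserving functions of A is finitely generated if and only if every Sylow subgroup of A is either cyclic or affine complete. -/
/-- A finitary operation on `A`. -/
abbrev FinOp (A : Type*) := Σ n : ℕ, (Fin n → A) → A

/-- Membership in the clone generated by a set `F` of finitary operations:
the smallest set of finitary operations containing `F` and all projections
and closed under composition. -/
inductive InClone {A : Type*} (F : Set (FinOp A)) : {n : ℕ} → ((Fin n → A) → A) → Prop
  | proj {n : ℕ} (i : Fin n) : InClone F fun x => x i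
  | base {n : ℕ} (f : (Fin n → A) → A) : (⟨n, f⟩ : FinOp A) ∈ F → InClone F f
  | comp {n m : ℕ} (f : (Fin m → A) → A) (g : Fin m → (Fin n → A) → A) :
      InClone F f → (∀ i, InClone F (g i)) → InClone F fun x => f fun i => g i x

/-- A function `A^k → A` on an abelian group is compatible (congruence
preserving): for every subgroup `N` and tuples `a ≡ b mod N` one has
`f a ≡ f b mod N`. -/
def Compatible {A : Type*} [CommGroup A] {k : ℕ} (f : (Fin k → A) → A) : Prop :=
  ∀ N : Subgroup A, ∀ a b : Fin k → A,
    (∀ i, (a i)⁻¹ * b i ∈ N) → (f a)⁻¹ * f b ∈ N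

/-- The clone `Comp A` of congruence preserving functions of `A` is finitely
generated. -/
def CompFG (A : Type*) [CommGroup A] : Prop :=
  ∃ F : Set (FinOp A), F.Finite ∧ (∀ f ∈ F, 1 ≤ f.1 ∧ Compatible f.2) ∧
    ∀ (n : ℕ), 1 ≤ n → ∀ f : (Fin n → A) → A, (Compatible f ↔ InClone F f)

/-- An abelian group is affine complete if every compatible function is a
polynomial function `x ↦ c + ∑ mᵢ • xᵢ` (written multiplicatively). -/
def AffineComplete (A : Type*) [CommGroup A] : Prop :=
  ∀ (k : ℕ), 1 ≤ k → ∀ f : (Fin k → A) → A, Compatible f →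
    ∃ (c : A) (m : Fin k → ℤ), ∀ x : Fin k → A, f x = c * ∏ i, x i ^ m i

/-- The functions `X ^ k → B` that are sums of functions each depending on at most `d` of the
`k` arguments. -/
def boundedWidth (X B : Type*) [AddCommMonoid B] (k d : ℕ) : AddSubmonoid ((Fin k → X) → B) :=
  AddSubmonoid.closure {g | ∃ T : Finset (Fin k), T.card ≤ d ∧ DependsOn g (T : Set (Fin k))}

namespace boundedWidth

variable {X B C : Type*} {k d : ℕ}

lemma of_dependsOn [AddCommMonoid B] {g : (Fin k → X) → B} (T : Finset (Fin k))
    (hT : T.card ≤ d) (hg : DependsOn g (T : Set (Fin k))) : g ∈ boundedWidth X B k d :=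
  AddSubmonoid.subset_closure ⟨T, hT, hg⟩

lemma mono [AddCommMonoid B] {d' : ℕ} (h : d ≤ d') :
    boundedWidth X B k d ≤ boundedWidth X B k d' :=
  AddSubmonoid.closure_mono fun _ ⟨T, hT, hg⟩ => ⟨T, hT.trans h, hg⟩

lemma map_addMonoidHom [AddCommMonoid B] [AddCommMonoid C] (φ : B →+ C)
    {g : (Fin k → X) → B} (hg : g ∈ boundedWidth X B k d) :
    (fun x => φ (g x)) ∈ boundedWidth X C k d := by
  induction hg using AddSubmonoid.closure_induction with
  | mem g hg =>
    obtain ⟨T, hT, hg⟩ := hg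
    exact of_dependsOn T hT fun x y h => congrArg φ (hg h)
  | zero =>
    simp only [Pi.zero_apply, map_zero]
    exact zero_mem _
  | add g h _ _ hg hh =>
    simp only [Pi.add_apply, map_add]
    exact add_mem hg hh

lemma pi [AddCommMonoid B] {m : ℕ} {g : (Fin k → X) → Fin m → B}
    (hg : ∀ l, (fun x => g x l) ∈ boundedWidth X B k d) :
    g ∈ boundedWidth X (Fin m → B) k d := by
  have : g = ∑ l, fun x => AddMonoidHom.single (fun _ : Fin m => B) l (g x l) := by
    funext x
    rw [Finset.sum_apply]
    exact (Finset.univ_sum_single (g x)).symm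
  rw [this]
  exact sum_mem fun l _ => map_addMonoidHom _ (hg l)

/-- Products of many elements of the augmentation ideal of `ℤ[B]` are divisible by any given
power of `p`, when `B` is a finite group of exponent a power of `p`. -/
lemma exists_pow_dvd_prod_single_sub_one [AddCommGroup B] [Finite B] {p β : ℕ} (hp : p.Prime)
    (hB : ∀ b : B, p ^ β • b = 0) (γ : ℕ) :
    ∃ D : ℕ, ∀ {ι : Type} (T : Finset ι) (u : ι → B), D < T.card →
      ((p ^ γ : ℕ) : AddMonoidAlgebra ℤ B) ∣
        ∏ i ∈ T, (AddMonoidAlgebra.single (u i) 1 - 1) := by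
  classical
  have := Fintype.ofFinite B
  have single_pow : ∀ (b : B) (n : ℕ),
      (AddMonoidAlgebra.single b 1 : AddMonoidAlgebra ℤ B) ^ n =
        AddMonoidAlgebra.single (n • b) 1 := by
    intro b n
    rw [AddMonoidAlgebra.single_pow, one_pow]
  have base : ∀ b : B, (p : AddMonoidAlgebra ℤ B) ∣
      (AddMonoidAlgebra.single b 1 - 1) ^ p ^ β := by
    intro b
    obtain ⟨r, hr⟩ := exists_add_pow_prime_pow_eq hp
      (AddMonoidAlgebra.single b 1 - 1 : AddMonoidAlgebra ℤ B) 1 β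
    rw [sub_add_cancel, single_pow, hB, one_pow, ← AddMonoidAlgebra.one_def] at hr
    refine ⟨-((AddMonoidAlgebra.single b 1 - 1) * r), ?_⟩
    linear_combination -hr
  refine ⟨Fintype.card B * (p ^ β * γ), fun T u hT => ?_⟩
  obtain ⟨b, -, hb⟩ := Finset.exists_lt_card_fiber_of_mul_lt_card_of_maps_to
    (f := u) (t := Finset.univ) (fun a _ => Finset.mem_univ _) hT
  calc ((p ^ γ : ℕ) : AddMonoidAlgebra ℤ B)
      ∣ (AddMonoidAlgebra.single b 1 - 1) ^ (p ^ β * γ) := by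
        rw [pow_mul, Nat.cast_pow]
        exact pow_dvd_pow_of_dvd (base b) γ
    _ ∣ (AddMonoidAlgebra.single b 1 - 1) ^ (Finset.card {x ∈ T | u x = b}) :=
        pow_dvd_pow _ hb.le
    _ = ∏ i ∈ T with u i = b, (AddMonoidAlgebra.single (u i) 1 - 1) := by
        rw [Finset.prod_congr rfl (g := fun _ => AddMonoidAlgebra.single b 1 - 1),
          Finset.prod_const]
        intro i hi
        rw [(Finset.mem_filter.mp hi).2]
    _ ∣ _ := Finset.prod_dvd_prod_of_subset _ _ _ (Finset.filter_subset _ _)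

/-- Composition with a fixed function between finite abelian `p`-groups increases the width at
most by a constant factor. -/
lemma exists_comp_mem [AddCommGroup B] [Finite B] [AddCommGroup C] {p β γ : ℕ} (hp : p.Prime)
    (hB : ∀ b : B, p ^ β • b = 0) (hC : ∀ c : C, p ^ γ • c = 0) (f : B → C) :
    ∃ D : ℕ, ∀ (k d : ℕ) (g : (Fin k → X) → B), g ∈ boundedWidth X B k d →
      (fun x => f (g x)) ∈ boundedWidth X C k (D * d) := by
  classical
  obtain ⟨D, hD⟩ := exists_pow_dvd_prod_single_sub_one hp hB γ
  refine ⟨D, fun k d g hg => ?_⟩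
  obtain ⟨l, hl, rfl⟩ := AddSubmonoid.exists_list_of_mem_closure hg
  choose T hT hdep using fun i : Fin l.length => hl l[i] (List.getElem_mem _)
  let F : AddMonoidAlgebra ℤ B →ₗ[ℤ] C :=
    (Finsupp.linearCombination ℤ f).comp (AddMonoidAlgebra.coeffLinearEquiv ℤ).toLinearMap
  have hF : ∀ b, F (AddMonoidAlgebra.single b 1) = f b := by
    intro b
    simp [F]
  have prod_single : ∀ (S : Finset (Fin l.length)) (u : Fin l.length → B),
      ∏ i ∈ S, (AddMonoidAlgebra.single (u i) 1 : AddMonoidAlgebra ℤ B) =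
        AddMonoidAlgebra.single (∑ i ∈ S, u i) 1 := by
    intro S u
    induction S using Finset.induction_on with
    | empty => rfl
    | insert i S hi ih =>
      rw [Finset.prod_insert hi, Finset.sum_insert hi, ih, AddMonoidAlgebra.single_mul_single,
        one_mul]
  have expand : (fun x => f (l.sum x)) = ∑ S : Finset (Fin l.length), fun x =>
      F (∏ i ∈ S, (AddMonoidAlgebra.single (l[i] x) 1 - 1)) := by
    funext x
    rw [Finset.sum_apply, ← hF, ← map_sum, ← Finset.powerset_univ, ← Finset.prod_one_add]
    simp only [add_sub_cancel]
    rw [prod_single, ← Finset.sum_apply]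
    exact congrArg (fun g : (Fin k → X) → B => F (AddMonoidAlgebra.single (g x) 1))
      (Fin.sum_univ_getElem l).symm
  rw [expand]
  refine sum_mem fun S _ => ?_
  by_cases hS : D < S.card
  · convert zero_mem (boundedWidth X C k (D * d)) using 1
    funext x
    obtain ⟨r, hr⟩ := hD S (fun i => l[i] x) hS
    rw [hr, ← nsmul_eq_mul, map_nsmul, hC]
    rfl
  · refine of_dependsOn (S.biUnion T) ?_ ?_
    · exact (Finset.card_biUnion_le_card_mul S T d fun i _ => hT i).trans
        (Nat.mul_le_mul_right d (not_lt.mp hS))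
    · intro x y hxy
      refine congrArg F (Finset.prod_congr rfl fun i hi => ?_)
      rw [hdep i fun j hj => hxy j (Finset.mem_coe.mpr (Finset.mem_biUnion.mpr ⟨i, hi, hj⟩))]

/-- A function of small width that vanishes whenever some argument is `z` vanishes. -/
lemma eq_zero_of_absorbing [AddCommGroup B] {g : (Fin k → X) → B}
    (hg : g ∈ boundedWidth X B k d) (hd : d < k) (z : X)
    (hz : ∀ x, (∃ i, x i = z) → g x = 0) (x : Fin k → X) : g x = 0 := by
  classical
  have key : ∑ S : Finset (Fin k), (-1 : ℤ) ^ S.card • g (S.piecewise x fun _ => z) = 0 := by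
    clear hz
    induction hg using AddSubmonoid.closure_induction with
    | mem g hg =>
      obtain ⟨T, hT, hg⟩ := hg
      obtain ⟨i, hi⟩ : ∃ i, i ∉ T := by
        by_contra! h
        rw [Finset.eq_univ_of_forall h, Finset.card_univ, Fintype.card_fin] at hT
        omega
      refine Finset.sum_involution (fun S _ => symmDiff S {i}) ?_ ?_ ?_ ?_
      · intro S _
        have hval : g ((symmDiff S {i}).piecewise x fun _ => z) =
            g (S.piecewise x fun _ => z) := by
          refine hg fun j hj => ?_
          have hij : j ≠ i := fun h => hi (h ▸ hj)
          simp [Finset.piecewise, Finset.mem_symmDiff, hij]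
        rw [hval, ← add_smul]
        by_cases hiS : i ∈ S
        · have : symmDiff S {i} = S.erase i := by
            ext j; by_cases h : j = i <;> simp [Finset.mem_symmDiff, h, hiS]
          rw [this, ← Finset.card_erase_add_one hiS, pow_succ]
          simp
        · have : symmDiff S {i} = insert i S := by
            ext j; by_cases h : j = i <;> simp [Finset.mem_symmDiff, h, hiS]
          rw [this, Finset.card_insert_of_notMem hiS, pow_succ]
          simp
      · intro S _ _ h
        rw [symmDiff_eq_left] at h
        exact Finset.singleton_ne_empty i h
      · exact fun _ _ => Finset.mem_univ _
      · intro S _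
        exact symmDiff_symmDiff_cancel_right _ _
    | zero => simp
    | add g h _ _ hg hh => simp [smul_add, Finset.sum_add_distrib, hg, hh]
  rw [Finset.sum_eq_single Finset.univ] at key
  · rw [Finset.piecewise_univ] at key
    rcases neg_one_pow_eq_or ℤ (Finset.univ : Finset (Fin k)).card with h | h <;> rw [h] at key
    · rwa [one_smul] at key
    · rwa [neg_one_smul, neg_eq_zero] at key
  · intro S _ hS
    obtain ⟨i, hi⟩ : ∃ i, i ∉ S := by
      by_contra! h
      exact hS (Finset.eq_univ_of_forall h)
    rw [hz _ ⟨i, by simp [hi]⟩, smul_zero]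
  · exact fun h => absurd (Finset.mem_univ _) h

end boundedWidth

/-- Compatibility of a finitary function on an abelian group in additive notation. -/
def AddCompat {G ι : Type*} [AddCommGroup G] (f : (ι → G) → G) : Prop :=
  ∀ (N : AddSubgroup G) (a b : ι → G), (∀ i, b i - a i ∈ N) → f b - f a ∈ N

/-- A binary compatible function vanishing whenever one of its arguments does. -/
structure IsAbsorbing {G : Type*} [AddCommGroup G] (c : G → G → G) : Prop where
  left : ∀ (N : AddSubgroup G) (x y z : G), x - y ∈ N → c x z - c y z ∈ N
  right : ∀ (N : AddSubgroup G) (x y z : G), y - z ∈ N → c x y - c x z ∈ N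
  zero_left : ∀ y, c 0 y = 0
  zero_right : ∀ x, c x 0 = 0

section AddCommGroup

variable {G ι : Type*} [AddCommGroup G]

lemma IsAbsorbing.mem_left {c : G → G → G} (hc : IsAbsorbing c) (x y : G) :
    c x y ∈ AddSubgroup.zmultiples x := by
  simpa [hc.zero_left] using
    hc.left (AddSubgroup.zmultiples x) x 0 y (by simp [AddSubgroup.mem_zmultiples])

lemma IsAbsorbing.mem_right {c : G → G → G} (hc : IsAbsorbing c) (x y : G) :
    c x y ∈ AddSubgroup.zmultiples y := by
  simpa [hc.zero_right] using
    hc.right (AddSubgroup.zmultiples y) x y 0 (by simp [AddSubgroup.mem_zmultiples])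

lemma AddCompat.isAbsorbing_secondDiff [DecidableEq ι] {f : (ι → G) → G} (hf : AddCompat f)
    (x : ι → G) (i j : ι) :
    IsAbsorbing fun u v => f (x + Pi.single i u + Pi.single j v) - f (x + Pi.single i u)
      - f (x + Pi.single j v) + f x := by
  have single_mem : ∀ (N : AddSubgroup G) (i : ι) (u v : G), u - v ∈ N → ∀ l,
      (Pi.single i u - Pi.single i v : ι → G) l ∈ N := by
    intro N i u v h l
    rw [← Pi.single_sub]
    by_cases hl : l = i
    · subst hl; simpa using h
    · simp [hl]
  refine ⟨fun N u v w h => ?_, fun N w u v h => ?_, fun y => ?_, fun y => ?_⟩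
  · have h1 := hf N (x + Pi.single i v + Pi.single j w) (x + Pi.single i u + Pi.single j w)
      fun l => by simpa using single_mem N i u v h l
    have h2 := hf N (x + Pi.single i v) (x + Pi.single i u)
      fun l => by simpa using single_mem N i u v h l
    convert sub_mem h1 h2 using 1
    abel
  · have h1 := hf N (x + Pi.single i w + Pi.single j v) (x + Pi.single i w + Pi.single j u)
      fun l => by simpa using single_mem N j u v h l
    have h2 := hf N (x + Pi.single j v) (x + Pi.single j u)
      fun l => by simpa using single_mem N j u v h l
    convert sub_mem h1 h2 using 1
    abel
  · simp
  · simp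

/-- If all absorbing functions map `G × H` into `K`, then every compatible function is additive
modulo `K` in directions from `H`. -/
lemma AddCompat.secondDiff_mem [Finite ι] {H K : AddSubgroup G}
    (hHK : ∀ c : G → G → G, IsAbsorbing c → ∀ u, ∀ v ∈ H, c u v ∈ K)
    {f : (ι → G) → G} (hf : AddCompat f) (x U V : ι → G) (hV : ∀ l, V l ∈ H) :
    f (x + U + V) - f (x + U) - f (x + V) + f x ∈ K := by
  classical
  have := Fintype.ofFinite ι
  have step1 : ∀ (j : ι) (s : Finset ι) (x : ι → G),
      f (x + ∑ i ∈ s, Pi.single i (U i) + Pi.single j (V j)) - f (x + ∑ i ∈ s, Pi.single i (U i))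
        - f (x + Pi.single j (V j)) + f x ∈ K := by
    intro j s
    induction s using Finset.induction_on with
    | empty => intro x; simp
    | insert i s hi ih =>
      intro x
      have h := hHK _ (hf.isAbsorbing_secondDiff (x + ∑ i ∈ s, Pi.single i (U i)) i j)
        (U i) (V j) (hV j)
      convert add_mem h (ih x) using 1
      rw [Finset.sum_insert hi, add_comm (Pi.single (M := fun _ => G) i (U i)), ← add_assoc]
      abel
  have step2 : ∀ (s : Finset ι) (x : ι → G),
      f (x + U + ∑ j ∈ s, Pi.single j (V j)) - f (x + U)
        - f (x + ∑ j ∈ s, Pi.single j (V j)) + f x ∈ K := by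
    intro s
    induction s using Finset.induction_on with
    | empty => intro x; simp
    | insert j s hj ih =>
      intro x
      have h := step1 j Finset.univ (x + ∑ j ∈ s, Pi.single j (V j))
      rw [Finset.univ_sum_single] at h
      convert add_mem h (ih x) using 1
      rw [Finset.sum_insert hj, add_comm (Pi.single (M := fun _ => G) j (V j)), ← add_assoc,
        ← add_assoc,
        add_right_comm x U]
      abel
  simpa only [Finset.univ_sum_single] using step2 Finset.univ x

lemma mem_zmultiples_zsmul {p i : ℕ} (hp : p.Prime) {y : G} (hy : p ^ (i + 1) • y = 0) {n : ℤ}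
    (hn : p ^ i • n • y ≠ 0) : y ∈ AddSubgroup.zmultiples (n • y) := by
  have hcop : IsCoprime n (p ^ (i + 1) : ℕ) := by
    rw [Nat.cast_pow]
    refine IsCoprime.pow_right ?_
    rw [isCoprime_comm, (Nat.prime_iff_prime_int.mp hp).coprime_iff_not_dvd]
    rintro ⟨m, rfl⟩
    apply hn
    rw [mul_comm, mul_smul, smul_comm, natCast_zsmul, smul_smul, ← pow_succ, hy, smul_zero]
  obtain ⟨a, b, hab⟩ := hcop
  refine ⟨a, ?_⟩
  have : (a * n + b * (p ^ (i + 1) : ℕ)) • y = y := by rw [hab, one_smul]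
  rw [add_smul, mul_smul, mul_smul, natCast_zsmul, hy, smul_zero, add_zero] at this
  exact this

lemma eq_zero_of_mem_zmultiples {p : ℕ} (hp : p.Prime) {s z : G} (hs : p • s = 0)
    (hz : z ∈ AddSubgroup.zmultiples s) {N : AddSubgroup G} (hzN : z ∈ N) (hsN : s ∉ N) :
    z = 0 := by
  obtain ⟨n, rfl⟩ := AddSubgroup.mem_zmultiples_iff.mp hz
  by_contra h
  have := mem_zmultiples_zsmul (i := 0) hp (by simpa using hs) (n := n) (by simpa using h)
  exact hsN ((AddSubgroup.zmultiples_le_of_mem hzN) this)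

/-- If no cyclic subgroup contains all elements of order `p`, the torsion filtration
`{y | p ^ i • y = 0}` is central for compatible functions. -/
lemma IsAbsorbing.pow_smul_eq_zero {p : ℕ} (hp : p.Prime)
    (hG : ∀ x : G, ∃ s : G, p • s = 0 ∧ s ∉ AddSubgroup.zmultiples x) {c : G → G → G}
    (hc : IsAbsorbing c) {i : ℕ} (x y : G) (hy : p ^ (i + 1) • y = 0) : p ^ i • c x y = 0 := by
  by_contra hne
  obtain ⟨s, hs, hsx⟩ := hG x
  have hmem : ∀ z, p ^ (i + 1) • z = 0 → p ^ i • c x z ≠ 0 → z ∈ AddSubgroup.zmultiples x := by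
    intro z hz hne
    obtain ⟨n, hn⟩ := AddSubgroup.mem_zmultiples_iff.mp (hc.mem_right x z)
    rw [← hn] at hne
    have := mem_zmultiples_zsmul hp hz hne
    rw [hn] at this
    exact AddSubgroup.zmultiples_le_of_mem (hc.mem_left x z) this
  have hsub : c x (y + s) - c x y = 0 := by
    refine eq_zero_of_mem_zmultiples hp hs (hc.right _ x (y + s) y ?_)
      (sub_mem (hc.mem_left x _) (hc.mem_left x _)) hsx
    simp
  have hys : y + s ∈ AddSubgroup.zmultiples x := by
    refine hmem _ ?_ ?_
    · rw [smul_add, hy, pow_succ, mul_smul, hs, smul_zero, add_zero]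
    · rwa [sub_eq_zero.mp hsub]
  exact hsx (by simpa using sub_mem hys (hmem y hy hne))

lemma exists_notMem_zmultiples_of_not_isAddCyclic [Finite G] {p a : ℕ} (hp : p.Prime)
    (hG : ∀ x : G, p ^ a • x = 0) (hcyc : ¬ IsAddCyclic G) (x : G) :
    ∃ s : G, p • s = 0 ∧ s ∉ AddSubgroup.zmultiples x := by
  classical
  have := Fintype.ofFinite G
  by_contra! hx
  apply hcyc
  have hsoc : Nat.card (nsmulAddMonoidHom (α := G) p).ker ≤ p := by
    have hle := IsAddCyclic.card_nsmul_eq_zero_le (α := AddSubgroup.zmultiples x) hp.pos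
    refine le_trans ?_ hle
    rw [← Fintype.card_coe, ← Nat.card_eq_fintype_card]
    refine Nat.card_le_card_of_injective
      (fun s => ⟨⟨s.1, hx s.1 s.2⟩, ?_⟩) ?_
    · simp only [Finset.mem_filter, Finset.mem_univ, true_and]
      exact Subtype.ext s.2
    · intro s t h
      exact Subtype.ext (congrArg (fun z => (z.1.1 : G)) h)
  have htor : ∀ i, Nat.card (nsmulAddMonoidHom (α := G) (p ^ i)).ker ≤ p ^ i := by
    intro i
    induction i with
    | zero =>
      have : (nsmulAddMonoidHom (α := G) (p ^ 0)).ker = ⊥ := by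
        ext z; simp
      rw [this]; simp
    | succ i ih =>
      set K := (nsmulAddMonoidHom (α := G) (p ^ (i + 1))).ker
      let φ : K →+ G := (nsmulAddMonoidHom (α := G) p).comp K.subtype
      have h1 : Nat.card φ.ker ≤ p := by
        refine le_trans ?_ hsoc
        refine Nat.card_le_card_of_injective (fun z => ⟨z.1.1, z.2⟩) ?_
        intro s t h
        exact Subtype.ext (Subtype.ext (Subtype.mk.inj h))
      have h2 : Nat.card φ.range ≤ p ^ i := by
        refine le_trans ?_ ih
        refine Nat.card_le_card_of_injective (AddSubgroup.inclusion ?_)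
          (AddSubgroup.inclusion_injective _)
        rintro _ ⟨z, rfl⟩
        have hz : p ^ (i + 1) • z.1 = 0 := z.2
        change p ^ i • p • z.1 = 0
        rwa [smul_smul, ← pow_succ]
      rw [AddSubgroup.card_eq_card_quotient_mul_card_addSubgroup φ.ker,
        Nat.card_congr (QuotientAddGroup.quotientKerEquivRange φ).toEquiv, pow_succ]
      exact Nat.mul_le_mul h2 h1
  refine isAddCyclic_of_card_nsmul_eq_zero_le fun n hn => ?_
  obtain ⟨i, hi, hgcd⟩ := (Nat.dvd_prime_pow hp).mp (Nat.gcd_dvd_right n (p ^ a))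
  have hle : p ^ i ≤ n := hgcd ▸ Nat.gcd_le_left _ hn
  refine le_trans ?_ ((htor i).trans hle)
  rw [← Fintype.card_coe, ← Nat.card_eq_fintype_card]
  refine Nat.card_le_card_of_injective (fun z => ⟨z.1, ?_⟩) ?_
  · have hz : n • z.1 = 0 := (Finset.mem_filter.mp z.2).2
    change p ^ i • z.1 = 0
    rw [← hgcd]
    exact addOrderOf_dvd_iff_nsmul_eq_zero.mp (Nat.dvd_gcd
      (addOrderOf_dvd_iff_nsmul_eq_zero.mpr hz) (addOrderOf_dvd_iff_nsmul_eq_zero.mpr (hG _)))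
  · intro s t h
    exact Subtype.ext (Subtype.mk.inj h)

end AddCommGroup

section AffineComplete

variable {G ι : Type*} [AddCommGroup G]

lemma pow_smul_mem_zmultiples_of_mem {p b : ℕ} (hp : p.Prime) {e z : G}
    (he : p ^ (b + 1) • e = 0) (hz : z ∈ AddSubgroup.zmultiples e) (hz0 : z ≠ 0) :
    p ^ b • e ∈ AddSubgroup.zmultiples z := by
  induction b generalizing e z with
  | zero =>
    obtain ⟨n, rfl⟩ := AddSubgroup.mem_zmultiples_iff.mp hz
    simpa using mem_zmultiples_zsmul (i := 0) hp he (n := n) (by simpa using hz0)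
  | succ b ih =>
    obtain ⟨n, rfl⟩ := AddSubgroup.mem_zmultiples_iff.mp hz
    by_cases h : p ^ (b + 1) • n • e = 0
    · by_cases hn : (p : ℤ) ∣ n
      · obtain ⟨m, rfl⟩ := hn
        rw [mul_comm, mul_smul, natCast_zsmul] at hz0 ⊢
        have := ih (e := p • e) (z := m • p • e) (by rwa [smul_smul, ← pow_succ])
          (AddSubgroup.zsmul_mem_zmultiples _ _) hz0
        rwa [smul_smul, ← pow_succ] at this
      · have hcop : IsCoprime n (p : ℤ) := by
          rwa [isCoprime_comm, (Nat.prime_iff_prime_int.mp hp).coprime_iff_not_dvd]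
        obtain ⟨x, y, hxy⟩ := hcop
        have h1 : p ^ (b + 1) • e = 0 := by
          have : (x * n + y * p) • p ^ (b + 1) • e = p ^ (b + 1) • e := by rw [hxy, one_smul]
          rw [add_smul, mul_smul, mul_smul, smul_comm n, h, natCast_zsmul, smul_smul p,
            ← pow_succ', he, smul_zero, smul_zero, add_zero] at this
          exact this.symm
        rw [h1]
        exact zero_mem _
    · exact nsmul_mem (mem_zmultiples_zsmul hp he h) _

lemma exists_pow_smul_ne_zero {p a : ℕ} {y : G} (hy : p ^ a • y = 0) (hy0 : y ≠ 0) :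
    ∃ j, p ^ (j + 1) • y = 0 ∧ p ^ j • y ≠ 0 := by
  classical
  have hex : ∃ a, p ^ a • y = 0 := ⟨a, hy⟩
  obtain ⟨j, hj⟩ := Nat.exists_eq_succ_of_ne_zero (n := Nat.find hex) fun h => by
    have := Nat.find_spec hex
    rw [h, pow_zero, one_smul] at this
    exact hy0 this
  exact ⟨j, by simpa [hj] using Nat.find_spec hex, Nat.find_min hex (by omega)⟩

/-- If `e₁` and `e₂` have maximal order and their socles differ, any cyclic subgroup meets one of
the subgroups they generate trivially. -/
lemma disjoint_or_disjoint {p b : ℕ} (hp : p.Prime) (hG : ∀ x : G, p ^ (b + 1) • x = 0)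
    {e₁ e₂ : G} (he₁ : p ^ b • e₁ ≠ 0)
    (he : p ^ b • e₂ ∉ AddSubgroup.zmultiples (p ^ b • e₁)) (y : G) :
    Disjoint (AddSubgroup.zmultiples e₁) (AddSubgroup.zmultiples y) ∨
      Disjoint (AddSubgroup.zmultiples e₂) (AddSubgroup.zmultiples y) := by
  simp only [AddSubgroup.disjoint_def]
  by_contra! h
  obtain ⟨⟨z₁, hz₁, hy₁, hz₁0⟩, z₂, hz₂, hy₂, hz₂0⟩ := h
  have h₁ : p ^ b • e₁ ∈ AddSubgroup.zmultiples y :=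
    AddSubgroup.zmultiples_le_of_mem hy₁ (pow_smul_mem_zmultiples_of_mem hp (hG _) hz₁ hz₁0)
  have h₂ : p ^ b • e₂ ∈ AddSubgroup.zmultiples y :=
    AddSubgroup.zmultiples_le_of_mem hy₂ (pow_smul_mem_zmultiples_of_mem hp (hG _) hz₂ hz₂0)
  have hy0 : y ≠ 0 := by
    rintro rfl
    rw [AddSubgroup.zmultiples_zero_eq_bot, AddSubgroup.mem_bot] at hy₁
    exact hz₁0 hy₁
  obtain ⟨j, hj, hj0⟩ := exists_pow_smul_ne_zero (hG y) hy0
  obtain ⟨m, hm⟩ := AddSubgroup.mem_zmultiples_iff.mp h₂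
  have hpm : ((p * m : ℤ)) • y = 0 := by
    rw [mul_smul, hm, natCast_zsmul, smul_smul, ← pow_succ', hG]
  have := Fact.mk hp
  rw [← addOrderOf_dvd_iff_zsmul_eq_zero, addOrderOf_eq_prime_pow hj0 hj, Nat.cast_pow, pow_succ',
    mul_dvd_mul_iff_left (by exact_mod_cast hp.ne_zero)] at hpm
  obtain ⟨q, rfl⟩ := hpm
  have hjy : p ^ j • y ∈ AddSubgroup.zmultiples (p ^ b • e₁) :=
    pow_smul_mem_zmultiples_of_mem hp hj h₁ he₁
  apply he
  rw [← hm, mul_comm, mul_smul, ← Nat.cast_pow, natCast_zsmul]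
  exact zsmul_mem hjy q

lemma smul_eq_zero_of_smul_eq_zero {p b : ℕ} (hp : p.Prime) (hG : ∀ x : G, p ^ (b + 1) • x = 0)
    {e : G} (he : p ^ b • e ≠ 0) {n : ℤ} (hn : n • e = 0) (x : G) : n • x = 0 := by
  have := Fact.mk hp
  rw [← addOrderOf_dvd_iff_zsmul_eq_zero, addOrderOf_eq_prime_pow he (hG e)] at hn
  obtain ⟨m, rfl⟩ := hn
  rw [mul_comm, mul_smul, natCast_zsmul, hG, smul_zero]

/-- A unary compatible function that fixes `0` is a multiplication by an integer if there are two
independent elements of maximal order. -/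
lemma exists_zsmul_of_unary {p b : ℕ} (hp : p.Prime) (hG : ∀ x : G, p ^ (b + 1) • x = 0)
    {e₁ e₂ : G} (he₁ : p ^ b • e₁ ≠ 0) (he : p ^ b • e₂ ∉ AddSubgroup.zmultiples (p ^ b • e₁))
    {f : G → G} (hf : ∀ (N : AddSubgroup G) (x y : G), x - y ∈ N → f x - f y ∈ N)
    (hf0 : f 0 = 0) : ∃ m : ℤ, ∀ y, f y = m • y := by
  have he₂ : p ^ b • e₂ ≠ 0 := fun h => he (h ▸ zero_mem _)
  have mem_self : ∀ (h : G → G), (∀ (N : AddSubgroup G) (x y : G), x - y ∈ N → h x - h y ∈ N) →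
      h 0 = 0 → ∀ y, h y ∈ AddSubgroup.zmultiples y := by
    intro h hh h0 y
    simpa [h0] using hh (AddSubgroup.zmultiples y) y 0 (by simp [AddSubgroup.mem_zmultiples])
  obtain ⟨m, hm⟩ := AddSubgroup.mem_zmultiples_iff.mp (mem_self f hf hf0 e₁)
  refine ⟨m, fun y => ?_⟩
  let h : G → G := fun y => f y - m • y
  have hh : ∀ (N : AddSubgroup G) (x y : G), x - y ∈ N → h x - h y ∈ N := by
    intro N x y hxy
    convert sub_mem (hf N x y hxy) (zsmul_mem hxy m) using 1
    simp only [h, smul_sub]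
    abel
  have hh0 : h 0 = 0 := by simp [h, hf0]
  have transfer : ∀ e, p ^ b • e ≠ 0 → h e = 0 → ∀ y,
      Disjoint (AddSubgroup.zmultiples e) (AddSubgroup.zmultiples y) → h y = 0 := by
    intro e he hhe y hey
    rw [AddSubgroup.disjoint_def] at hey
    have h1 : h (e + y) ∈ AddSubgroup.zmultiples y := by
      simpa [hhe] using hh (AddSubgroup.zmultiples y) (e + y) e (by simp)
    obtain ⟨l, hl⟩ := AddSubgroup.mem_zmultiples_iff.mp (mem_self h hh hh0 (e + y))
    have h2 : l • e = 0 := by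
      refine hey (AddSubgroup.zsmul_mem_zmultiples _ _) ?_
      rw [← hl, smul_add] at h1
      simpa using sub_mem h1 (zsmul_mem (AddSubgroup.mem_zmultiples y) l)
    have h3 : h (e + y) = 0 := by
      rw [← hl, smul_eq_zero_of_smul_eq_zero hp hG he h2]
    refine hey ?_ (mem_self h hh hh0 y)
    simpa [h3] using hh (AddSubgroup.zmultiples e) y (e + y) (by simp)
  have hh₁ : h e₁ = 0 := by simp [h, hm]
  have hh₂ : h e₂ = 0 := by
    refine transfer e₁ he₁ hh₁ e₂ ((disjoint_or_disjoint hp hG he₁ he e₂).resolve_right ?_)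
    rw [disjoint_self, AddSubgroup.zmultiples_eq_bot]
    rintro rfl
    simp at he₂
  refine sub_eq_zero.mp (?_ : h y = 0)
  rcases disjoint_or_disjoint hp hG he₁ he y with hy | hy
  · exact transfer e₁ he₁ hh₁ y hy
  · exact transfer e₂ he₂ hh₂ y hy

/-- An abelian `p`-group with two independent elements of maximal order is affine complete. -/
lemma AddCompat.exists_affine [Fintype ι] {p b : ℕ} (hp : p.Prime)
    (hG : ∀ x : G, p ^ (b + 1) • x = 0) {e₁ e₂ : G} (he₁ : p ^ b • e₁ ≠ 0)
    (he : p ^ b • e₂ ∉ AddSubgroup.zmultiples (p ^ b • e₁)) {f : (ι → G) → G}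
    (hf : AddCompat f) : ∃ (c : G) (m : ι → ℤ), ∀ x, f x = c + ∑ i, m i • x i := by
  classical
  have he₂ : p ^ b • e₂ ≠ 0 := fun h => he (h ▸ zero_mem _)
  have habs : ∀ c : G → G → G, IsAbsorbing c → ∀ u, ∀ v ∈ (⊤ : AddSubgroup G),
      c u v ∈ (⊥ : AddSubgroup G) := by
    intro c hc u v _
    obtain ⟨m, hm⟩ := exists_zsmul_of_unary hp hG he₁ he (fun N x y => hc.right N u x y)
      (hc.zero_right u)
    have hmem : ∀ e, m • e ∈ AddSubgroup.zmultiples u := fun e => hm e ▸ hc.mem_left u e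
    rw [AddSubgroup.mem_bot, hm]
    rcases disjoint_or_disjoint hp hG he₁ he u with h | h <;> rw [AddSubgroup.disjoint_def] at h
    · exact smul_eq_zero_of_smul_eq_zero hp hG he₁
        (h (AddSubgroup.zsmul_mem_zmultiples _ _) (hmem e₁)) v
    · exact smul_eq_zero_of_smul_eq_zero hp hG he₂
        (h (AddSubgroup.zsmul_mem_zmultiples _ _) (hmem e₂)) v
  have hadd : ∀ U V, f (U + V) - f 0 = (f U - f 0) + (f V - f 0) := by
    intro U V
    have := hf.secondDiff_mem habs 0 U V fun _ => AddSubgroup.mem_top _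
    rw [AddSubgroup.mem_bot, zero_add, zero_add] at this
    rw [← sub_eq_zero, ← this]
    abel
  let φ : (ι → G) →+ G := AddMonoidHom.mk' (fun x => f x - f 0) hadd
  have hφ : ∀ i, ∃ m : ℤ, ∀ y, φ (Pi.single i y) = m • y := by
    intro i
    refine exists_zsmul_of_unary hp hG he₁ he (fun N x y hxy => ?_) (by simp)
    rw [← map_sub, ← Pi.single_sub]
    refine hf N 0 _ fun l => ?_
    by_cases hl : l = i
    · subst hl; simpa using hxy
    · simp [hl]
  choose m hm using hφ
  refine ⟨f 0, m, fun x => ?_⟩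
  have hx : φ x = ∑ i, m i • x i := by
    conv_lhs => rw [← Finset.univ_sum_single x, map_sum]
    exact Finset.sum_congr rfl fun i _ => hm i (x i)
  rw [← hx]
  exact (add_sub_cancel (f 0) (f x)).symm

end AffineComplete

section FiniteGeneration

variable {G : Type*} [AddCommGroup G]

/-- The image of `{y | p ^ (i + 1) • y = 0}` under multiplication by `p ^ i`, isomorphic to a layer
of the torsion filtration. -/
def torsionLayer (G : Type*) [AddCommGroup G] (p i : ℕ) : AddSubgroup G :=
  (nsmulAddMonoidHom (p ^ (i + 1))).ker.map (nsmulAddMonoidHom (p ^ i))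

lemma mem_torsionLayer {p i : ℕ} {y : G} (hy : p ^ (i + 1) • y = 0) :
    p ^ i • y ∈ torsionLayer G p i :=
  ⟨y, hy, rfl⟩

lemma AddCompat.smul_sub_eq_zero {ι : Type*} {f : (ι → G) → G} (hf : AddCompat f) (n : ℕ)
    {x y : ι → G} (h : ∀ l, n • (y l - x l) = 0) : n • (f y - f x) = 0 :=
  hf (nsmulAddMonoidHom (α := G) n).ker x y h

lemma AddCompat.exists_layerHom {p i : ℕ} (hp : p.Prime)
    (hG : ∀ x : G, ∃ s : G, p • s = 0 ∧ s ∉ AddSubgroup.zmultiples x) {m : ℕ}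
    {f : (Fin m → G) → G} (hf : AddCompat f) :
    ∃ φ : (Fin m → torsionLayer G p i) →+ torsionLayer G p i,
      ∀ (v : Fin m → torsionLayer G p i) (x ω : Fin m → G), (∀ l, p ^ (i + 1) • ω l = 0) →
        (∀ l, (v l : G) = p ^ i • ω l) → (φ v : G) = p ^ i • (f (x + ω) - f x) := by
  have hdiff : ∀ x U V : Fin m → G, (∀ l, p ^ (i + 1) • V l = 0) →
      p ^ i • (f (x + U + V) - f (x + U) - f (x + V) + f x) = 0 := fun x U V hV =>
    hf.secondDiff_mem (H := (nsmulAddMonoidHom (α := G) (p ^ (i + 1))).ker)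
      (K := (nsmulAddMonoidHom (α := G) (p ^ i)).ker)
      (fun c hc u v hv => hc.pow_smul_eq_zero hp hG u v hv) x U V hV
  choose ρ hρ hρv using fun v : torsionLayer G p i => v.2
  have hρ' : ∀ v, p ^ (i + 1) • ρ v = 0 := hρ
  have hρv' : ∀ v, p ^ i • ρ v = (v : G) := hρv
  let φ : (Fin m → torsionLayer G p i) →+ torsionLayer G p i :=
    AddMonoidHom.mk' (fun v => ⟨p ^ i • (f (fun l => ρ (v l)) - f 0),
      mem_torsionLayer (hf.smul_sub_eq_zero _ fun l => by simp [hρ'])⟩) (by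
        intro v w
        apply Subtype.ext
        have h1 := hdiff 0 (fun l => ρ (v l)) (fun l => ρ (w l)) fun l => hρ' _
        have h2 := hf.smul_sub_eq_zero (p ^ i) (x := (fun l => ρ (v l)) + fun l => ρ (w l))
          (y := fun l => ρ ((v + w) l)) fun l => by simp [smul_sub, smul_add, hρv']
        rw [zero_add, zero_add] at h1
        change p ^ i • (f (fun l => ρ ((v + w) l)) - f 0) =
          p ^ i • (f (fun l => ρ (v l)) - f 0) + p ^ i • (f (fun l => ρ (w l)) - f 0)
        linear_combination (norm := module) h1 + h2)
  refine ⟨φ, fun v x ω hω hv => ?_⟩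
  have h1 := hdiff 0 x ω hω
  have h2 := hf.smul_sub_eq_zero (p ^ i) (x := ω) (y := fun l => ρ (v l))
    fun l => by rw [smul_sub, hρv', hv, sub_self]
  change p ^ i • (f (fun l => ρ (v l)) - f 0) = _
  rw [zero_add, zero_add] at h1
  linear_combination (norm := module) h2 - h1

/-- In a noncyclic `p`-group, the width of the functions in a finitely generated clone of
compatible functions is bounded: passage to the next layer of the torsion filtration. -/
lemma exists_width_step [Finite G] {p a i : ℕ} (hp : p.Prime) (hG : ∀ x : G, p ^ a • x = 0)
    (hsoc : ∀ x : G, ∃ s : G, p • s = 0 ∧ s ∉ AddSubgroup.zmultiples x) {F : Set (FinOp G)}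
    (hF : F.Finite) (hFc : ∀ f ∈ F, AddCompat f.2) {d : ℕ}
    (hd : ∀ (k : ℕ) (t : (Fin k → G) → G), InClone F t →
      (fun x => p ^ (i + 1) • t x) ∈ boundedWidth G G k d) :
    ∃ d', ∀ (k : ℕ) (t : (Fin k → G) → G), InClone F t →
      (fun x => p ^ i • t x) ∈ boundedWidth G G k d' := by
  let σ : G → G := Function.invFun fun x => p ^ (i + 1) • x
  have hσ : ∀ x, p ^ (i + 1) • σ (p ^ (i + 1) • x) = p ^ (i + 1) • x :=
    fun x => Function.invFun_eq (f := fun x : G => p ^ (i + 1) • x) ⟨x, rfl⟩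
  have hσ' : ∀ y, p ^ (i + 1) • (y - σ (p ^ (i + 1) • y)) = 0 := by
    intro y
    rw [smul_sub, hσ, sub_self]
  let δ : G → torsionLayer G p i := fun y =>
    ⟨p ^ i • (y - σ (p ^ (i + 1) • y)), mem_torsionLayer (hσ' y)⟩
  have hpi : ∀ (m : ℕ) (x : Fin m → G), p ^ a • x = 0 := fun m x => funext fun l => hG (x l)
  have hlayer : ∀ v : torsionLayer G p i, p ^ a • v = 0 := fun v => Subtype.ext (hG v)
  obtain ⟨Dσ, hDσ⟩ := boundedWidth.exists_comp_mem (X := G) hp hG hG fun z => p ^ i • σ z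
  choose D hD using fun f : FinOp G => boundedWidth.exists_comp_mem (X := G) hp (hpi f.1) hlayer
    fun z => δ (f.2 fun l => σ (z l))
  obtain ⟨B, hB⟩ := (hF.image D).bddAbove
  let w := max 1 (B * d)
  have hgood : ∀ (m : ℕ) (t : (Fin m → G) → G), InClone F t →
      ∀ (n : ℕ) (g : Fin m → (Fin n → G) → G), (∀ l, InClone F (g l)) →
        (∀ l, (fun x => δ (g l x)) ∈ boundedWidth G (torsionLayer G p i) n w) →
          (fun x => δ (t fun l => g l x)) ∈ boundedWidth G (torsionLayer G p i) n w := by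
    intro m t ht
    induction ht with
    | proj j => exact fun n g _ hg => hg j
    | @base m f hf =>
      intro n g hgc hg
      obtain ⟨φ, hφ⟩ := (hFc _ hf).exists_layerHom (i := i) hp hsoc
      have hsplit : (fun x => δ (f fun l => g l x)) =
          (fun x => δ (f fun l => σ (p ^ (i + 1) • g l x))) +
            fun x => φ fun l => δ (g l x) := by
        funext x
        apply Subtype.ext
        have h1 := hφ (fun l => δ (g l x)) (fun l => σ (p ^ (i + 1) • g l x))
          (fun l => g l x - σ (p ^ (i + 1) • g l x)) (fun l => hσ' _) fun l => rfl
        have h2 : ((fun l => σ (p ^ (i + 1) • g l x)) +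
            fun l => g l x - σ (p ^ (i + 1) • g l x)) = fun l => g l x := by
          funext l
          simp
        have h3 : p ^ (i + 1) • f (fun l => g l x) =
            p ^ (i + 1) • f fun l => σ (p ^ (i + 1) • g l x) := by
          rw [← sub_eq_zero, ← smul_sub]
          exact (hFc _ hf).smul_sub_eq_zero _ fun l => hσ' _
        rw [h2] at h1
        rw [Pi.add_apply, AddSubgroup.coe_add, h1]
        change p ^ i • (_ - σ _) = p ^ i • (_ - σ _) + _
        rw [h3, ← smul_add]
        congr 1
        abel
      rw [hsplit]
      refine add_mem ?_ (boundedWidth.map_addMonoidHom φ (boundedWidth.pi hg))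
      refine boundedWidth.mono ?_ (hD ⟨m, f⟩ n d (fun x l => p ^ (i + 1) • g l x)
        (boundedWidth.pi fun l => hd n _ (hgc l)))
      exact (Nat.mul_le_mul_right d (hB ⟨_, hf, rfl⟩)).trans (le_max_right _ _)
    | comp f h _ hh ihf ihh =>
      intro n g hgc hg
      exact ihf n _ (fun l => InClone.comp _ _ (hh l) hgc) fun l => ihh l n g hgc hg
  refine ⟨max w (Dσ * d), fun k t ht => ?_⟩
  have hδ := hgood k t ht k (fun l x => x l) (fun l => InClone.proj l) fun l =>
    boundedWidth.of_dependsOn {l} ((Finset.card_singleton l).trans_le (le_max_left _ _))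
      fun x y hxy => by rw [hxy l (by simp)]
  have hsum : (fun x => p ^ i • t x) =
      (fun x => (torsionLayer G p i).subtype (δ (t x))) +
        fun x => p ^ i • σ (p ^ (i + 1) • t x) := by
    funext x
    change _ = p ^ i • (_ - σ _) + _
    rw [smul_sub, sub_add_cancel]
  rw [hsum]
  exact add_mem
    (boundedWidth.mono (le_max_left _ _) (boundedWidth.map_addMonoidHom _ hδ))
    (boundedWidth.mono (le_max_right _ _) (hDσ k d _ (hd k t ht)))

lemma exists_width_bound [Finite G] {p a : ℕ} (hp : p.Prime) (hG : ∀ x : G, p ^ a • x = 0)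
    (hsoc : ∀ x : G, ∃ s : G, p • s = 0 ∧ s ∉ AddSubgroup.zmultiples x) {F : Set (FinOp G)}
    (hF : F.Finite) (hFc : ∀ f ∈ F, AddCompat f.2) :
    ∃ d, ∀ (k : ℕ) (t : (Fin k → G) → G), InClone F t → t ∈ boundedWidth G G k d := by
  have : ∀ j ≤ a, ∃ d, ∀ (k : ℕ) (t : (Fin k → G) → G), InClone F t →
      (fun x => p ^ (a - j) • t x) ∈ boundedWidth G G k d := by
    intro j
    induction j with
    | zero =>
      refine fun _ => ⟨0, fun k t _ => ?_⟩
      simp only [Nat.sub_zero, hG]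
      exact zero_mem _
    | succ j ih =>
      intro hj
      obtain ⟨d, hd⟩ := ih (by omega)
      rw [show a - j = a - (j + 1) + 1 by omega] at hd
      exact exists_width_step hp hG hsoc hF hFc hd
  simpa using this a le_rfl

/-- If `p ^ b • G` has order `p`, any Boolean function of the coordinates modulo
`{x | p ^ b • x = 0}` with values in `p ^ b • G` is compatible. -/
lemma addCompat_ite {p b : ℕ} (hp : p.Prime) {u : G}
    (hu : p • u = 0) (hcyc : ∀ x : G, p ^ b • x ∈ AddSubgroup.zmultiples u) (ι : Type*)
    [DecidablePred fun x : ι → G => ∀ i, p ^ b • x i = u] :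
    AddCompat fun x : ι → G => if ∀ i, p ^ b • x i = u then u else 0 := by
  intro N x y hxy
  by_cases hN : ∀ n ∈ N, p ^ b • n = 0
  · have : ∀ i, p ^ b • y i = p ^ b • x i := fun i => by
      rw [← sub_eq_zero, ← smul_sub, hN _ (hxy i)]
    simp [this]
  · push Not at hN
    obtain ⟨n, hn, hn0⟩ := hN
    have huN : u ∈ N := by
      by_contra h
      exact hn0 (eq_zero_of_mem_zmultiples hp hu (hcyc n) (nsmul_mem hn _) h)
    beta_reduce
    split_ifs <;> simp [huN]

theorem exists_affine_of_finitelyGenerated [Finite G] {p a : ℕ} (hp : p.Prime)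
    (hG : ∀ x : G, p ^ a • x = 0) (hcyc : ¬ IsAddCyclic G) {F : Set (FinOp G)}
    (hF : F.Finite) (hFc : ∀ f ∈ F, AddCompat f.2)
    (hgen : ∀ n : ℕ, 1 ≤ n → ∀ f : (Fin n → G) → G, AddCompat f → InClone F f)
    {k : ℕ} {f : (Fin k → G) → G} (hf : AddCompat f) :
    ∃ (c : G) (m : Fin k → ℤ), ∀ x, f x = c + ∑ i, m i • x i := by
  classical
  have hsoc := exists_notMem_zmultiples_of_not_isAddCyclic hp hG hcyc
  obtain ⟨d, hd⟩ := exists_width_bound hp hG hsoc hF hFc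
  have hex : ∃ a, ∀ x : G, p ^ a • x = 0 := ⟨a, hG⟩
  obtain ⟨b, hb⟩ := Nat.exists_eq_succ_of_ne_zero (n := Nat.find hex) fun h => by
    have hspec := Nat.find_spec hex
    rw [h] at hspec
    obtain ⟨s, -, hs⟩ := hsoc 0
    have := hspec s
    rw [pow_zero, one_smul] at this
    exact hs (by rw [this]; exact zero_mem _)
  have hGb : ∀ x : G, p ^ (b + 1) • x = 0 := by
    have := Nat.find_spec hex
    rwa [hb] at this
  obtain ⟨e, he⟩ : ∃ e : G, p ^ b • e ≠ 0 := by
    have := Nat.find_min hex (m := b) (by omega)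
    push Not at this
    exact this
  by_cases hsplit : ∃ e₂ : G, p ^ b • e₂ ∉ AddSubgroup.zmultiples (p ^ b • e)
  · obtain ⟨e₂, he₂⟩ := hsplit
    exact hf.exists_affine hp hGb he he₂
  · push Not at hsplit
    exfalso
    have hcompat := addCompat_ite hp (u := p ^ b • e)
      (by rw [smul_smul, ← pow_succ', hGb]) hsplit (Fin (d + 1))
    have hzero := boundedWidth.eq_zero_of_absorbing (hd _ _ (hgen _ (by omega) _ hcompat))
      (by omega) 0 (by
        rintro x ⟨i, hi⟩
        refine if_neg fun h => he ?_
        rw [← h i, hi, smul_zero]) fun _ => e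
    simp [he] at hzero

end FiniteGeneration

section CommGroup

variable {A : Type*} [CommGroup A]

lemma compatible_iff_addCompat {n : ℕ} (f : (Fin n → A) → A) :
    Compatible f ↔ AddCompat (G := Additive A) f := by
  have hdiv : ∀ x y : A, x⁻¹ * y = y / x := fun x y => by rw [div_eq_mul_inv, mul_comm]
  simp only [Compatible, hdiv]
  exact ⟨fun h N a b hab => h (Subgroup.toAddSubgroup.symm N) a b hab,
    fun h N a b hab => h (Subgroup.toAddSubgroup N) a b hab⟩

lemma InClone.compatible {F : Set (FinOp A)} (hF : ∀ f ∈ F, Compatible f.2) {n : ℕ}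
    {f : (Fin n → A) → A} (hf : InClone F f) : Compatible f := by
  induction hf with
  | proj i => exact fun N a b hab => hab i
  | base f hf => exact hF _ hf
  | comp f g _ _ ihf ihg => exact fun N a b hab => ihf N _ _ fun i => ihg i N a b hab

lemma Compatible.mul {n : ℕ} {f g : (Fin n → A) → A} (hf : Compatible f) (hg : Compatible g) :
    Compatible fun x => f x * g x := by
  intro N a b hab
  convert mul_mem (hf N a b hab) (hg N a b hab) using 1
  rw [mul_inv, mul_mul_mul_comm]

lemma Compatible.inv {n : ℕ} {f : (Fin n → A) → A} (hf : Compatible f) :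
    Compatible fun x => (f x)⁻¹ := by
  intro N a b hab
  convert inv_mem (hf N a b hab) using 1
  rw [mul_inv, inv_inv]

/-- The unary and binary compatible functions. -/
def smallOps (A : Type*) [CommGroup A] : Set (FinOp A) :=
  {f | (f.1 = 1 ∨ f.1 = 2) ∧ Compatible f.2}

lemma finite_smallOps [Finite A] : (smallOps A).Finite := by
  refine ((Set.finite_range fun f : (Fin 1 → A) → A => (⟨1, f⟩ : FinOp A)).union
    (Set.finite_range fun f : (Fin 2 → A) → A => (⟨2, f⟩ : FinOp A))).subset ?_
  rintro ⟨n, f⟩ ⟨hn, -⟩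
  rcases hn with hn | hn
  · obtain rfl : n = 1 := hn
    exact Or.inl ⟨f, rfl⟩
  · obtain rfl : n = 2 := hn
    exact Or.inr ⟨f, rfl⟩

namespace InClone

variable {n : ℕ} {f g : (Fin n → A) → A}

lemma unary {u : A → A} (hu : Compatible fun x : Fin 1 → A => u (x 0))
    (hf : InClone (smallOps A) f) : InClone (smallOps A) fun x => u (f x) :=
  comp (fun x : Fin 1 → A => u (x 0)) (fun _ => f) (base _ ⟨Or.inl rfl, hu⟩) fun _ => hf

lemma binary {b : A → A → A} (hb : Compatible fun x : Fin 2 → A => b (x 0) (x 1))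
    (hf : InClone (smallOps A) f) (hg : InClone (smallOps A) g) :
    InClone (smallOps A) fun x => b (f x) (g x) :=
  comp (fun x : Fin 2 → A => b (x 0) (x 1)) ![f, g] (base _ ⟨Or.inr rfl, hb⟩)
    (Fin.forall_fin_two.mpr ⟨hf, hg⟩)

lemma const (hn : 1 ≤ n) (c : A) : InClone (smallOps A) fun _ : Fin n → A => c :=
  unary (u := fun _ => c) (fun N a b _ => by simp) (proj ⟨0, hn⟩)

lemma mul (hf : InClone (smallOps A) f) (hg : InClone (smallOps A) g) :
    InClone (smallOps A) fun x => f x * g x :=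
  binary (Compatible.mul (fun _ _ _ h => h 0) (fun _ _ _ h => h 1)) hf hg

lemma inv (hf : InClone (smallOps A) f) : InClone (smallOps A) fun x => (f x)⁻¹ :=
  unary (u := fun x => x⁻¹) (Compatible.inv fun _ _ _ h => h 0) hf

lemma zpow (hf : InClone (smallOps A) f) (m : ℤ) : InClone (smallOps A) fun x => f x ^ m :=
  unary (u := fun x => x ^ m) (fun N a b hab => by
    rw [← inv_zpow, ← mul_zpow]
    exact zpow_mem (hab 0) m) hf

lemma prod (hn : 1 ≤ n) {ι : Type*} (s : Finset ι) {h : ι → (Fin n → A) → A}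
    (hh : ∀ i ∈ s, InClone (smallOps A) (h i)) :
    InClone (smallOps A) fun x => ∏ i ∈ s, h i x := by
  classical
  induction s using Finset.induction_on with
  | empty => simpa using const hn 1
  | insert i s hi ih =>
    simp only [Finset.prod_insert hi]
    exact mul (hh i (Finset.mem_insert_self i s))
      (ih fun j hj => hh j (Finset.mem_insert_of_mem hj))

end InClone

lemma AffineComplete.inClone (hA : AffineComplete A) {n : ℕ} (hn : 1 ≤ n)
    {f : (Fin n → A) → A} (hf : Compatible f) : InClone (smallOps A) f := by
  obtain ⟨c, m, h⟩ := hA n hn f hf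
  obtain rfl : f = fun x => c * ∏ i, x i ^ m i := funext h
  exact (InClone.const hn c).mul (InClone.prod hn _ fun i _ => (InClone.proj i).zpow (m i))

/-- If `M` covers `M'` in a chain of subgroups, functions into `M` that are invariant modulo `M'`
are compatible. -/
lemma compatible_of_covBy (hchain : ∀ N M : Subgroup A, N ≤ M ∨ M ≤ N) {M' M : Subgroup A}
    (hM : M' ⋖ M) {n : ℕ} {f : (Fin n → A) → A} (hfM : ∀ x, f x ∈ M)
    (hfM' : ∀ x y : Fin n → A, (∀ i, (x i : A ⧸ M') = y i) → f x = f y) : Compatible f := by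
  intro N a b hab
  have : M ≤ N ∨ N ≤ M' := by
    rcases hchain M N with h | h
    · exact Or.inl h
    · rcases hchain N M' with h' | h'
      · exact Or.inr h'
      · rcases hM.eq_or_eq h' h with rfl | rfl
        · exact Or.inr le_rfl
        · exact Or.inl le_rfl
  rcases this with h | h
  · exact mul_mem (inv_mem (h (hfM a))) (h (hfM b))
  · rw [hfM' a b fun i => QuotientGroup.eq.mpr (h (hab i)), inv_mul_cancel]
    exact one_mem _

open Classical in
lemma inClone_ite_of_covBy (hchain : ∀ N M : Subgroup A, N ≤ M ∨ M ≤ N) {M' M : Subgroup A}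
    (hM : M' ⋖ M) {n : ℕ} (hn : 1 ≤ n) (c : Fin n → A ⧸ M') {v : A} (hv : v ∈ M) :
    InClone (smallOps A) fun x : Fin n → A => if ∀ i, (x i : A ⧸ M') = c i then v else 1 := by
  obtain ⟨w, hwM, hwM'⟩ := SetLike.exists_of_lt hM.lt
  have hw : ((1 : A) : A ⧸ M') ≠ w := by
    rw [Ne, QuotientGroup.eq]
    simpa using hwM'
  have hind : ∀ s : Finset (Fin n), InClone (smallOps A) fun x : Fin n → A =>
      if ∀ i ∈ s, (x i : A ⧸ M') = c i then w else 1 := by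
    intro s
    induction s using Finset.induction_on with
    | empty => simpa using InClone.const hn w
    | insert i s hi ih =>
      have hb : Compatible fun x : Fin 2 → A =>
          if (x 0 : A ⧸ M') = c i ∧ (x 1 : A ⧸ M') = w then w else 1 := by
        refine compatible_of_covBy hchain hM (fun x => ?_) fun x y hxy => ?_
        · split_ifs
          exacts [hwM, one_mem _]
        · simp only [hxy]
      convert InClone.binary (b := fun y z : A =>
        if (y : A ⧸ M') = c i ∧ (z : A ⧸ M') = w then w else 1) hb (InClone.proj i) ih using 2
      simp only [Finset.forall_mem_insert]
      split_ifs <;> simp_all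
  have hu : Compatible fun x : Fin 1 → A => if (x 0 : A ⧸ M') = w then v else 1 := by
    refine compatible_of_covBy hchain hM (fun x => ?_) fun x y hxy => ?_
    · split_ifs
      exacts [hv, one_mem _]
    · simp only [hxy]
  convert InClone.unary (u := fun z : A => if (z : A ⧸ M') = w then v else 1) hu
    (hind Finset.univ) using 2
  simp only [Finset.mem_univ, forall_true_left]
  split_ifs <;> simp_all

/-- If the subgroups form a chain, all compatible functions are generated by the unary and binary
ones. -/
lemma Compatible.inClone_of_chain [Finite A] (hchain : ∀ N M : Subgroup A, N ≤ M ∨ M ≤ N) {n : ℕ}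
    (hn : 1 ≤ n) {f : (Fin n → A) → A} (hf : Compatible f) : InClone (smallOps A) f := by
  classical
  suffices h : ∀ (M : Subgroup A) (f : (Fin n → A) → A), Compatible f → (∀ x, f x ∈ M) →
      InClone (smallOps A) f from h ⊤ f hf fun _ => Subgroup.mem_top _
  clear hf f
  intro M
  induction M using WellFoundedLT.induction with
  | ind M ih =>
    intro f hf hfM
    rcases eq_or_ne M ⊥ with rfl | hM0
    · obtain rfl : f = fun _ => 1 := funext fun x => Subgroup.mem_bot.mp (hfM x)
      exact InClone.const hn 1
    · obtain ⟨M', -, hM⟩ := exists_le_covBy_of_lt (bot_lt_iff_ne_bot.mpr hM0)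
      have := Fintype.ofFinite (A ⧸ M')
      let g : (Fin n → A) → A := fun x => f fun i => (x i : A ⧸ M').out
      have hgc : Compatible g := compatible_of_covBy hchain hM (fun x => hfM _)
        fun x y hxy => by simp only [g, hxy]
      have hg : InClone (smallOps A) g := by
        have hsum : g = fun x => ∏ c : Fin n → A ⧸ M',
            if ∀ i, (x i : A ⧸ M') = c i then f fun i => (c i).out else 1 := by
          funext x
          rw [Finset.prod_eq_single fun i => (x i : A ⧸ M')]
          · simp [g]
          · intro c _ hc
            exact if_neg fun h => hc (funext fun i => (h i).symm)
          · simp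
        rw [hsum]
        exact InClone.prod hn _ fun c _ => inClone_ite_of_covBy hchain hM hn c (hfM _)
      have hrest : InClone (smallOps A) fun x => (g x)⁻¹ * f x := by
        refine ih M' hM.lt _ (hgc.inv.mul hf) fun x => hf M' _ _ fun i => ?_
        rw [← QuotientGroup.eq, QuotientGroup.out_eq']
      simpa using hg.mul hrest

lemma IsPGroup.subgroup_le_or_le_of_isCyclic [Finite A] [IsCyclic A] {p : ℕ} (hp : p.Prime)
    (hA : IsPGroup p A) (N M : Subgroup A) : N ≤ M ∨ M ≤ N := by
  classical
  have := Fintype.ofFinite A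
  have := Fact.mk hp
  have key : ∀ N M : Subgroup A, Nat.card N ∣ Nat.card M → N ≤ M := by
    intro N M h x hx
    have hpow : ∀ (K : Subgroup A) (a : A), a ∈ K → a ^ Nat.card K = 1 := fun K a ha =>
      congrArg Subtype.val (pow_card_eq_one' (x := (⟨a, ha⟩ : K)))
    have hsub : (Finset.univ.filter (· ∈ M)) ⊆
        Finset.univ.filter fun a : A => a ^ Nat.card M = 1 := by
      intro a ha
      rw [Finset.mem_filter] at ha ⊢
      exact ⟨ha.1, hpow M a ha.2⟩
    have hM : Nat.card M = (Finset.univ.filter (· ∈ M)).card := by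
      rw [Nat.card_eq_fintype_card, Fintype.card_subtype]
    have hcard := Finset.eq_of_subset_of_card_le hsub
      ((IsCyclic.card_pow_eq_one_le Nat.card_pos).trans_eq hM)
    have hx' : x ∈ Finset.univ.filter fun a : A => a ^ Nat.card M = 1 := by
      obtain ⟨q, hq⟩ := h
      refine Finset.mem_filter.mpr ⟨Finset.mem_univ x, ?_⟩
      rw [hq, pow_mul, hpow N x hx, one_pow]
    rw [← hcard] at hx'
    exact (Finset.mem_filter.mp hx').2
  obtain ⟨i, hi⟩ := IsPGroup.iff_card.mp (hA.to_subgroup N)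
  obtain ⟨j, hj⟩ := IsPGroup.iff_card.mp (hA.to_subgroup M)
  rcases le_total i j with h | h
  · exact Or.inl (key N M (hi ▸ hj ▸ pow_dvd_pow p h))
  · exact Or.inr (key M N (hi ▸ hj ▸ pow_dvd_pow p h))

end CommGroup

section Sylow

variable {A : Type*} [CommGroup A]

/-- A retraction of an abelian group onto a subgroup `P` that is a power map. -/
structure PowRetraction (P : Subgroup A) where
  /-- The underlying homomorphism. -/
  toHom : A →* P
  /-- The exponent of the power map. -/
  exponent : ℕ
  coe_toHom : ∀ a, (toHom a : A) = a ^ exponent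
  toHom_coe : ∀ x : P, toHom x = x

lemma exists_powRetraction [Finite A] {p : ℕ} (hp : p.Prime) (P : Sylow p A) :
    ∃ e : PowRetraction (P : Subgroup A), e.exponent ≡ 1 [MOD Nat.card P] := by
  have := Fact.mk hp
  obtain ⟨m, hm1, hm0⟩ := Nat.chineseRemainder (Sylow.card_coprime_index P) 1 0
  have hmem : ∀ a : A, a ^ m ∈ (P : Subgroup A) := by
    intro a
    obtain ⟨q, rfl⟩ := (Nat.modEq_zero_iff_dvd).mp hm0
    rw [pow_mul]
    exact pow_mem (Subgroup.pow_index_mem _ a) q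
  refine ⟨⟨(powMonoidHom m).codRestrict _ hmem, m, fun _ => rfl, fun x => ?_⟩, hm1⟩
  have : x ^ m = x ^ 1 := pow_eq_pow_iff_modEq.mpr (hm1.of_dvd (orderOf_dvd_natCard x))
  exact Subtype.ext (congrArg Subtype.val (this.trans (pow_one x)))

namespace PowRetraction

variable {P : Subgroup A} (e : PowRetraction P) {n : ℕ}

/-- Extend an operation on `P` to one on `A` along the retraction. -/
def lift (h : (Fin n → P) → P) : (Fin n → A) → A := fun x => h fun i => e.toHom (x i)

/-- Restrict an operation on `A` to one on `P` along the retraction. -/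
def restrict (f : (Fin n → A) → A) : (Fin n → P) → P := fun x => e.toHom (f fun i => x i)

lemma restrict_lift (h : (Fin n → P) → P) : e.restrict (e.lift h) = h := by
  funext x
  simp only [restrict, lift, e.toHom_coe]

lemma compatible_lift {h : (Fin n → P) → P} (hh : Compatible h) : Compatible (e.lift h) := by
  intro N a b hab
  refine hh (N.comap P.subtype) _ _ fun i => ?_
  rw [← map_inv, ← map_mul, Subgroup.mem_comap, Subgroup.coe_subtype, e.coe_toHom]
  exact pow_mem (hab i) _

lemma compatible_restrict {f : (Fin n → A) → A} (hf : Compatible f) :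
    Compatible (e.restrict f) := by
  intro N a b hab
  have h := hf (N.map P.subtype) _ _ fun i => Subgroup.mem_map_of_mem P.subtype (hab i)
  obtain ⟨y, hy, hyx⟩ := h
  have : e.toHom y = _ := congrArg e.toHom hyx
  rw [e.toHom_coe, map_mul, map_inv] at this
  exact this ▸ hy

lemma toHom_apply_eq {f : (Fin n → A) → A} (hf : Compatible f) (x : Fin n → A) :
    e.toHom (f x) = e.restrict f fun i => e.toHom (x i) := by
  have h := hf e.toHom.ker x (fun i => (e.toHom (x i) : A)) fun i => by
    rw [MonoidHom.mem_ker, map_mul, map_inv, e.toHom_coe, inv_mul_cancel]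
  rw [MonoidHom.mem_ker, map_mul, map_inv, inv_mul_eq_one] at h
  exact h

lemma pow_exponent_eq {f : (Fin n → A) → A} (hf : Compatible f) (x : Fin n → A) :
    f x ^ e.exponent = e.lift (e.restrict f) x := by
  rw [← e.coe_toHom, e.toHom_apply_eq hf]
  rfl

lemma inClone_restrict {F : Set (FinOp A)} (hF : ∀ f ∈ F, Compatible f.2) {f : (Fin n → A) → A}
    (hf : InClone F f) :
    InClone ((fun f : FinOp A => (⟨f.1, e.restrict f.2⟩ : FinOp P)) '' F) (e.restrict f) := by
  induction hf with
  | proj i =>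
    convert InClone.proj i using 1
    exact funext fun x => e.toHom_coe (x i)
  | base f hf => exact InClone.base _ ⟨_, hf, rfl⟩
  | comp f g hf _ ihf ihg =>
    convert InClone.comp _ (fun i => e.restrict (g i)) ihf ihg using 1
    funext x
    exact e.toHom_apply_eq (hf.compatible hF) _

lemma inClone_lift {h : (Fin n → P) → P} (hh : InClone (smallOps P) h) :
    InClone (smallOps A) (e.lift h) := by
  induction hh with
  | proj i =>
    exact InClone.unary (u := fun a => (e.toHom a : A))
      (e.compatible_lift (h := fun x : Fin 1 → P => x 0) fun _ _ _ h => h 0) (InClone.proj i)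
  | base f hf => exact InClone.base _ ⟨hf.1, e.compatible_lift hf.2⟩
  | comp f g _ _ ihf ihg =>
    convert InClone.comp _ (fun i => e.lift (g i)) ihf ihg using 1
    funext x
    simp only [lift, e.toHom_coe]

end PowRetraction

lemma Compatible.inClone_of_sylow [Finite A]
    (hA : ∀ (p : ℕ), p.Prime → ∀ P : Sylow p A,
      IsCyclic ↥(P : Subgroup A) ∨ AffineComplete ↥(P : Subgroup A))
    {n : ℕ} (hn : 1 ≤ n) {f : (Fin n → A) → A} (hf : Compatible f) :
    InClone (smallOps A) f := by
  let H : AddSubgroup ℤ :=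
    { carrier := {z | InClone (smallOps A) fun x => f x ^ z}
      zero_mem' := by simpa using InClone.const hn 1
      add_mem' := fun {a b} ha hb => by simpa [zpow_add] using InClone.mul ha hb
      neg_mem' := fun {a} ha => by simpa using InClone.inv ha }
  have hcard : (Nat.card A : ℤ) ∈ H := by
    change InClone (smallOps A) fun x => f x ^ (Nat.card A : ℤ)
    simpa using InClone.const hn 1
  obtain ⟨d, hd⟩ := Int.subgroup_cyclic H
  have hmem : ∀ z : ℤ, z ∈ H ↔ d ∣ z := fun z => by
    rw [hd, ← AddSubgroup.zmultiples_eq_closure, Int.mem_zmultiples_iff]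
  have hunit : IsUnit d := by
    rw [Int.isUnit_iff_natAbs_eq]
    by_contra hd1
    obtain ⟨p, hp, hpd⟩ := Nat.exists_prime_and_dvd hd1
    have := Fact.mk hp
    obtain ⟨P⟩ : Nonempty (Sylow p A) := inferInstance
    obtain ⟨e, he⟩ := exists_powRetraction hp P
    have hP : InClone (smallOps P) (e.restrict f) := by
      rcases hA p hp P with h | h
      · exact (e.compatible_restrict hf).inClone_of_chain
          (IsPGroup.subgroup_le_or_le_of_isCyclic hp P.isPGroup') hn
      · exact h.inClone hn (e.compatible_restrict hf)
    have hexp : (e.exponent : ℤ) ∈ H := by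
      change InClone (smallOps A) fun x => f x ^ (e.exponent : ℤ)
      simpa only [zpow_natCast, e.pow_exponent_eq hf] using e.inClone_lift hP
    have hpdvd : ∀ m : ℕ, (m : ℤ) ∈ H → p ∣ m := fun m hm =>
      hpd.trans (Int.natAbs_dvd_natAbs.mpr ((hmem _).mp hm))
    have hpP : p ∣ Nat.card P := by
      have h := hpdvd _ hcard
      rw [← (P : Subgroup A).card_mul_index, hp.dvd_mul] at h
      exact h.resolve_right P.not_dvd_index
    have h1 := ((he.of_dvd hpP).dvd_iff dvd_rfl).mp (hpdvd _ hexp)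
    exact hp.one_lt.ne' (Nat.dvd_one.mp h1)
  have h1 : (1 : ℤ) ∈ H := (hmem 1).mpr hunit.dvd
  simpa [H] using h1

lemma affineComplete_of_compFG [Finite A] (hA : CompFG A) {p : ℕ} (hp : p.Prime)
    (P : Sylow p A) (hP : ¬ IsCyclic ↥(P : Subgroup A)) :
    AffineComplete ↥(P : Subgroup A) := by
  obtain ⟨F, hF, hFc, hgen⟩ := hA
  have := Fact.mk hp
  obtain ⟨e, -⟩ := exists_powRetraction hp P
  obtain ⟨a, ha⟩ := IsPGroup.iff_card.mp P.isPGroup'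
  intro k _ f hf
  refine exists_affine_of_finitelyGenerated (G := Additive P) (p := p) (a := a) hp
    (fun x => ?_) (fun h => hP (isAddCyclic_additive_iff.mp h))
    (F := (fun f : FinOp A => (⟨f.1, e.restrict f.2⟩ : FinOp P)) '' F) (hF.image _) ?_
    (fun n hn (f : (Fin n → P) → P) hf => ?_) ((compatible_iff_addCompat f).mp hf)
  · rw [← ha]
    exact pow_card_eq_one' (x := (Additive.toMul x : P))
  · rintro _ ⟨f, hf, rfl⟩
    exact (compatible_iff_addCompat (e.restrict f.2)).mp (e.compatible_restrict (hFc f hf).2)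
  · have hf' : Compatible f := (compatible_iff_addCompat f).mpr hf
    have h := e.inClone_restrict (fun f hf => (hFc f hf).2)
      ((hgen n hn _).mp (e.compatible_lift hf'))
    rwa [e.restrict_lift] at h

end Sylow

/-- Theorem 1.2 of the paper: the clone of congruence preserving functions of
a finite abelian group is finitely generated iff all its Sylow subgroups are
either cyclic or affine complete. -/
theorem compFG_iff_sylow_cyclic_or_affineComplete (A : Type*) [CommGroup A] [Finite A] :
    CompFG A ↔ ∀ (p : ℕ), p.Prime → ∀ P : Sylow p A,
      IsCyclic ↥(P : Subgroup A) ∨ AffineComplete ↥(P : Subgroup A) := by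
  refine ⟨fun hA p hp P => or_iff_not_imp_left.mpr (affineComplete_of_compFG hA hp P),
    fun hA => ⟨smallOps A, finite_smallOps, ?_, fun n hn f =>
      ⟨Compatible.inClone_of_sylow hA hn, InClone.compatible fun f hf => hf.2⟩⟩⟩
  rintro ⟨n, f⟩ ⟨hn, hf⟩
  exact ⟨by omega, hf⟩
end

section
/- Let p be a prime, let n ≥ 1, and let α_1 ≥ α_2 ≥ ⋯ ≥ α_n ≥ 1 be natural numbers. Let G := Z_{p^{α_1}} × ⋯ × Z_{p^{α_n}} (the direct product of cyclic groups of orders p^{α_i}). Then the subgroup lattice of G splits if and only if n = 1, or n ≥ 2 and α_1 > α_2. -/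
/-- An atom contained in every cyclic subgroup of maximal order splits the subgroup lattice, when one
cyclic factor is strictly larger than all the others. -/
theorem exists_splitting_of_unique_max {ι : Type*} [DecidableEq ι] {p : ℕ} (hp : p.Prime)
    (α : ι → ℕ) (j : ι) (hj : 1 ≤ α j) (hlt : ∀ i, i ≠ j → α i < α j) :
    ∃ D E : AddSubgroup (∀ i, ZMod (p ^ α i)),
      D < ⊤ ∧ ⊥ < E ∧ ∀ N : AddSubgroup (∀ i, ZMod (p ^ α i)), N ≤ D ∨ E ≤ N := by
  obtain ⟨a, ha⟩ : ∃ a, α j = a + 1 := ⟨α j - 1, by omega⟩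
  set g : ∀ i, ZMod (p ^ α i) := Pi.single j 1 with hg
  have hkill : (p ^ (a + 1)) • g = 0 := by
    rw [hg, ← Pi.single_smul, nsmul_one, ← ha, ZMod.natCast_self, Pi.single_zero]
  have hne : (p ^ a) • g ≠ 0 := by
    intro h
    have h1 := congrFun h j
    simp only [hg, Pi.smul_apply, Pi.single_eq_same, nsmul_one, Pi.zero_apply] at h1
    rw [ZMod.natCast_eq_zero_iff, ha, Nat.pow_dvd_pow_iff_le_right hp.one_lt] at h1
    omega
  refine ⟨(nsmulAddMonoidHom (p ^ a)).ker, AddSubgroup.zmultiples ((p ^ a) • g), ?_, ?_, ?_⟩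
  · refine lt_top_iff_ne_top.2 fun h => hne ?_
    have : g ∈ (nsmulAddMonoidHom (α := ∀ i, ZMod (p ^ α i)) (p ^ a)).ker :=
      h ▸ AddSubgroup.mem_top g
    exact this
  · exact bot_lt_iff_ne_bot.2 fun h => hne (AddSubgroup.zmultiples_eq_bot.1 h)
  · intro N
    by_cases hN : N ≤ (nsmulAddMonoidHom (p ^ a)).ker
    · exact Or.inl hN
    right
    obtain ⟨x, hxN, hx⟩ := SetLike.not_le_iff_exists.1 hN
    replace hx : (p ^ a) • x ≠ 0 := hx
    obtain ⟨k, hk⟩ := ZMod.intCast_surjective (x j)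
    have hxk : (p ^ a) • x = k • (p ^ a) • g := by
      funext i
      by_cases hi : i = j
      · subst hi
        simp [hg, ← hk, mul_comm]
      · have : ((p ^ a : ℕ) : ZMod (p ^ α i)) = 0 := by
          rw [ZMod.natCast_eq_zero_iff]
          exact pow_dvd_pow p (by have := hlt i hi; omega)
        rw [Pi.smul_apply, nsmul_eq_mul, this, zero_mul]
        simp [hg, hi]
    have hpk : ¬ (p : ℤ) ∣ k := by
      rintro ⟨t, rfl⟩
      apply hx
      rw [hxk, mul_comm, mul_smul, natCast_zsmul, smul_smul, ← pow_succ', hkill, smul_zero]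
    obtain ⟨u, v, huv⟩ := ((Nat.prime_iff_prime_int.1 hp).coprime_iff_not_dvd.2 hpk)
    rw [AddSubgroup.zmultiples_le]
    have : (p ^ a) • g = v • (p ^ a) • x := by
      rw [hxk, smul_smul, eq_sub_of_add_eq' huv, sub_smul, one_smul, mul_smul, natCast_zsmul,
        smul_smul, ← pow_succ', hkill, smul_zero, sub_zero]
    rw [this]
    exact N.zsmul_mem (N.nsmul_mem hxN _) _

/-- The subgroup lattice of a product of cyclic `p`-groups does not split if every factor embeds in
another one. -/
theorem not_exists_splitting_of_forall_exists_le {ι : Type*} [Finite ι] [DecidableEq ι] (p : ℕ)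
    (α : ι → ℕ) (h : ∀ j, ∃ k, k ≠ j ∧ α j ≤ α k) :
    ¬ ∃ D E : AddSubgroup (∀ i, ZMod (p ^ α i)),
      D < ⊤ ∧ ⊥ < E ∧ ∀ N : AddSubgroup (∀ i, ZMod (p ^ α i)), N ≤ D ∨ E ≤ N := by
  rintro ⟨D, E, hD, hE, hDE⟩
  cases nonempty_fintype ι
  have hcyc : ∀ x, x ∉ D → ∀ e ∈ E, ∃ m : ℤ, m • x = e := fun x hx e he =>
    AddSubgroup.mem_zmultiples_iff.1 <|
      (hDE (AddSubgroup.zmultiples x)).resolve_left 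
        (fun hle => hx (AddSubgroup.zmultiples_le.1 hle)) he
  obtain ⟨e, he, hne⟩ := (AddSubgroup.bot_or_exists_ne_zero E).resolve_left hE.ne'
  obtain ⟨j, hj⟩ : ∃ j, (Pi.single j 1 : ∀ i, ZMod (p ^ α i)) ∉ D := by
    by_contra! hall
    refine hD.ne (eq_top_iff.2 fun x _ => ?_)
    rw [← Finset.univ_sum_single x]
    refine D.sum_mem fun i _ => ?_
    obtain ⟨k, hk⟩ := ZMod.intCast_surjective (x i)
    rw [← hk, ← zsmul_one, Pi.single_smul]
    exact D.zsmul_mem (hall i) k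
  obtain ⟨k, hkj, hle⟩ := h j
  obtain ⟨c, hc⟩ := hcyc _ hj e he
  by_cases hk : (Pi.single k 1 : ∀ i, ZMod (p ^ α i)) ∈ D
  · obtain ⟨m, hm⟩ := hcyc (Pi.single j 1 + Pi.single k 1)
      (fun hmem => hj ((D.add_mem_cancel_right hk).1 hmem)) e he
    have hmk : (m : ZMod (p ^ α k)) = 0 := by
      have := congrFun (hm.trans hc.symm) k
      simpa [hkj] using this
    have hmj : (m : ZMod (p ^ α j)) = 0 := by
      rw [ZMod.intCast_zmod_eq_zero_iff_dvd] at hmk ⊢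
      exact (Int.natCast_dvd_natCast.2 (pow_dvd_pow p hle)).trans hmk
    apply hne
    rw [← hm, smul_add, ← Pi.single_smul, ← Pi.single_smul, zsmul_one, zsmul_one, hmj, hmk]
    simp
  · obtain ⟨m, hm⟩ := hcyc _ hk e he
    have hcj : (c : ZMod (p ^ α j)) = 0 := by
      have := congrFun (hc.trans hm.symm) j
      simpa [hkj.symm] using this
    apply hne
    rw [← hc, ← Pi.single_smul, zsmul_one, hcj, Pi.single_zero]

/-- Lemma (splitting of the subgroup lattice of a finite abelian `p`-group):
for `G = Z_{p^{α 0}} × ⋯ × Z_{p^{α n}}` with `α` nonincreasing, the subgroup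
lattice of `G` splits iff there is one factor, or there are at least two
factors and `α 0 > α 1`. -/
theorem subgroupLattice_splits_iff (p : ℕ) (hp : p.Prime) (n : ℕ)
    (α : Fin (n + 1) → ℕ) (hpos : ∀ i, 1 ≤ α i)
    (hanti : ∀ i j : Fin (n + 1), i ≤ j → α j ≤ α i) :
    (∃ D E : AddSubgroup (∀ i : Fin (n + 1), ZMod (p ^ α i)),
        D < ⊤ ∧ ⊥ < E ∧
        ∀ N : AddSubgroup (∀ i : Fin (n + 1), ZMod (p ^ α i)), N ≤ D ∨ E ≤ N)
      ↔ (n = 0 ∨ (1 ≤ n ∧ α 1 < α 0)) := by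
  constructor
  · intro hsplit
    by_contra! hcon
    obtain ⟨hn, h01⟩ := hcon
    obtain ⟨n, rfl⟩ := Nat.exists_eq_succ_of_ne_zero hn
    refine not_exists_splitting_of_forall_exists_le p α (fun j => ?_) hsplit
    by_cases hj : j = 0
    · subst hj
      exact ⟨1, one_ne_zero, h01 (by omega)⟩
    · exact ⟨0, Ne.symm hj, hanti 0 j (Fin.zero_le j)⟩
  · intro h
    refine exists_splitting_of_unique_max hp α 0 (hpos 0) fun i hi => ?_
    rcases h with rfl | ⟨hn, hlt⟩
    · exact absurd (Fin.fin_one_eq_zero i) hi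
    · obtain ⟨n, rfl⟩ := Nat.exists_eq_succ_of_ne_zero (Nat.one_le_iff_ne_zero.1 hn)
      exact (hanti 1 i (Fin.one_le_of_ne_zero hi)).trans_lt hlt
end

section
/- Let p be a prime, let n ≥ 1, and let α_1 ≥ α_2 ≥ ⋯ ≥ α_n ≥ 1 be natural numbers. Let G := Z_{p^{α_1}} × ⋯ × Z_{p^{α_n}} (the direct product of cyclic groups of orders p^{α_i}). Then the clone Comp(G) of congruence preserving functions of G is finitely generated if and only if n = 1, or n ≥ 2 and α_1 = α_2. -/
/-- A function `A^k → A` on an abelian group is compatible (congruence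
preserving): for every subgroup `N` and tuples `a ≡ b mod N` one has
`f a ≡ f b mod N`. -/
def AddCompatible {A : Type*} [AddCommGroup A] {k : ℕ} (f : (Fin k → A) → A) : Prop :=
  ∀ N : AddSubgroup A, ∀ a b : Fin k → A,
    (∀ i, b i - a i ∈ N) → f b - f a ∈ N

/-- The clone `Comp A` of congruence preserving functions of `A` is finitely
generated. -/
def AddCompFG (A : Type*) [AddCommGroup A] : Prop :=
  ∃ F : Set (FinOp A), F.Finite ∧ (∀ f ∈ F, 1 ≤ f.1 ∧ AddCompatible f.2) ∧
    ∀ (n : ℕ), 1 ≤ n → ∀ f : (Fin n → A) → A, (AddCompatible f ↔ InClone F f)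

section Clones

variable {A : Type*} [AddCommGroup A]

/-- Clones generated by compatible functions consist of compatible functions. -/
theorem InClone.addCompatible {F : Set (FinOp A)} (hF : ∀ f ∈ F, AddCompatible f.2)
    {n : ℕ} {f : (Fin n → A) → A} (hf : InClone F f) : AddCompatible f := by
  induction hf with
  | proj i => exact fun N a b h => h i
  | base f hf => exact hF _ hf
  | comp f g _ _ ihf ihg => exact fun N a b h => ihf N _ _ fun i => ihg i N a b h

/-- The unary and binary compatible functions. -/
def smallCompatible (A : Type*) [AddCommGroup A] : Set (FinOp A) :=
  {f | (f.1 = 1 ∨ f.1 = 2) ∧ AddCompatible f.2}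

theorem smallCompatible_finite [Finite A] : (smallCompatible A).Finite := by
  have h1 : (Set.range (Sigma.mk 1 : _ → FinOp A)).Finite := Set.finite_range _
  have h2 : (Set.range (Sigma.mk 2 : _ → FinOp A)).Finite := Set.finite_range _
  refine (h1.union h2).subset ?_
  rintro ⟨k, f⟩ ⟨hk | hk, -⟩
  · simp only at hk
    subst hk
    exact Or.inl ⟨f, rfl⟩
  · simp only at hk
    subst hk
    exact Or.inr ⟨f, rfl⟩

theorem addCompFG_of_smallCompatible [Finite A]
    (h : ∀ n : ℕ, 1 ≤ n → ∀ f : (Fin n → A) → A, AddCompatible f →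
      InClone (smallCompatible A) f) : AddCompFG A := by
  refine ⟨smallCompatible A, smallCompatible_finite, fun f hf => ⟨?_, hf.2⟩, fun n hn f =>
    ⟨h n hn f, InClone.addCompatible fun f hf => hf.2⟩⟩
  rcases hf.1 with h | h <;> omega

theorem inClone_smallCompatible_unary (u : A → A)
    (hu : ∀ N : AddSubgroup A, ∀ a b, b - a ∈ N → u b - u a ∈ N)
    {n : ℕ} {f : (Fin n → A) → A} (hf : InClone (smallCompatible A) f) :
    InClone (smallCompatible A) fun x => u (f x) :=
  InClone.comp (fun y : Fin 1 → A => u (y 0)) (fun _ => f)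
    (InClone.base _ ⟨Or.inl rfl, fun N _ _ h => hu N _ _ (h 0)⟩) fun _ => hf

theorem inClone_smallCompatible_binary (u : A → A → A)
    (hu : ∀ N : AddSubgroup A, ∀ a b c d, b - a ∈ N → d - c ∈ N → u b d - u a c ∈ N)
    {n : ℕ} {f g : (Fin n → A) → A} (hf : InClone (smallCompatible A) f)
    (hg : InClone (smallCompatible A) g) :
    InClone (smallCompatible A) fun x => u (f x) (g x) := by
  have := InClone.comp (F := smallCompatible A) (fun y : Fin 2 → A => u (y 0) (y 1)) ![f, g]
    (InClone.base _ ⟨Or.inr rfl, fun N a b h => hu N _ _ _ _ (h 0) (h 1)⟩)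
    (fun i => by fin_cases i <;> assumption)
  simpa using this

theorem inClone_smallCompatible_const {n : ℕ} (hn : 1 ≤ n) (c : A) :
    InClone (smallCompatible A) fun _ : Fin n → A => c :=
  inClone_smallCompatible_unary (fun _ => c) (fun N _ _ _ => by simp [N.zero_mem])
    (InClone.proj (⟨0, hn⟩ : Fin n))

theorem inClone_smallCompatible_add {n : ℕ} {f g : (Fin n → A) → A}
    (hf : InClone (smallCompatible A) f) (hg : InClone (smallCompatible A) g) :
    InClone (smallCompatible A) fun x => f x + g x :=
  inClone_smallCompatible_binary (· + ·)
    (fun N _ _ c d h h' => by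
      have := N.add_mem h h'
      rwa [sub_add_sub_comm] at this) hf hg

theorem inClone_smallCompatible_sum {n : ℕ} (hn : 1 ≤ n) {ι : Type*} (s : Finset ι)
    (f : ι → (Fin n → A) → A) (hf : ∀ i ∈ s, InClone (smallCompatible A) (f i)) :
    InClone (smallCompatible A) fun x => ∑ i ∈ s, f i x := by
  classical
  induction s using Finset.induction_on with
  | empty => simpa using inClone_smallCompatible_const hn (0 : A)
  | insert i s hi ih =>
    simp only [Finset.sum_insert hi]
    exact inClone_smallCompatible_add (hf i (Finset.mem_insert_self i s))
      (ih fun j hj => hf j (Finset.mem_insert_of_mem hj))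

theorem inClone_smallCompatible_affine {n : ℕ} (hn : 1 ≤ n) (c : A) (m : Fin n → ℤ) :
    InClone (smallCompatible A) fun x : Fin n → A => c + ∑ i, m i • x i :=
  inClone_smallCompatible_add (inClone_smallCompatible_const hn c)
    (inClone_smallCompatible_sum hn _ _ fun i _ =>
      inClone_smallCompatible_unary (fun x => m i • x)
        (fun N a b h => by
          rw [← smul_sub]
          exact N.zsmul_mem h _) (InClone.proj i))

end Clones

section Chains

variable {A : Type*} [AddCommGroup A]

theorem le_or_le_of_covBy (htot : ∀ M N : AddSubgroup A, M ≤ N ∨ N ≤ M)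
    {N' N : AddSubgroup A} (hcov : N' ⋖ N) (M : AddSubgroup A) : M ≤ N' ∨ N ≤ M := by
  rcases htot M N' with h | h
  · exact Or.inl h
  rcases htot M N with h' | h'
  · rcases h.lt_or_eq with h1 | h1
    · rcases h'.lt_or_eq with h2 | h2
      · exact absurd h2 (hcov.2 h1)
      · exact Or.inr h2.ge
    · exact Or.inl h1.ge
  · exact Or.inr h'

open Classical in
/-- The function with value `v` on a box of cosets and `0` elsewhere is in the clone. -/
theorem inClone_smallCompatible_indicator {N' N : AddSubgroup A}
    (hlt : N' < N) (hdich : ∀ M : AddSubgroup A, M ≤ N' ∨ N ≤ M)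
    {n : ℕ} (hn : 1 ≤ n) (c : Fin n → A ⧸ N') {v : A} (hv : v ∈ N) :
    InClone (smallCompatible A)
      fun x : Fin n → A => if ∀ i, (x i : A ⧸ N') = c i then v else 0 := by
  obtain ⟨w, hw, hw'⟩ := SetLike.exists_of_lt hlt
  have hw0 : (0 : A ⧸ N') ≠ w := by
    rw [← QuotientAddGroup.mk_zero, Ne, QuotientAddGroup.eq]
    simpa using hw'
  have hmem : ∀ (M : AddSubgroup A) (_ : N ≤ M) {z : A} (_ : z ∈ N) (P Q : Prop)
      [Decidable P] [Decidable Q],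
      (if P then z else 0) - (if Q then z else 0) ∈ M := by
    intro M hM z hz P Q _ _
    refine M.sub_mem ?_ ?_ <;> split_ifs <;> first | exact hM hz | exact M.zero_mem
  have hmk : ∀ {M : AddSubgroup A} (_ : M ≤ N') {a b : A} (_ : b - a ∈ M),
      (b : A ⧸ N') = a := by
    intro M hM a b hab
    rw [eq_comm, QuotientAddGroup.eq, neg_add_eq_sub]
    exact hM hab
  have huna : ∀ (d : A ⧸ N') {z : A} (_ : z ∈ N) (M : AddSubgroup A) (a b : A),
      b - a ∈ M → (if (b : A ⧸ N') = d then z else 0) - (if (a : A ⧸ N') = d then z else 0) ∈ M := by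
    intro d z hz M a b hab
    rcases hdich M with hM | hM
    · simp [hmk hM hab]
    · exact hmem M hM hz _ _
  have hbox : ∀ s : Finset (Fin n), InClone (smallCompatible A)
      fun x : Fin n → A => if ∀ i ∈ s, (x i : A ⧸ N') = c i then w else 0 := by
    intro s
    induction s using Finset.induction_on with
    | empty => simpa using inClone_smallCompatible_const hn w
    | insert i s hi ih =>
      have := inClone_smallCompatible_binary
        (fun a b : A => if (a : A ⧸ N') = w ∧ (b : A ⧸ N') = w then w else 0)
        (fun M a b a' b' h h' => by
          rcases hdich M with hM | hM
          · simp [hmk hM h, hmk hM h']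
          · exact hmem M hM hw _ _)
        (inClone_smallCompatible_unary (fun a : A => if (a : A ⧸ N') = c i then w else 0)
          (huna (c i) hw) (InClone.proj i)) ih
      convert this using 2 with x
      simp only [Finset.forall_mem_insert]
      split_ifs <;> simp_all
  have := inClone_smallCompatible_unary (fun a : A => if (a : A ⧸ N') = w then v else 0)
    (huna w hv) (hbox Finset.univ)
  convert this using 2 with x
  simp only [Finset.mem_univ, true_imp_iff]
  split_ifs <;> simp_all

/-- If the subgroups of a finite abelian group form a chain, then the unary and binary compatible
functions generate all compatible functions. -/
theorem inClone_smallCompatible_of_chain [Finite A]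
    (htot : ∀ M N : AddSubgroup A, M ≤ N ∨ N ≤ M) {n : ℕ} (hn : 1 ≤ n)
    (f : (Fin n → A) → A) (hf : AddCompatible f) : InClone (smallCompatible A) f := by
  classical
  suffices H : ∀ (N : AddSubgroup A) (f : (Fin n → A) → A), AddCompatible f → (∀ x, f x ∈ N) →
      InClone (smallCompatible A) f from H ⊤ f hf fun x => AddSubgroup.mem_top _
  intro N
  induction N using WellFoundedLT.induction with
  | ind N ih =>
  intro f hf hfN
  by_cases hbot : N = ⊥
  · have : f = fun _ => 0 := by
      funext x
      simpa [hbot] using hfN x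
    rw [this]
    exact inClone_smallCompatible_const hn 0
  obtain ⟨N', -, hcov⟩ := exists_le_covBy_of_lt (bot_lt_iff_ne_bot.2 hbot)
  have hdich := le_or_le_of_covBy htot hcov
  have hfin : Finite (A ⧸ N') := inferInstance
  cases nonempty_fintype (A ⧸ N')
  let g : (Fin n → A) → A := fun x => ∑ c : Fin n → A ⧸ N',
    if ∀ i, (x i : A ⧸ N') = c i then f (fun i => (c i).out) else 0
  have hg : InClone (smallCompatible A) g :=
    inClone_smallCompatible_sum hn _ _ fun c _ =>
      inClone_smallCompatible_indicator hcov.1 hdich hn c (hfN _)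
  have hgx : ∀ x, g x = f fun i => (x i : A ⧸ N').out := by
    intro x
    simp only [g, ← funext_iff]
    simp
  have hgc : AddCompatible g := hg.addCompatible fun f hf => hf.2
  have hfg : InClone (smallCompatible A) fun x => f x - g x := by
    refine ih N' hcov.1 _ (fun M a b h => ?_) fun x => ?_
    · have := M.sub_mem (hf M a b h) (hgc M a b h)
      rwa [sub_sub_sub_comm] at this
    · rw [hgx]
      refine hf N' _ _ fun i => ?_
      rw [← neg_add_eq_sub, ← QuotientAddGroup.eq]
      simp
  simpa using inClone_smallCompatible_add hfg hg

end Chains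

section AlternatingSums

theorem prod_one_sub_single_eq_zero {p : ℕ} [Fact p.Prime] {P : Type*} [AddCommGroup P]
    [Finite P] {e : ℕ} (he : ∀ x : P, p ^ e • x = 0) {k : ℕ} (hk : Nat.card P * p ^ e < k)
    (c : Fin k → P) :
    ∏ j, (1 - AddMonoidAlgebra.single (c j) 1 : AddMonoidAlgebra (ZMod p) P) = 0 := by
  classical
  cases nonempty_fintype P
  obtain ⟨y, hy⟩ := Fintype.exists_lt_card_fiber_of_mul_lt_card c (n := p ^ e)
    (by simpa [Nat.card_eq_fintype_card] using hk)
  rw [← Finset.prod_filter_mul_prod_filter_not Finset.univ (fun j => c j = y)]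
  have hpow : (1 - AddMonoidAlgebra.single y 1 : AddMonoidAlgebra (ZMod p) P) ^ p ^ e = 0 := by
    have : CharP (AddMonoidAlgebra (ZMod p) P) p :=
      charP_of_injective_algebraMap (algebraMap (ZMod p) _).injective p
    rw [sub_pow_char_pow, AddMonoidAlgebra.single_pow, he, one_pow, one_pow,
      ← AddMonoidAlgebra.one_def, sub_self]
  rw [Finset.prod_congr rfl
    (g := fun _ => (1 - AddMonoidAlgebra.single y 1 : AddMonoidAlgebra (ZMod p) P))
    (fun j hj => by rw [(Finset.mem_filter.1 hj).2]), Finset.prod_const,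
    pow_eq_zero_of_le hy.le hpow, zero_mul]

/-- Functions from a finite abelian `p`-group to `ZMod p` have bounded degree. -/
theorem dvd_alternating_sum {p : ℕ} [Fact p.Prime] {P : Type*} [AddCommGroup P]
    [Finite P] {e : ℕ} (he : ∀ x : P, p ^ e • x = 0) {k : ℕ} (hk : Nat.card P * p ^ e < k)
    (c₀ : P) (c : Fin k → P) (φ : P → ℤ) :
    (p : ℤ) ∣ ∑ S : Finset (Fin k), (-1) ^ S.card * φ (c₀ + ∑ j ∈ S, c j) := by
  classical
  have h := prod_one_sub_single_eq_zero he hk c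
  simp only [sub_eq_add_neg, ← AddMonoidAlgebra.single_neg, Finset.prod_one_add,
    AddMonoidAlgebra.prod_single, Finset.prod_const, Finset.powerset_univ] at h
  have h' := congrArg (fun a : AddMonoidAlgebra (ZMod p) P =>
    Finsupp.linearCombination (ZMod p) (fun x => (φ (c₀ + x) : ZMod p))
      (AddMonoidAlgebra.coeffLinearEquiv (ZMod p) a)) h
  rw [← ZMod.intCast_zmod_eq_zero_iff_dvd]
  push_cast
  simp only [map_sum, map_zero] at h'
  rw [← h']
  refine Finset.sum_congr rfl fun S _ => ?_
  simp [AddMonoidAlgebra.coeffLinearEquiv]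

/-- Alternating sums of affine functions on the cube vanish. -/
theorem alternating_sum_affine {A : Type*} [AddCommGroup A] {k : ℕ} (hk : 2 ≤ k)
    (c₀ : A) (c : Fin k → A) :
    ∑ S : Finset (Fin k), (-1 : ℤ) ^ S.card • (c₀ + ∑ j ∈ S, c j) = 0 := by
  classical
  have hnt : Nontrivial (Fin k) := Fin.nontrivial_iff_two_le.2 hk
  have hsum : ∀ (P : Finset (Fin k) → Prop) [DecidablePred P] (i : Fin k),
      (∀ S, P (symmDiff S {i}) ↔ P S) → ∀ a : A,
      ∑ S : Finset (Fin k), (-1 : ℤ) ^ S.card • (if P S then a else 0) = 0 := by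
    intro P _ i hP a
    refine Finset.sum_involution (fun S _ => symmDiff S {i}) (fun S _ => ?_) (fun S _ _ h => ?_)
      (fun S _ => Finset.mem_univ _) (fun S _ => symmDiff_symmDiff_cancel_right _ _)
    · have hcard : (-1 : ℤ) ^ (symmDiff S {i}).card = -(-1) ^ S.card := by
        by_cases hi : i ∈ S
        · have : symmDiff S {i} = S.erase i := by
            ext x; by_cases hx : x = i <;> simp [Finset.mem_symmDiff, hx, hi]
          rw [this, ← Finset.card_erase_add_one hi, pow_succ]
          ring
        · have : symmDiff S {i} = insert i S := by
            ext x; by_cases hx : x = i <;> simp [Finset.mem_symmDiff, hx, hi]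
          rw [this, Finset.card_insert_of_notMem hi, pow_succ]
          ring
      simp only [hP, hcard, neg_smul, add_neg_cancel]
    · simp at h
  simp only [smul_add, Finset.sum_add_distrib]
  obtain ⟨i₀⟩ : Nonempty (Fin k) := inferInstance
  have h0 := hsum (fun _ => True) i₀ (fun _ => Iff.rfl) c₀
  simp only [if_true] at h0
  rw [h0, zero_add]
  have hS : ∀ S : Finset (Fin k), ∑ j ∈ S, c j = ∑ j, if j ∈ S then c j else 0 := fun S => by
    simp
  simp only [hS, Finset.smul_sum]
  rw [Finset.sum_comm]
  refine Finset.sum_eq_zero fun j _ => ?_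
  obtain ⟨i, hi⟩ := exists_ne j
  exact hsum (fun S => j ∈ S) i (fun S => by simp [Finset.mem_symmDiff, hi.symm]) (c j)

end AlternatingSums

section AffineComplete

variable {ι : Type*} {m : ι → ℕ}

theorem zsmul_eq_zero_of_dvd {i₀ : ι} (h₀ : ∀ i, m i ∣ m i₀) {l : ℤ}
    (hl : (l : ZMod (m i₀)) = 0) (x : ∀ i, ZMod (m i)) : l • x = 0 := by
  funext i
  rw [ZMod.intCast_zmod_eq_zero_iff_dvd] at hl
  have : (l : ZMod (m i)) = 0 := by
    rw [ZMod.intCast_zmod_eq_zero_iff_dvd]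
    exact (Int.natCast_dvd_natCast.2 (h₀ i)).trans hl
  simp [zsmul_eq_mul, this]

variable [DecidableEq ι]

theorem unary_eq_zero_of_apply_single {i₀ : ι} (h₀ : ∀ i, m i ∣ m i₀)
    {g : (∀ i, ZMod (m i)) → ∀ i, ZMod (m i)}
    (hg : ∀ (N : AddSubgroup (∀ i, ZMod (m i))) (a b), b - a ∈ N → g b - g a ∈ N)
    (hzero : g 0 = 0) (hone : g (Pi.single i₀ 1) = 0)
    {y : ∀ i, ZMod (m i)} (hy : y i₀ = 0) : g y = 0 := by
  obtain ⟨s, hs⟩ := AddSubgroup.mem_zmultiples_iff.1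
    (hg (AddSubgroup.zmultiples y) 0 y (by simp))
  obtain ⟨l, hl⟩ := AddSubgroup.mem_zmultiples_iff.1
    (hg (AddSubgroup.zmultiples (y - Pi.single i₀ 1)) (Pi.single i₀ 1) y (by simp))
  rw [hzero, sub_zero] at hs
  rw [hone, sub_zero] at hl
  have h := congrFun (hs.trans hl.symm) i₀
  rw [← hl]
  refine zsmul_eq_zero_of_dvd h₀ ?_ _
  simpa [hy] using h.symm

/-- A compatible function is zero if it vanishes on two complementary coordinate hyperplanes. -/
theorem eq_zero_of_vanishes {κ : Type*} {i₀ i₁ : ι} (hne : i₀ ≠ i₁)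
    {h : (κ → ∀ i, ZMod (m i)) → ∀ i, ZMod (m i)}
    (hh : ∀ (N : AddSubgroup (∀ i, ZMod (m i))) (a b : κ → ∀ i, ZMod (m i)),
      (∀ j, b j - a j ∈ N) → h b - h a ∈ N)
    (hz₀ : ∀ y, (∀ j, y j i₀ = 0) → h y = 0) (hz₁ : ∀ y, (∀ j, y j i₁ = 0) → h y = 0)
    (y : κ → ∀ i, ZMod (m i)) : h y = 0 := by
  have key : ∀ i' : ι, (∀ y, (∀ j, y j i' = 0) → h y = 0) → ∀ i, i ≠ i' → h y i = 0 := by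
    intro i' hz i hi
    have := hh (Pi.evalAddMonoidHom _ i).ker (fun j => Function.update (y j) i' 0) y
      (fun j => by simp [AddMonoidHom.mem_ker, Function.update_of_ne hi])
    rw [hz (fun j => Function.update (y j) i' 0) (fun j => Function.update_self _ _ _),
      sub_zero] at this
    exact this
  funext i
  by_cases hi : i = i₀
  · exact key i₁ hz₁ i (hi ▸ hne)
  · exact key i₀ hz₀ i hi

theorem unary_eq_affine {i₀ i₁ : ι} (hne : i₀ ≠ i₁) (h₀ : ∀ i, m i ∣ m i₀)
    (h₁ : ∀ i, m i ∣ m i₁) {g : (∀ i, ZMod (m i)) → ∀ i, ZMod (m i)}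
    (hg : ∀ (N : AddSubgroup (∀ i, ZMod (m i))) (a b), b - a ∈ N → g b - g a ∈ N) :
    ∃ n : ℤ, ∀ x, g x = g 0 + n • x := by
  obtain ⟨n, hn⟩ := AddSubgroup.mem_zmultiples_iff.1
    (hg (AddSubgroup.zmultiples (Pi.single i₀ 1)) 0 (Pi.single i₀ 1) (by simp))
  refine ⟨n, fun x => ?_⟩
  have hg' : ∀ (N : AddSubgroup (∀ i, ZMod (m i))) (a b), b - a ∈ N →
      (g b - g 0 - n • b) - (g a - g 0 - n • a) ∈ N := by
    intro N a b hab
    have := N.sub_mem (hg N a b hab) (N.zsmul_mem hab n)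
    convert this using 1
    rw [smul_sub]
    abel
  have hz : g 0 - g 0 - n • (0 : ∀ i, ZMod (m i)) = 0 := by simp
  have hv₀ : ∀ y : ∀ i, ZMod (m i), y i₀ = 0 → g y - g 0 - n • y = 0 := fun y hy =>
    unary_eq_zero_of_apply_single (g := fun y => g y - g 0 - n • y) h₀ hg' hz (by simp [hn]) hy
  have hv₁ : ∀ y : ∀ i, ZMod (m i), y i₁ = 0 → g y - g 0 - n • y = 0 := fun y hy =>
    unary_eq_zero_of_apply_single (g := fun y => g y - g 0 - n • y) h₁ hg' hz
      (hv₀ _ (Pi.single_eq_of_ne hne _)) hy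
  have := eq_zero_of_vanishes (κ := Unit) hne (h := fun y => g (y ()) - g 0 - n • y ())
    (fun N a b hab => hg' N _ _ (hab ())) (fun y hy => hv₀ _ (hy ())) (fun y hy => hv₁ _ (hy ()))
    fun _ => x
  rw [sub_sub] at this
  exact sub_eq_zero.1 this

/-- **Nöbauer's theorem**: a product of cyclic groups, two of which have maximal exponent, is
affine complete. -/
theorem AddCompatible.eq_affine {i₀ i₁ : ι} (hne : i₀ ≠ i₁) (h₀ : ∀ i, m i ∣ m i₀)
    (h₁ : ∀ i, m i ∣ m i₁) {k : ℕ} {f : (Fin k → ∀ i, ZMod (m i)) → ∀ i, ZMod (m i)}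
    (hf : AddCompatible f) : ∃ M : Fin k → ℤ, ∀ x, f x = f 0 + ∑ j, M j • x j := by
  have hun : ∀ (j : Fin k) (y : Fin k → ∀ i, ZMod (m i)),
      ∃ n : ℤ, ∀ t, f (y + Pi.single j t) = f y + n • t := by
    intro j y
    obtain ⟨n, hn⟩ := unary_eq_affine hne h₀ h₁ (g := fun t => f (y + Pi.single j t))
      (fun N a b hab => hf N _ _ fun i => by
        rw [Pi.add_apply, Pi.add_apply, add_sub_add_left_eq_sub]
        by_cases hi : i = j
        · subst hi; simpa using hab
        · simp [Pi.single_eq_of_ne hi, N.zero_mem])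
    exact ⟨n, fun t => by simpa using hn t⟩
  choose M hM using hun
  have hstep : ∀ j y t, f (y + Pi.single j t) = f y + M j 0 • t := by
    intro j y t
    have hcomp : ∀ t (N : AddSubgroup (∀ i, ZMod (m i))) (a b : Fin k → ∀ i, ZMod (m i)),
        (∀ j, b j - a j ∈ N) → (M j b - M j 0) • t - (M j a - M j 0) • t ∈ N := by
      intro t N a b hab
      have := N.sub_mem (hf N (a + Pi.single j t) (b + Pi.single j t)
        (fun i => by simpa using hab i)) (hf N a b hab)
      rw [hM, hM] at this
      convert this using 1
      rw [sub_smul, sub_smul]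
      abel
    have hvan : ∀ i', (∀ i, m i ∣ m i') → ∀ y : Fin k → ∀ i, ZMod (m i), (∀ j, y j i' = 0) →
        (M j y - M j 0) • t = 0 := by
      intro i' hi' y hy
      refine zsmul_eq_zero_of_dvd hi' ?_ t
      have := hcomp (Pi.single i' 1) (Pi.evalAddMonoidHom _ i').ker 0 y
        (fun j => by simp [AddMonoidHom.mem_ker, hy])
      simpa [AddMonoidHom.mem_ker] using this
    have := eq_zero_of_vanishes hne (hcomp t) (hvan i₀ h₀) (hvan i₁ h₁) y
    rw [hM, sub_smul, sub_eq_zero] at *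
    rw [this]
  refine ⟨fun j => M j 0, fun x => ?_⟩
  have hfin : ∀ s : Finset (Fin k),
      f (∑ j ∈ s, Pi.single j (x j)) = f 0 + ∑ j ∈ s, M j 0 • x j := by
    intro s
    induction s using Finset.induction_on with
    | empty => simp
    | insert j s hj ih =>
      rw [Finset.sum_insert hj, Finset.sum_insert hj, add_comm (Pi.single j _), hstep, ih]
      abel
  simpa [Finset.univ_sum_single] using hfin Finset.univ

end AffineComplete

section Layers

variable {ι : Type*} {p : ℕ} {α : ι → ℕ}

/-- Reduction of every factor modulo `p ^ b`. -/
def reduction (p : ℕ) (α : ι → ℕ) (b : ℕ) :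
    (∀ i, ZMod (p ^ α i)) →+ ∀ i, ZMod (p ^ min (α i) b) where
  toFun x i := ZMod.castHom (pow_dvd_pow p (min_le_left (α i) b)) _ (x i)
  map_zero' := funext fun _ => map_zero _
  map_add' _ _ := funext fun _ => map_add _ _ _

theorem reduction_surjective (b : ℕ) : Function.Surjective (reduction p α b) := by
  intro y
  choose x hx using fun i =>
    ZMod.castHom_surjective (pow_dvd_pow p (min_le_left (α i) b)) (y i)
  exact ⟨x, funext hx⟩

variable [DecidableEq ι]

/-- The subgroup `p ^ t ℤ / p ^ (α i₀)` of the factor with index `i₀`. -/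
def layer (p : ℕ) (α : ι → ℕ) (i₀ : ι) (t : ℕ) : AddSubgroup (∀ i, ZMod (p ^ α i)) :=
  AddSubgroup.zmultiples (Pi.single i₀ ((p : ZMod (p ^ α i₀)) ^ t))

theorem mem_layer {i₀ : ι} {t : ℕ} {z : ∀ i, ZMod (p ^ α i)} :
    z ∈ layer p α i₀ t ↔ ∃ l : ℤ, l • Pi.single i₀ ((p : ZMod (p ^ α i₀)) ^ t) = z :=
  AddSubgroup.mem_zmultiples_iff

theorem apply_eq_zero_of_mem_layer {i₀ i : ι} (hi : i ≠ i₀) {t : ℕ} {z : ∀ i, ZMod (p ^ α i)}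
    (hz : z ∈ layer p α i₀ t) : z i = 0 := by
  obtain ⟨l, rfl⟩ := mem_layer.1 hz
  simp [Pi.single_eq_of_ne hi]

theorem zsmul_mem_layer_succ {i₀ : ι} {t : ℕ} {z : ∀ i, ZMod (p ^ α i)}
    (hz : z ∈ layer p α i₀ t) {l : ℤ} (hl : (p : ℤ) ∣ l) : l • z ∈ layer p α i₀ (t + 1) := by
  obtain ⟨s, rfl⟩ := mem_layer.1 hz
  obtain ⟨q, rfl⟩ := hl
  refine mem_layer.2 ⟨q * s, ?_⟩
  rw [← Pi.single_smul, smul_smul, ← Pi.single_smul]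
  congr 1
  simp only [zsmul_eq_mul]
  push_cast
  ring

theorem single_notMem_layer_succ (hp : p.Prime) {i₀ : ι} {t : ℕ} (ht : t < α i₀) :
    (Pi.single i₀ ((p : ZMod (p ^ α i₀)) ^ t) : ∀ i, ZMod (p ^ α i)) ∉ layer p α i₀ (t + 1) := by
  intro h
  obtain ⟨l, hl⟩ := mem_layer.1 h
  have h1 := congrFun hl i₀
  simp only [Pi.smul_apply, Pi.single_eq_same, zsmul_eq_mul] at h1
  have h2 : ((l * p ^ (t + 1) - p ^ t : ℤ) : ZMod (p ^ α i₀)) = 0 := by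
    push_cast
    rw [h1, sub_self]
  rw [ZMod.intCast_zmod_eq_zero_iff_dvd] at h2
  have h3 : (p : ℤ) ^ (t + 1) ∣ l * p ^ (t + 1) - p ^ t := by
    refine dvd_trans ?_ h2
    push_cast
    exact pow_dvd_pow _ ht
  have h4 : (p : ℤ) ^ (t + 1) ∣ (p : ℤ) ^ t := by
    have := dvd_sub (Dvd.intro_left l rfl : (p : ℤ) ^ (t + 1) ∣ l * p ^ (t + 1)) h3
    simpa using this
  have := Nat.pow_dvd_pow_iff_le_right hp.one_lt |>.1 (by exact_mod_cast h4 : p ^ (t + 1) ∣ p ^ t)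
  omega

theorem mem_layer_of_reduction_eq_zero (hp : p.Prime) {i₀ : ι} {b : ℕ} (hb : b ≤ α i₀)
    (hα : ∀ i, i ≠ i₀ → α i ≤ b) {z : ∀ i, ZMod (p ^ α i)} (hz : reduction p α b z = 0) :
    z ∈ layer p α i₀ b := by
  have hdvd : ∀ i, p ^ min (α i) b ∣ (z i).val := by
    intro i
    have : NeZero (p ^ α i) := ⟨pow_ne_zero _ hp.ne_zero⟩
    have h := congrFun hz i
    rw [← ZMod.natCast_eq_zero_iff]
    simpa [reduction] using h
  have : NeZero (p ^ α i₀) := ⟨pow_ne_zero _ hp.ne_zero⟩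
  obtain ⟨l, hl⟩ := hdvd i₀
  rw [min_eq_right hb] at hl
  refine mem_layer.2 ⟨l, ?_⟩
  rw [← Pi.single_smul]
  funext i
  by_cases hi : i = i₀
  · subst hi
    rw [Pi.single_eq_same, ← ZMod.natCast_zmod_val (z i), hl]
    simp [mul_comm]
  · have : NeZero (p ^ α i) := ⟨pow_ne_zero _ hp.ne_zero⟩
    have h := hdvd i
    rw [min_eq_left (hα i hi)] at h
    rw [Pi.single_eq_of_ne hi, ← ZMod.natCast_zmod_val (z i), (ZMod.natCast_eq_zero_iff _ _).2 h]

/-- If the second largest exponent is `b`, compatible functions are affine modulo `layer p α i₀ b`. -/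
theorem AddCompatible.affine_mod_layer (hp : p.Prime) {i₀ i₁ : ι} (hne : i₀ ≠ i₁)
    (hlt : α i₁ < α i₀) (hα : ∀ i, i ≠ i₀ → α i ≤ α i₁) {k : ℕ}
    {f : (Fin k → ∀ i, ZMod (p ^ α i)) → ∀ i, ZMod (p ^ α i)} (hf : AddCompatible f) :
    ∃ M : Fin k → ℤ, ∀ x, f x - f 0 - ∑ j, M j • x j ∈ layer p α i₀ (α i₁) := by
  set π := reduction p α (α i₁)
  choose s hs using reduction_surjective (p := p) (α := α) (α i₁)
  have hcomp : AddCompatible fun y : Fin k → ∀ i, ZMod (p ^ min (α i) (α i₁)) =>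
      π (f fun j => s (y j)) := by
    intro N a b hab
    rw [← map_sub]
    refine hf (N.comap π) _ _ fun j => ?_
    rw [AddSubgroup.mem_comap, map_sub, hs, hs]
    exact hab j
  have hπ : ∀ x, π (f x) = π (f fun j => s (π (x j))) := by
    intro x
    rw [← sub_eq_zero, ← map_sub]
    exact hf π.ker _ _ fun j => by rw [AddMonoidHom.mem_ker, map_sub, hs, sub_self]
  obtain ⟨M, hM⟩ := hcomp.eq_affine (i₀ := i₀) (i₁ := i₁) hne
    (fun i => pow_dvd_pow p (by rw [min_eq_right hlt.le]; exact min_le_right _ _))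
    (fun i => pow_dvd_pow p (by rw [min_self]; exact min_le_right _ _))
  refine ⟨M, fun x => mem_layer_of_reduction_eq_zero hp hlt.le hα ?_⟩
  have h0 := hπ 0
  have hx := hM fun j => π (x j)
  rw [← hπ] at hx
  simp only [Pi.zero_apply, map_zero] at h0 hx
  change π _ = 0
  rw [map_sub, map_sub, hx, h0, map_sum]
  simp only [map_zsmul]
  abel

/-- The remainder of a compatible function is constant on cosets of the layer. -/
theorem AddCompatible.sub_mem_layer_succ (hp : p.Prime) {i₀ i₁ : ι} (hne : i₀ ≠ i₁)
    (hpos : 1 ≤ α i₁) {k : ℕ}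
    {f : (Fin k → ∀ i, ZMod (p ^ α i)) → ∀ i, ZMod (p ^ α i)} (hf : AddCompatible f)
    {M : Fin k → ℤ} (hM : ∀ x, f x - f 0 - ∑ j, M j • x j ∈ layer p α i₀ (α i₁))
    (x d : Fin k → ∀ i, ZMod (p ^ α i)) (hd : ∀ j, d j ∈ layer p α i₀ (α i₁)) :
    f (x + d) - f x - ∑ j, M j • d j ∈ layer p α i₀ (α i₁ + 1) := by
  have hsub : ∀ (N : AddSubgroup (∀ i, ZMod (p ^ α i))) (j : Fin k) (t u : ∀ i, ZMod (p ^ α i))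
      (x : Fin k → ∀ i, ZMod (p ^ α i)),
      t - u ∈ N → f (x + Pi.single j t) - f (x + Pi.single j u) ∈ N := by
    intro N j t u x htu
    refine hf N _ _ fun i => ?_
    rw [Pi.add_apply, Pi.add_apply, add_sub_add_left_eq_sub]
    by_cases hi : i = j
    · subst hi; simpa using htu
    · simp [Pi.single_eq_of_ne hi, N.zero_mem]
  have hstep : ∀ (j : Fin k) (x : Fin k → ∀ i, ZMod (p ^ α i)) (d : ∀ i, ZMod (p ^ α i)),
      d ∈ layer p α i₀ (α i₁) →
      f (x + Pi.single j d) - f x - M j • d ∈ layer p α i₀ (α i₁ + 1) := by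
    intro j x d hd
    let κ : ∀ i, ZMod (p ^ α i) := Pi.single i₁ ((p : ZMod (p ^ α i₁)) ^ (α i₁ - 1))
    have hκ : ∀ l : ℤ, (l • κ) i₁ = 0 → (p : ℤ) ∣ l ∧ l • κ = 0 := by
      intro l hl
      refine ⟨?_, ?_⟩
      · have h1 : ((l * p ^ (α i₁ - 1) : ℤ) : ZMod (p ^ α i₁)) = 0 := by
          simpa [κ] using hl
        rw [ZMod.intCast_zmod_eq_zero_iff_dvd] at h1
        have h2 : (p : ℤ) * p ^ (α i₁ - 1) ∣ l * p ^ (α i₁ - 1) := by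
          rw [← pow_succ', Nat.sub_add_cancel hpos]
          exact_mod_cast h1
        exact Int.dvd_of_mul_dvd_mul_right (pow_ne_zero _ (by exact_mod_cast hp.ne_zero)) h2
      · simp only [κ, Pi.smul_apply, Pi.single_eq_same] at hl
        rw [← Pi.single_smul, hl, Pi.single_zero]
    obtain ⟨μ, hμ⟩ := AddSubgroup.mem_zmultiples_iff.1
      (hsub (AddSubgroup.zmultiples d) j d 0 x (by simp))
    obtain ⟨ν, hν⟩ := AddSubgroup.mem_zmultiples_iff.1
      (hsub (AddSubgroup.zmultiples κ) j κ 0 x (by simp))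
    obtain ⟨l, hl⟩ := AddSubgroup.mem_zmultiples_iff.1
      (hsub (AddSubgroup.zmultiples (d - κ)) j d κ x (by simp))
    rw [Pi.single_zero, add_zero] at hμ hν
    have hd₁ : d i₁ = 0 := apply_eq_zero_of_mem_layer hne.symm hd
    have e1 : μ • d - l • d = (ν - l) • κ := by
      rw [hμ, sub_smul, hν]
      rw [smul_sub] at hl
      rw [sub_eq_iff_eq_add.1 hl]
      abel
    have hνl := hκ (ν - l) (by rw [← e1]; simp [hd₁])
    have e2 : (ν - M j) • κ ∈ layer p α i₀ (α i₁) := by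
      have := (layer p α i₀ (α i₁)).sub_mem (hM (x + Pi.single j κ)) (hM x)
      convert this using 1
      have hs : ∑ i, M i • (x + Pi.single j κ : Fin k → ∀ i, ZMod (p ^ α i)) i = ∑ i, M i • x i + M j • κ := by
        simp only [Pi.add_apply, smul_add, Finset.sum_add_distrib]
        congr 1
        rw [Finset.sum_eq_single j (fun i _ hi => by rw [Pi.single_eq_of_ne hi, smul_zero])
          (by simp), Pi.single_eq_same]
      rw [hs, sub_smul, hν]
      abel
    have hνM := (hκ (ν - M j) (apply_eq_zero_of_mem_layer hne.symm e2)).1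
    rw [hνl.2, sub_eq_zero] at e1
    rw [← hμ, e1, ← sub_smul]
    refine zsmul_mem_layer_succ hd ?_
    have := dvd_sub hνM hνl.1
    rwa [sub_sub_sub_cancel_left] at this
  have hfin : ∀ s : Finset (Fin k), f (x + ∑ j ∈ s, Pi.single j (d j)) - f x - ∑ j ∈ s, M j • d j ∈
      layer p α i₀ (α i₁ + 1) := by
    intro s
    induction s using Finset.induction_on with
    | empty => simp
    | insert j s hj ih =>
      rw [Finset.sum_insert hj, Finset.sum_insert hj, add_comm (Pi.single j _), ← add_assoc]
      have := AddSubgroup.add_mem _ ih (hstep j (x + ∑ j ∈ s, Pi.single j (d j)) (d j) (hd j))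
      convert this using 1
      abel
  simpa [Finset.univ_sum_single] using hfin Finset.univ

end Layers

section Cube

variable {ι : Type*} [DecidableEq ι] {p : ℕ} {α : ι → ℕ}

/-- Families on the cube which are affine modulo the layer `t` and whose alternating sum lies in the
next layer. -/
def IsTame (p : ℕ) (α : ι → ℕ) (i₀ : ι) (t : ℕ) {k : ℕ}
    (u : Finset (Fin k) → ∀ i, ZMod (p ^ α i)) : Prop :=
  (∃ (c₀ : ∀ i, ZMod (p ^ α i)) (c : Fin k → ∀ i, ZMod (p ^ α i)),
    ∀ S, u S - (c₀ + ∑ j ∈ S, c j) ∈ layer p α i₀ t) ∧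
  ∑ S, (-1 : ℤ) ^ S.card • u S ∈ layer p α i₀ (t + 1)

/-- On cubes of large dimension, compatible functions preserve tameness. -/
theorem AddCompatible.isTame [Finite ι] (hp : p.Prime) {i₀ i₁ : ι} (hne : i₀ ≠ i₁)
    (hpos : 1 ≤ α i₁) (hlt : α i₁ < α i₀) (hα : ∀ i, i ≠ i₀ → α i ≤ α i₁) {m : ℕ}
    {f : (Fin m → ∀ i, ZMod (p ^ α i)) → ∀ i, ZMod (p ^ α i)} (hf : AddCompatible f)
    {k : ℕ} (hk : Nat.card (Fin m → ∀ i, ZMod (p ^ α i)) * p ^ α i₀ < k) (hk2 : 2 ≤ k)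
    {u : Fin m → Finset (Fin k) → ∀ i, ZMod (p ^ α i)}
    (hu : ∀ i, IsTame p α i₀ (α i₁) (u i)) :
    IsTame p α i₀ (α i₁) fun S => f fun i => u i S := by
  have : Fact p.Prime := ⟨hp⟩
  have : ∀ i, NeZero (p ^ α i) := fun i => ⟨pow_ne_zero _ hp.ne_zero⟩
  obtain ⟨M, hM⟩ := hf.affine_mod_layer hp hne hlt hα
  choose c₀ c hc using fun i => (hu i).1
  let L : Finset (Fin k) → Fin m → ∀ i, ZMod (p ^ α i) := fun S i => c₀ i + ∑ j ∈ S, c i j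
  choose φ hφ using fun x => mem_layer.1 (hM x)
  have hE : ∀ S, f (fun i => u i S) - f (L S) - ∑ i, M i • (u i S - L S i) ∈
      layer p α i₀ (α i₁ + 1) := by
    intro S
    have := hf.sub_mem_layer_succ hp hne hpos hM (L S) (fun i => u i S - L S i) fun i => hc i S
    rwa [show L S + (fun i => u i S - L S i) = fun i => u i S from
      funext fun i => add_sub_cancel _ _] at this
  refine ⟨⟨f 0 + ∑ i, M i • c₀ i, fun j => ∑ i, M i • c i j, fun S => ?_⟩, ?_⟩
  · have h1 := AddSubgroup.add_mem _ (hM fun i => u i S)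
      (AddSubgroup.sum_mem (layer p α i₀ (α i₁)) (t := Finset.univ)
        (f := fun i => M i • (u i S - L S i)) fun i _ => AddSubgroup.zsmul_mem _ (hc i S) (M i))
    convert h1 using 1
    simp only [L, smul_sub, smul_add, Finset.sum_sub_distrib, Finset.sum_add_distrib,
      Finset.smul_sum]
    rw [Finset.sum_comm]
    abel
  · have hdec : ∀ S, f (fun i => u i S) =
        (f (fun i => u i S) - f (L S) - ∑ i, M i • (u i S - L S i)) +
          φ (L S) • Pi.single i₀ ((p : ZMod (p ^ α i₀)) ^ α i₁) + f 0 + ∑ i, M i • u i S := by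
      intro S
      rw [hφ]
      simp only [smul_sub, Finset.sum_sub_distrib]
      abel
    have hconst : ∑ S : Finset (Fin k), (-1 : ℤ) ^ S.card • f 0 = 0 := by
      simpa using alternating_sum_affine hk2 (f 0) 0
    have hdvd : (p : ℤ) ∣ ∑ S : Finset (Fin k), (-1) ^ S.card * φ (L S) := by
      have hexp : ∀ x : Fin m → ∀ i, ZMod (p ^ α i), p ^ α i₀ • x = 0 := by
        intro x
        funext j i
        have hle : α i ≤ α i₀ := by
          by_cases hi : i = i₀
          · rw [hi]
          · exact (hα i hi).trans hlt.le
        have hz : ((p ^ α i₀ : ℕ) : ZMod (p ^ α i)) = 0 :=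
          (ZMod.natCast_eq_zero_iff _ _).2 (pow_dvd_pow p hle)
        rw [Pi.smul_apply, Pi.smul_apply, nsmul_eq_mul, hz, zero_mul]
        rfl
      convert dvd_alternating_sum hexp hk c₀ (fun j i => c i j) φ using 4 with S
      funext i
      simp [L, Finset.sum_apply]
    have hsum : ∑ S : Finset (Fin k), (-1 : ℤ) ^ S.card • f (fun i => u i S) =
        ∑ S : Finset (Fin k), (-1 : ℤ) ^ S.card •
          (f (fun i => u i S) - f (L S) - ∑ i, M i • (u i S - L S i)) +
        (∑ S : Finset (Fin k), (-1) ^ S.card * φ (L S)) •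
          Pi.single i₀ ((p : ZMod (p ^ α i₀)) ^ α i₁) +
        ∑ i, M i • ∑ S : Finset (Fin k), (-1 : ℤ) ^ S.card • u i S := by
      rw [Finset.sum_congr rfl fun S _ => congrArg ((-1 : ℤ) ^ S.card • ·) (hdec S)]
      simp only [smul_add, Finset.sum_add_distrib, hconst, add_zero]
      congr 1
      · rw [Finset.sum_smul]
        simp only [mul_smul]
      · simp only [Finset.smul_sum]
        rw [Finset.sum_comm]
        refine Finset.sum_congr rfl fun i _ => Finset.sum_congr rfl fun S _ => ?_
        rw [smul_comm]
    rw [hsum]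
    refine AddSubgroup.add_mem _ (AddSubgroup.add_mem _ ?_ ?_) ?_
    · exact AddSubgroup.sum_mem _ fun S _ => AddSubgroup.zsmul_mem _ (hE S) _
    · exact zsmul_mem_layer_succ (AddSubgroup.mem_zmultiples _) hdvd
    · exact AddSubgroup.sum_mem _ fun i _ => AddSubgroup.zsmul_mem _ (hu i).2 _

theorem isTame_single {i₀ : ι} {t k : ℕ} (hk : 2 ≤ k) (j : Fin k) :
    IsTame p α i₀ t fun S : Finset (Fin k) => if j ∈ S then Pi.single i₀ 1 else 0 := by
  have h : ∀ S : Finset (Fin k), (if j ∈ S then Pi.single i₀ 1 else 0 : ∀ i, ZMod (p ^ α i)) =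
      0 + ∑ i ∈ S, if j = i then Pi.single i₀ 1 else 0 := by
    intro S
    rw [zero_add, Finset.sum_ite_eq]
  refine ⟨⟨0, fun i => if j = i then Pi.single i₀ 1 else 0, fun S => ?_⟩, ?_⟩
  · rw [← h, sub_self]
    exact AddSubgroup.zero_mem _
  · simp only [h]
    rw [alternating_sum_affine hk]
    exact AddSubgroup.zero_mem _

theorem InClone.isTame {F : Set (FinOp (∀ i, ZMod (p ^ α i)))} {i₀ : ι} {t k : ℕ}
    (hF : ∀ f ∈ F, ∀ u : Fin f.1 → Finset (Fin k) → ∀ i, ZMod (p ^ α i),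
      (∀ i, IsTame p α i₀ t (u i)) → IsTame p α i₀ t fun S => f.2 fun i => u i S)
    {n : ℕ} {f : (Fin n → ∀ i, ZMod (p ^ α i)) → ∀ i, ZMod (p ^ α i)} (hf : InClone F f)
    (u : Fin n → Finset (Fin k) → ∀ i, ZMod (p ^ α i)) (hu : ∀ i, IsTame p α i₀ t (u i)) :
    IsTame p α i₀ t fun S => f fun i => u i S := by
  induction hf with
  | proj i => exact hu i
  | base f hf => exact hF _ hf u hu
  | comp f g _ _ ihf ihg => exact ihf _ fun i => ihg i u hu

open Classical in
/-- A compatible function of full degree in all of its variables. -/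
noncomputable def boxIndicator (p : ℕ) (α : ι → ℕ) (i₀ : ι) (t k : ℕ)
    (x : Fin k → ∀ i, ZMod (p ^ α i)) : ∀ i, ZMod (p ^ α i) :=
  if ∀ j, ¬ IsUnit (x j i₀ - 1) then Pi.single i₀ ((p : ZMod (p ^ α i₀)) ^ t) else 0

theorem isUnit_sub_iff_of_not_isUnit_sub (hp : p.Prime) {e : ℕ} (he : 1 ≤ e)
    {a b : ZMod (p ^ e)} (h : ¬ IsUnit (b - a)) : IsUnit (a - 1) ↔ IsUnit (b - 1) := by
  have hloc : ∀ z : ZMod (p ^ e), IsUnit z ↔ ZMod.castHom (dvd_pow_self p (by omega)) (ZMod p) z ≠ 0 := by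
    intro z
    have : NeZero (p ^ e) := ⟨pow_ne_zero _ hp.ne_zero⟩
    rw [← ZMod.natCast_zmod_val z, ZMod.isUnit_iff_coprime, map_natCast, Ne,
      ZMod.natCast_eq_zero_iff, Nat.coprime_pow_right_iff (by omega), Nat.coprime_comm,
      hp.coprime_iff_not_dvd]
  rw [hloc, map_sub, not_not, sub_eq_zero] at h
  rw [hloc, hloc, map_sub, map_sub, h]

theorem boxIndicator_addCompatible (hp : p.Prime) {i₀ : ι} {t : ℕ} (hpos : 1 ≤ α i₀)
    (hα : ∀ i, i ≠ i₀ → α i ≤ t) (k : ℕ) : AddCompatible (boxIndicator p α i₀ t k) := by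
  intro N a b hab
  by_cases h : ∀ j, ¬ IsUnit ((b j - a j) i₀)
  · have : boxIndicator p α i₀ t k b = boxIndicator p α i₀ t k a := by
      simp only [boxIndicator]
      congr 1
      exact propext (forall_congr' fun j =>
        (not_congr (isUnit_sub_iff_of_not_isUnit_sub hp hpos (h j))).symm)
    rw [this, sub_self]
    exact N.zero_mem
  · push Not at h
    obtain ⟨j, hj⟩ := h
    have hmem : Pi.single i₀ ((p : ZMod (p ^ α i₀)) ^ t) ∈ N := by
      have : NeZero (p ^ α i₀) := ⟨pow_ne_zero _ hp.ne_zero⟩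
      obtain ⟨v, hv⟩ := hj.exists_left_inv
      have h1 := N.nsmul_mem (hab j) (v.val * p ^ t)
      convert h1 using 1
      funext i
      by_cases hi : i = i₀
      · subst hi
        rw [Pi.single_eq_same, Pi.smul_apply, nsmul_eq_mul, Nat.cast_mul, ZMod.natCast_zmod_val,
          mul_right_comm, hv, one_mul, Nat.cast_pow]
      · have hz : ((p ^ t : ℕ) : ZMod (p ^ α i)) = 0 :=
          (ZMod.natCast_eq_zero_iff _ _).2 (pow_dvd_pow p (hα i hi))
        rw [Pi.single_eq_of_ne hi, Pi.smul_apply, nsmul_eq_mul, Nat.cast_mul, hz, mul_zero,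
          zero_mul]
    simp only [boxIndicator]
    refine N.sub_mem ?_ ?_ <;> split_ifs <;> first | exact hmem | exact N.zero_mem

theorem not_addCompFG [Finite ι] (hp : p.Prime) {i₀ i₁ : ι} (hne : i₀ ≠ i₁)
    (hpos : 1 ≤ α i₁) (hlt : α i₁ < α i₀) (hα : ∀ i, i ≠ i₀ → α i ≤ α i₁) :
    ¬ AddCompFG (∀ i, ZMod (p ^ α i)) := by
  rintro ⟨F, hfin, hF, hgen⟩
  obtain ⟨B, hB⟩ := (hfin.image fun f =>
    Nat.card (Fin f.1 → ∀ i, ZMod (p ^ α i)) * p ^ α i₀).bddAbove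
  set k := B + 2
  have hbox := ((hgen k (by omega) _).1
    (boxIndicator_addCompatible hp (hpos.trans hlt.le) hα k)).isTame (i₀ := i₀) (t := α i₁) (k := k)
    (fun f hf u hu => (hF f hf).2.isTame hp hne hpos hlt hα
      (lt_of_le_of_lt (hB (Set.mem_image_of_mem _ hf)) (by omega)) (by omega) hu)
    _ (isTame_single (by omega))
  have hval : ∀ S : Finset (Fin k), boxIndicator p α i₀ (α i₁) k
      (fun j => if j ∈ S then Pi.single i₀ 1 else 0) =
      if S = Finset.univ then Pi.single i₀ ((p : ZMod (p ^ α i₀)) ^ α i₁) else 0 := by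
    intro S
    have hnt : Fact (1 < p ^ α i₀) := ⟨Nat.one_lt_pow (by omega) hp.one_lt⟩
    have hiff : (∀ j, ¬ IsUnit ((if j ∈ S then Pi.single i₀ 1 else 0 : ∀ i, ZMod (p ^ α i)) i₀ - 1))
        ↔ S = Finset.univ := by
      rw [Finset.eq_univ_iff_forall]
      refine forall_congr' fun j => ?_
      by_cases hj : j ∈ S <;> simp [hj]
    simp only [boxIndicator, hiff]
  have h := hbox.2
  simp only [hval] at h
  simp only [smul_ite, smul_zero, Finset.sum_ite_eq', Finset.mem_univ, if_true] at h
  refine single_notMem_layer_succ (α := α) hp hlt ?_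
  have := AddSubgroup.zsmul_mem _ h ((-1) ^ (Finset.univ : Finset (Fin k)).card)
  rwa [smul_smul, ← mul_pow, neg_one_mul, neg_neg, one_pow, one_smul] at this

end Cube

section PrimePowerCyclic

theorem ZMod.exists_eq_zsmul_of_gcd_dvd {N : ℕ} [NeZero N] {x y : ZMod N}
    (h : Nat.gcd x.val N ∣ y.val) : ∃ c : ℤ, y = c • x := by
  obtain ⟨w, hw⟩ := h
  refine ⟨Nat.gcdA x.val N * w, ?_⟩
  have hg := congrArg (Int.cast : ℤ → ZMod N) (Nat.gcd_eq_gcd_ab x.val N)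
  push_cast at hg
  rw [ZMod.natCast_zmod_val, ZMod.natCast_self, zero_mul, add_zero] at hg
  rw [← ZMod.natCast_zmod_val y, hw, Nat.cast_mul, hg, zsmul_eq_mul]
  push_cast
  ring

theorem ZMod.exists_zsmul_or_of_prime_pow {p : ℕ} (hp : p.Prime) {a : ℕ} (x y : ZMod (p ^ a)) :
    (∃ c : ℤ, y = c • x) ∨ ∃ c : ℤ, x = c • y := by
  have : NeZero (p ^ a) := ⟨pow_ne_zero _ hp.ne_zero⟩
  obtain ⟨i, -, hi⟩ := (Nat.dvd_prime_pow hp).1 (Nat.gcd_dvd_right x.val (p ^ a))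
  obtain ⟨j, -, hj⟩ := (Nat.dvd_prime_pow hp).1 (Nat.gcd_dvd_right y.val (p ^ a))
  rcases le_total i j with h | h
  · refine .inl (ZMod.exists_eq_zsmul_of_gcd_dvd ?_)
    exact (hi ▸ hj ▸ pow_dvd_pow p h).trans (Nat.gcd_dvd_left _ _)
  · refine .inr (ZMod.exists_eq_zsmul_of_gcd_dvd ?_)
    exact (hj ▸ hi ▸ pow_dvd_pow p h).trans (Nat.gcd_dvd_left _ _)

theorem addSubgroup_le_total_of_unique {ι : Type*} [Unique ι] {p : ℕ} (hp : p.Prime) (α : ι → ℕ)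
    (M N : AddSubgroup (∀ i, ZMod (p ^ α i))) : M ≤ N ∨ N ≤ M := by
  by_contra! h
  obtain ⟨x, hxM, hxN⟩ := SetLike.not_le_iff_exists.1 h.1
  obtain ⟨y, hyN, hyM⟩ := SetLike.not_le_iff_exists.1 h.2
  rcases ZMod.exists_zsmul_or_of_prime_pow hp (x default) (y default) with ⟨c, hc⟩ | ⟨c, hc⟩
  · have hy : y = c • x := funext fun i => by
      rw [Unique.eq_default i, hc, Pi.smul_apply]
    exact hyM (hy ▸ M.zsmul_mem hxM c)
  · have hx : x = c • y := funext fun i => by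
      rw [Unique.eq_default i, hc, Pi.smul_apply]
    exact hxN (hx ▸ N.zsmul_mem hyN c)

end PrimePowerCyclic

/-- Theorem (finite abelian `p`-groups): for
`G = Z_{p^{α 0}} × ⋯ × Z_{p^{α n}}` with `α` nonincreasing, the clone of
congruence preserving functions of `G` is finitely generated iff there is one
factor, or there are at least two factors and `α 0 = α 1`. -/
theorem addCompFG_iff (p : ℕ) (hp : p.Prime) (n : ℕ)
    (α : Fin (n + 1) → ℕ) (hpos : ∀ i, 1 ≤ α i)
    (hanti : ∀ i j : Fin (n + 1), i ≤ j → α j ≤ α i) :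
    AddCompFG (∀ i : Fin (n + 1), ZMod (p ^ α i))
      ↔ (n = 0 ∨ (1 ≤ n ∧ α 1 = α 0)) := by
  have (i : Fin (n + 1)) : NeZero (p ^ α i) := ⟨pow_ne_zero _ hp.ne_zero⟩
  rcases n with _ | n
  · have : Unique (Fin (0 + 1)) := inferInstanceAs (Unique (Fin 1))
    exact iff_of_true (addCompFG_of_smallCompatible fun n hn f hf =>
      inClone_smallCompatible_of_chain (addSubgroup_le_total_of_unique hp α) hn f hf) (.inl rfl)
  · have hone {i : Fin (n + 2)} (hi : i ≠ 0) : α i ≤ α 1 :=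
      hanti 1 i (Fin.one_le_of_ne_zero hi)
    constructor
    · intro hfg
      refine .inr ⟨by omega, by_contra fun hne => ?_⟩
      exact not_addCompFG hp zero_ne_one (hpos 1)
        (lt_of_le_of_ne (hanti 0 1 (Fin.zero_le _)) hne) (fun i => hone) hfg
    · rintro (h | ⟨-, h⟩)
      · omega
      · refine addCompFG_of_smallCompatible fun k hk f hf => ?_
        have hdvd (i : Fin (n + 2)) : p ^ α i ∣ p ^ α 0 :=
          pow_dvd_pow p (hanti 0 i (Fin.zero_le i))
        obtain ⟨M, hM⟩ := hf.eq_affine (zero_ne_one (α := Fin (n + 2))) hdvd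
          fun i => h ▸ hdvd i
        rw [funext hM]
        exact inClone_smallCompatible_affine hk (f 0) M
end

section
/- Let L be a bounded modular lattice of finite height satisfying (AP), and let σ ∈ L be minimal among the nonzero elements that cut L. Then the interval I[⊥, σ], regarded as a lattice, is simple. -/
/-- A lattice congruence: an equivalence relation compatible with `⊓` and `⊔`. -/
def IsLatticeCong {L : Type*} [Lattice L] (r : L → L → Prop) : Prop :=
  Equivalence r ∧ ∀ a b c d : L, r a b → r c d → r (a ⊓ c) (b ⊓ d) ∧ r (a ⊔ c) (b ⊔ d)

/-- A lattice is simple if it has at least two elements and its only lattice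
congruences are equality and the total relation. -/
def SimpleLattice (L : Type*) [Lattice L] : Prop :=
  Nontrivial L ∧ ∀ r : L → L → Prop, IsLatticeCong r →
    (∀ a b : L, r a b ↔ a = b) ∨ (∀ a b : L, r a b)

/-- `β` cuts the lattice: every element is comparable with `β`. -/
def Cuts {L : Type*} [Lattice L] (β : L) : Prop := ∀ α : L, α ≤ β ∨ β ≤ α

/-- The interval `I[p.1, p.2]` transposes up to the interval `I[q.1, q.2]`. -/
def TransposedUp {L : Type*} [Lattice L] (p q : L × L) : Prop :=
  p.1 = p.2 ⊓ q.1 ∧ q.2 = p.2 ⊔ q.1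

/-- Perspective intervals: one transposes up to the other. -/
def Perspective {L : Type*} [Lattice L] (p q : L × L) : Prop :=
  TransposedUp p q ∨ TransposedUp q p

/-- Projective intervals: the reflexive-transitive closure of perspectivity. -/
def ProjectiveIntervals {L : Type*} [Lattice L] : L × L → L × L → Prop :=
  Relation.ReflTransGen Perspective

/-- The property (AP): any two prime intervals with the same lower endpoint
are projective. -/
def AP (L : Type*) [Lattice L] : Prop :=
  ∀ a b c : L, a ⋖ b → a ⋖ c → ProjectiveIntervals (a, b) (a, c)

/-- Finite height: a finite upper bound on the lengths of chains. -/
def FiniteHeight (L : Type*) [Preorder L] : Prop :=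
  ∃ n : ℕ, ∀ l : List L, l.Chain' (· < ·) → l.length ≤ n

theorem FiniteHeight.wellFoundedLT {L : Type*} [Preorder L] (h : FiniteHeight L) :
    WellFoundedLT L := by
  obtain ⟨n, hn⟩ := h
  refine ⟨wellFounded_iff_isEmpty_descending_chain.2 ⟨fun ⟨f, hf⟩ ↦ ?_⟩⟩
  have hanti : StrictAnti f := strictAnti_nat_of_succ_lt hf
  have hlen := hn (List.ofFn fun i : Fin (n + 1) ↦ f (n - i))
    (List.isChain_ofFn.2 fun i hi ↦ hanti (by dsimp only; omega))
  simp at hlen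

theorem FiniteHeight.wellFoundedGT {L : Type*} [Preorder L] (h : FiniteHeight L) :
    WellFoundedGT L := by
  obtain ⟨n, hn⟩ := h
  refine ⟨wellFounded_iff_isEmpty_descending_chain.2 ⟨fun ⟨f, hf⟩ ↦ ?_⟩⟩
  have hlen := hn (List.ofFn fun i : Fin (n + 1) ↦ f i)
    (List.isChain_ofFn.2 fun i _ ↦ hf i)
  simp at hlen

theorem IsLatticeCong.of_perspective {L : Type*} [Lattice L] {R : L → L → Prop}
    (hR : IsLatticeCong R) {p q : L × L} (h : Perspective p q) : R p.1 p.2 ↔ R q.1 q.2 := by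
  have key : ∀ {p q : L × L}, TransposedUp p q → (R p.1 p.2 ↔ R q.1 q.2) := by
    rintro ⟨a, b⟩ ⟨c, d⟩ ⟨ha, hd⟩
    dsimp only at ha hd ⊢
    subst ha hd
    constructor
    · intro h
      simpa using (hR.2 _ _ _ _ h (hR.1.refl c)).2
    · intro h
      simpa using (hR.2 _ _ _ _ (hR.1.refl b) h).1
  exact h.elim key fun h ↦ (key h).symm

theorem IsLatticeCong.of_projective {L : Type*} [Lattice L] {R : L → L → Prop}
    (hR : IsLatticeCong R) {p q : L × L} (h : ProjectiveIntervals p q) :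
    R p.1 p.2 ↔ R q.1 q.2 := by
  induction h with
  | refl => rfl
  | tail _ h ih => exact ih.trans (hR.of_perspective h)

theorem IsLatticeCong.of_le_of_le {L : Type*} [Lattice L] {R : L → L → Prop}
    (hR : IsLatticeCong R) {a b c d : L} (h : R a d) (hab : a ≤ b) (hbc : b ≤ c) (hcd : c ≤ d) :
    R b c := by
  have h' := (hR.2 _ _ _ _ (hR.2 _ _ _ _ h (hR.1.refl b)).2 (hR.1.refl c)).1
  rwa [sup_eq_right.2 hab, sup_eq_left.2 (hbc.trans hcd), inf_eq_left.2 hbc,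
    inf_eq_right.2 hcd] at h'

/-- Two incomparable elements give prime intervals above their meet, one towards each of them,
on which a congruence behaves in the same way. -/
theorem AP.exists_covBy_inf {L : Type*} [Lattice L] [WellFoundedLT L] (hap : AP L)
    {R : L → L → Prop} (hR : IsLatticeCong R) {t x : L} (hxt : ¬ x ≤ t) (htx : ¬ t ≤ x) :
    ∃ b c, x ⊓ t ⋖ b ∧ b ≤ t ∧ x ⊓ t ⋖ c ∧ c ≤ x ∧ (R (x ⊓ t) b ↔ R (x ⊓ t) c) := by
  obtain ⟨b, hb, hbt⟩ := exists_covBy_le_of_lt (inf_lt_right.2 htx)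
  obtain ⟨c, hc, hcx⟩ := exists_covBy_le_of_lt (inf_lt_left.2 hxt)
  exact ⟨b, c, hb, hbt, hc, hcx, hR.of_projective (hap _ _ _ hb hc)⟩

theorem cuts_of_maximal_bot_class {L : Type*} [Lattice L] [BoundedOrder L] [WellFoundedLT L]
    (hap : AP L) {R : L → L → Prop} (hR : IsLatticeCong R) {t : L}
    (ht : Maximal (R ⊥) t) : Cuts t := by
  intro x
  by_contra! ⟨hxt, htx⟩
  obtain ⟨b, c, hb, hbt, hc, hcx, hbc⟩ := hap.exists_covBy_inf hR hxt htx
  have hm : R (x ⊓ t) c := hbc.1 (hR.of_le_of_le ht.prop bot_le hb.le hbt)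
  have hbot : R ⊥ c :=
    hR.1.trans (hR.of_le_of_le ht.prop le_rfl bot_le inf_le_right) hm
  have hsup : R ⊥ (c ⊔ t) := by simpa using (hR.2 _ _ _ _ hbot ht.prop).2
  have hct : c ≤ t := le_sup_left.trans (ht.le_of_ge hsup le_sup_right)
  exact hc.lt.not_ge (le_inf hcx hct)

/-- The relation `R` restricts to equality below `t`. -/
def FaithfulBelow {L : Type*} [LE L] (R : L → L → Prop) (t : L) : Prop :=
  ∀ x y, x ≤ t → y ≤ t → R x y → x = y

theorem IsLatticeCong.faithfulBelow_of_lt {L : Type*} [Lattice L] {R : L → L → Prop}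
    (hR : IsLatticeCong R) {t : L} (h : ∀ x y, x < y → y ≤ t → ¬ R x y) :
    FaithfulBelow R t := by
  intro x y hx hy hxy
  by_contra hne
  have hinf : R (x ⊓ y) (x ⊔ y) := by
    have h₁ := (hR.2 _ _ _ _ hxy (hR.1.refl y)).1
    have h₂ := (hR.2 _ _ _ _ hxy (hR.1.refl y)).2
    rw [inf_idem] at h₁
    rw [sup_idem] at h₂
    exact hR.1.trans h₁ (hR.1.symm h₂)
  exact h _ _ (inf_lt_sup.2 hne) (sup_le hx hy) hinf

theorem FaithfulBelow.of_covBy {L : Type*} [Lattice L] [IsModularLattice L] {R : L → L → Prop}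
    (hR : IsLatticeCong R) {t u : L} (ht : FaithfulBelow R t) (htu : t ⋖ u) (h : ¬ R t u) :
    FaithfulBelow R u := by
  refine hR.faithfulBelow_of_lt fun x y hxy hyu hr ↦ ?_
  have hinf : x ⊓ t = y ⊓ t :=
    ht _ _ inf_le_right inf_le_right (hR.2 _ _ _ _ hr (hR.1.refl t)).1
  have hsup : R (x ⊔ t) (y ⊔ t) := (hR.2 _ _ _ _ hr (hR.1.refl t)).2
  have hlt : x ⊔ t < y ⊔ t := sup_lt_sup_of_lt_of_inf_le_inf hxy hinf.ge
  have hy : y ⊔ t = u :=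
    (htu.eq_or_eq le_sup_right (sup_le hyu htu.le)).resolve_left
      (le_sup_right.trans_lt hlt).ne'
  have hx : x ⊔ t = t :=
    (htu.eq_or_eq le_sup_right (hlt.le.trans hy.le)).resolve_right (hlt.trans_eq hy).ne
  exact h (hx ▸ hy ▸ hsup)

theorem cuts_of_maximal_faithfulBelow {L : Type*} [Lattice L] [IsModularLattice L]
    [WellFoundedLT L] (hap : AP L) {R : L → L → Prop} (hR : IsLatticeCong R) {t : L}
    (ht : Maximal (FaithfulBelow R) t) : Cuts t := by
  intro x
  by_contra! ⟨hxt, htx⟩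
  obtain ⟨b, c, hb, hbt, hc, hcx, hbc⟩ := hap.exists_covBy_inf hR hxt htx
  have hct : c ⊓ t = x ⊓ t := le_antisymm (inf_le_inf_right t hcx) (le_inf hc.le inf_le_right)
  have hcov : t ⋖ c ⊔ t := covBy_sup_of_inf_covBy_left (hct ▸ hc)
  have hnot : ¬ R t (c ⊔ t) := fun h ↦ hb.ne <|
    ht.prop _ _ inf_le_right hbt (hbc.2 (by simpa [hct] using (hR.2 _ _ _ _ (hR.1.refl c) h).1))
  exact hcov.lt.not_ge (ht.le_of_ge (ht.prop.of_covBy hR hcov hnot) hcov.le)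

theorem bot_rel_or_faithfulBelow_of_minimal_cut {L : Type*} [Lattice L] [BoundedOrder L]
    [IsModularLattice L] [WellFoundedLT L] [WellFoundedGT L] (hap : AP L) {σ : L}
    (hcut : Cuts σ) (hne : σ ≠ ⊥) (hmin : ∀ τ : L, Cuts τ → τ ≠ ⊥ → ¬ τ < σ)
    {R : L → L → Prop} (hR : IsLatticeCong R) : R ⊥ σ ∨ FaithfulBelow R σ := by
  obtain ⟨a, ha, -⟩ := exists_covBy_le_of_lt (bot_lt_iff_ne_bot.2 hne)
  have hle : ∀ t, a ≤ t → Cuts t → σ ≤ t := fun t hat ht ↦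
    (hcut t).elim (fun h ↦ (h.eq_of_not_lt (hmin t ht (ha.lt.trans_le hat).ne')).ge) id
  by_cases hr : R ⊥ a
  · obtain ⟨t, hat, ht⟩ := exists_maximal_ge_of_wellFoundedGT (R ⊥) a hr
    exact .inl <| hR.of_le_of_le ht.prop le_rfl bot_le
      (hle t hat (cuts_of_maximal_bot_class hap hR ht))
  · have hbot : FaithfulBelow R (⊥ : L) := fun x y hx hy _ ↦
      (le_bot_iff.1 hx).trans (le_bot_iff.1 hy).symm
    obtain ⟨t, hat, ht⟩ :=
      exists_maximal_ge_of_wellFoundedGT (FaithfulBelow R) a (hbot.of_covBy hR ha hr)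
    have hσ := hle t hat (cuts_of_maximal_faithfulBelow hap hR ht)
    exact .inr fun x y hx hy ↦ ht.prop x y (hx.trans hσ) (hy.trans hσ)

theorem Cuts.sup_inf {L : Type*} [Lattice L] {σ : L} (hcut : Cuts σ) (x y : L) :
    (x ⊔ y) ⊓ σ = x ⊓ σ ⊔ y ⊓ σ := by
  rcases hcut x with hx | hx <;> rcases hcut y with hy | hy <;>
    simp [hx, hy, le_sup_of_le_left, le_sup_of_le_right]

/-- A congruence on the interval below a cutting element `σ` pulls back along `x ↦ x ⊓ σ`. -/
theorem IsLatticeCong.comap_inf {L : Type*} [Lattice L] [OrderBot L] {σ : L} (hcut : Cuts σ)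
    {r : Set.Icc (⊥ : L) σ → Set.Icc (⊥ : L) σ → Prop} (hr : IsLatticeCong r) :
    IsLatticeCong fun x y : L ↦ r ⟨x ⊓ σ, bot_le, inf_le_right⟩ ⟨y ⊓ σ, bot_le, inf_le_right⟩ := by
  refine ⟨⟨fun _ ↦ hr.1.refl _, hr.1.symm, hr.1.trans⟩, fun a b c d hab hcd ↦ ?_⟩
  have h := hr.2 _ _ _ _ hab hcd
  constructor
  · convert h.1 using 1 <;> exact Subtype.ext (inf_inf_distrib_right _ _ _)
  · convert h.2 using 1 <;> exact Subtype.ext (hcut.sup_inf _ _)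

/-- Lemma: in a bounded modular lattice of finite height with (AP), if `σ` is
minimal among the nonzero cutting elements, then the interval `I[⊥, σ]` is a
simple lattice. -/
theorem interval_simple_of_minimal_cut (L : Type*) [Lattice L] [BoundedOrder L]
    [IsModularLattice L] (hht : FiniteHeight L) (hap : AP L)
    (σ : L) (hcut : Cuts σ) (hne : σ ≠ ⊥)
    (hmin : ∀ τ : L, Cuts τ → τ ≠ ⊥ → ¬ τ < σ) :
    SimpleLattice (Set.Icc (⊥ : L) σ) := by
  have := hht.wellFoundedLT
  have := hht.wellFoundedGT
  refine ⟨⟨⟨⊥, le_rfl, bot_le⟩, ⟨σ, bot_le, le_rfl⟩, fun h ↦ hne (congrArg Subtype.val h).symm⟩,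
    fun r hr ↦ ?_⟩
  have hR := hr.comap_inf hcut
  have hval : ∀ a : Set.Icc (⊥ : L) σ, (⟨a ⊓ σ, bot_le, inf_le_right⟩ : Set.Icc (⊥ : L) σ) = a :=
    fun a ↦ Subtype.ext (inf_eq_left.2 a.2.2)
  rcases bot_rel_or_faithfulBelow_of_minimal_cut hap hcut hne hmin hR with h | h
  · refine .inr fun a b ↦ ?_
    have hbot : ∀ c : Set.Icc (⊥ : L) σ, r ⟨⊥ ⊓ σ, bot_le, inf_le_right⟩ c := fun c ↦
      hval c ▸ hR.of_le_of_le h le_rfl bot_le c.2.2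
    exact hr.1.trans (hr.1.symm (hbot a)) (hbot b)
  · refine .inl fun a b ↦ ⟨fun hab ↦ Subtype.ext (h a b a.2.2 b.2.2 ?_),
      fun hab ↦ hab ▸ hr.1.refl a⟩
    dsimp only
    rwa [hval, hval]
end

section
/- Let L be a bounded modular lattice of finite height. Then the following are equivalent: (1) L satisfies (AP); (2) L is a coalesced ordered sum of simple lattices, i.e., there exist elements ⊥ = α_0 < α_1 < ⋯ < α_n = ⊤ of L, each of which cuts L, such that for every i ∈ {0,…,n−1} the interval I[α_i, α_{i+1}], regarded as a lattice, is simple. -/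
section

variable {L : Type*} [Lattice L]

namespace TransposedUp

lemma cong_iff {a b c d : L} (h : TransposedUp (a, b) (c, d)) {r : L → L → Prop}
    (hr : IsLatticeCong r) : r a b ↔ r c d := by
  obtain ⟨rfl, rfl⟩ : a = b ⊓ c ∧ d = b ⊔ c := h
  constructor
  · intro h
    simpa using (hr.2 _ _ _ _ h (hr.1.refl c)).2
  · intro h
    simpa [inf_comm] using (hr.2 _ _ _ _ h (hr.1.refl b)).1

end TransposedUp

/-- A congruence collapses an interval iff it collapses every projective one. -/
lemma ProjectiveIntervals.cong_iff {p q : L × L} (h : ProjectiveIntervals p q)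
    {r : L → L → Prop} (hr : IsLatticeCong r) : r p.1 p.2 ↔ r q.1 q.2 := by
  induction h with
  | refl => rfl
  | tail _ h ih =>
    rw [ih]
    rcases h with h | h
    · exact TransposedUp.cong_iff h hr
    · exact (TransposedUp.cong_iff h hr).symm

/-- Every prime interval inside `I[x, y]` is projective to `p`. -/
def PrimesProjectiveTo (p : L × L) (x y : L) : Prop :=
  ∀ u v : L, x ≤ u → u ⋖ v → v ≤ y → ProjectiveIntervals p (u, v)

namespace PrimesProjectiveTo

variable {p : L × L} {x y z : L}

lemma mono {x' y' : L} (h : PrimesProjectiveTo p x y) (hx : x ≤ x') (hy : y' ≤ y) :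
    PrimesProjectiveTo p x' y' :=
  fun u v hu huv hv => h u v (hx.trans hu) huv (hv.trans hy)

lemma of_covBy (hxy : x ⋖ y) (h : ProjectiveIntervals p (x, y)) : PrimesProjectiveTo p x y := by
  intro u v hu huv hv
  obtain rfl : u = x := (hxy.eq_or_eq hu (huv.le.trans hv)).resolve_right (huv.lt.trans_le hv).ne
  obtain rfl : v = y := (hxy.eq_or_eq huv.le hv).resolve_left huv.lt.ne'
  exact h

variable [IsModularLattice L]

/-- A prime interval `I[u, v]` with `v ⊓ y ≤ u` transposes up to `I[u ⊔ y, v ⊔ y]`. -/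
lemma transposedUp_sup {u v : L} (huv : u ⋖ v) (hy : v ⊓ y ≤ u) :
    TransposedUp (u, v) (u ⊔ y, v ⊔ y) ∧ u ⊔ y ⋖ v ⊔ y := by
  have hinf : v ⊓ (u ⊔ y) = u := by
    rw [inf_comm, sup_inf_assoc_of_le y huv.le, inf_comm, sup_eq_left.2 hy]
  have hsup : v ⊔ (u ⊔ y) = v ⊔ y := by rw [← sup_assoc, sup_eq_left.2 huv.le]
  refine ⟨⟨hinf.symm, hsup.symm⟩, ?_⟩
  rw [← hsup]
  exact covBy_sup_of_inf_covBy_left (by rwa [hinf])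

/-- A prime interval `I[u, v]` with `v ≤ u ⊔ y` transposes down to `I[u ⊓ y, v ⊓ y]`. -/
lemma transposedUp_inf {u v : L} (huv : u ⋖ v) (hy : v ≤ u ⊔ y) :
    TransposedUp (u ⊓ y, v ⊓ y) (u, v) ∧ u ⊓ y ⋖ v ⊓ y := by
  have hsup : v ⊓ y ⊔ u = v := by
    rw [sup_comm, inf_comm, ← sup_inf_assoc_of_le y huv.le, inf_eq_right.2 hy]
  have hinf : v ⊓ y ⊓ u = u ⊓ y := by
    rw [inf_right_comm, inf_eq_right.2 huv.le]
  refine ⟨⟨hinf.symm, hsup.symm⟩, ?_⟩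
  rw [← hinf]
  exact inf_covBy_of_covBy_sup_right (by rwa [hsup])

lemma trans (hxy : x ≤ y) (hyz : y ≤ z) (h : PrimesProjectiveTo p x y)
    (h' : PrimesProjectiveTo p y z) : PrimesProjectiveTo p x z := by
  intro u v hu huv hv
  by_cases hy : v ⊓ y ≤ u
  · obtain ⟨ht, hc⟩ := transposedUp_sup huv hy
    exact (h' _ _ le_sup_right hc (sup_le hv hyz)).tail (Or.inr ht)
  · have hv' : u ⊔ v ⊓ y = v :=
      (huv.eq_or_eq le_sup_left (sup_le huv.le inf_le_left)).resolve_left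
        fun h => hy (sup_eq_left.1 h)
    obtain ⟨ht, hc⟩ := transposedUp_inf (y := y) huv (hv'.ge.trans (sup_le_sup_left inf_le_right u))
    exact (h _ _ (le_inf hu hxy) hc inf_le_right).tail (Or.inl ht)

lemma inf_right (hxy : x ≤ y) (h : PrimesProjectiveTo p x y) (t : L) :
    PrimesProjectiveTo p (x ⊓ t) (y ⊓ t) := by
  intro u v hu huv hv
  obtain ⟨ht, hc⟩ := transposedUp_sup (y := x) huv <|
    (le_inf inf_le_right (inf_le_left.trans (hv.trans inf_le_right))).trans hu
  exact (h _ _ le_sup_right hc (sup_le (hv.trans inf_le_left) hxy)).tail (Or.inr ht)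

lemma sup_right (hxy : x ≤ y) (h : PrimesProjectiveTo p x y) (t : L) :
    PrimesProjectiveTo p (x ⊔ t) (y ⊔ t) := by
  intro u v hu huv hv
  obtain ⟨ht, hc⟩ := transposedUp_inf (y := y) huv <|
    hv.trans (sup_le le_sup_right ((le_sup_right.trans hu).trans le_sup_left))
  exact (h _ _ (le_inf (le_sup_left.trans hu) hxy) hc inf_le_right).tail (Or.inl ht)

end PrimesProjectiveTo

/-- In a modular lattice, the pairs `x, y` such that every prime interval of `I[x ⊓ y, x ⊔ y]` is
projective to `p` form a congruence. -/
def primesProjectiveCon [IsModularLattice L] (p : L × L) : LatticeCon L :=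
  haveI : Std.Refl fun x y : L => PrimesProjectiveTo p (x ⊓ y) (x ⊔ y) :=
    ⟨fun x u v hu huv hv => by simp at hu hv; exact absurd (hv.trans hu) huv.lt.not_ge⟩
  LatticeCon.mk' (fun x y => PrimesProjectiveTo p (x ⊓ y) (x ⊔ y))
    (fun x y => by rw [inf_eq_left.2 inf_le_sup, sup_eq_right.2 inf_le_sup])
    (fun x y z hxy hyz h h' => by
      simp only [inf_eq_left.2, sup_eq_right.2, hxy, hyz, hxy.trans hyz] at h h' ⊢
      exact h.trans hxy hyz h')
    (fun x y t hxy h => by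
      simp only [inf_eq_left.2, sup_eq_right.2, hxy, inf_le_inf_right t hxy,
        sup_le_sup_right hxy t] at h ⊢
      exact ⟨h.inf_right hxy t, h.sup_right hxy t⟩)

lemma primesProjectiveCon_iff [IsModularLattice L] {p : L × L} {x y : L} (hxy : x ≤ y) :
    (primesProjectiveCon p).r x y ↔ PrimesProjectiveTo p x y := by
  change PrimesProjectiveTo p (x ⊓ y) (x ⊔ y) ↔ _
  rw [inf_eq_left.2 hxy, sup_eq_right.2 hxy]

lemma LatticeCon.isLatticeCong (c : LatticeCon L) : IsLatticeCong c.r :=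
  ⟨c.iseqv, fun _ _ _ _ h h' => ⟨c.inf h h', c.sup h h'⟩⟩

lemma IsLatticeCong.comap {M : Type*} [Lattice M] {r : M → M → Prop} (hr : IsLatticeCong r)
    {f : L → M} (hinf : ∀ x y, f (x ⊓ y) = f x ⊓ f y) (hsup : ∀ x y, f (x ⊔ y) = f x ⊔ f y) :
    IsLatticeCong fun x y => r (f x) (f y) :=
  ⟨⟨fun _ => hr.1.refl _, hr.1.symm, hr.1.trans⟩, fun a b c d h h' => by
    simpa only [hinf, hsup] using hr.2 _ _ _ _ h h'⟩

namespace Cuts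

variable {α : L}

lemma inf_sup (h : Cuts α) (x y : L) : x ⊓ y ⊔ α = (x ⊔ α) ⊓ (y ⊔ α) := by
  rcases h x with hx | hx
  · rw [sup_eq_right.2 hx, inf_eq_left.2 (le_sup_right : α ≤ y ⊔ α), sup_eq_right.2 (inf_le_left.trans hx)]
  · rcases h y with hy | hy
    · rw [sup_eq_right.2 hy, inf_eq_right.2 (le_sup_right : α ≤ x ⊔ α), sup_eq_right.2 (inf_le_right.trans hy)]
    · rw [sup_eq_left.2 hx, sup_eq_left.2 hy, sup_eq_left.2 (le_inf hx hy)]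

lemma sup_inf_s11 (h : Cuts α) (x y : L) : (x ⊔ y) ⊓ α = x ⊓ α ⊔ y ⊓ α := by
  rcases h x with hx | hx
  · rcases h y with hy | hy
    · rw [inf_eq_left.2 hx, inf_eq_left.2 hy, inf_eq_left.2 (sup_le hx hy)]
    · rw [inf_eq_right.2 hy, sup_eq_right.2 (inf_le_right : x ⊓ α ≤ α), inf_eq_right.2 (hy.trans le_sup_right)]
  · rw [inf_eq_right.2 hx, sup_eq_left.2 (inf_le_right : y ⊓ α ≤ α), inf_eq_right.2 (hx.trans le_sup_left)]

end Cuts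

namespace FiniteHeight

variable {P : Type*} [Preorder P]

lemma exists_forall_strictMono_le (h : FiniteHeight P) :
    ∃ n : ℕ, ∀ (k : ℕ) (f : Fin k → P), StrictMono f → k ≤ n := by
  obtain ⟨n, hn⟩ := h
  refine ⟨n, fun k f hf => ?_⟩
  simpa using hn (List.ofFn f) (List.pairwise_ofFn.2 fun _ _ h => hf h).isChain

lemma wellFoundedGT_s11 (h : FiniteHeight P) : WellFoundedGT P := by
  obtain ⟨n, hn⟩ := h.exists_forall_strictMono_le
  refine ⟨RelEmbedding.wellFounded_iff_isEmpty.2 ⟨fun f => ?_⟩⟩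
  have := hn (n + 1) (fun i => f i) fun _ _ h => f.map_rel_iff.2 h
  lia

lemma wellFoundedLT_s11 (h : FiniteHeight P) : WellFoundedLT P := by
  obtain ⟨n, hn⟩ := h.exists_forall_strictMono_le
  refine ⟨RelEmbedding.wellFounded_iff_isEmpty.2 ⟨fun f => ?_⟩⟩
  have := hn (n + 1) (fun i => f i.rev) fun _ _ h => f.map_rel_iff.2 (Fin.rev_lt_rev.2 h)
  lia

end FiniteHeight

/-- If the cutting elements `α < β` are such that all prime intervals of `I[α, β]` are projective
in `L`, then `I[α, β]` is simple. -/
lemma simpleLattice_Icc [WellFoundedLT L] [WellFoundedGT L] {α β : L} (hαβ : α < β) (hα : Cuts α)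
    (hβ : Cuts β) {p : L × L} (hp : PrimesProjectiveTo p α β) :
    SimpleLattice (Set.Icc α β) := by
  have hnt : Nontrivial (Set.Icc α β) :=
    ⟨⟨α, le_rfl, hαβ.le⟩, ⟨β, hαβ.le, le_rfl⟩, fun h => hαβ.ne (congrArg Subtype.val h)⟩
  refine ⟨hnt, fun θ hθ => or_iff_not_imp_left.2 fun hne => ?_⟩
  let f : L → Set.Icc α β := fun x => ⟨(x ⊔ α) ⊓ β, le_inf le_sup_right hαβ.le, inf_le_right⟩
  have hf (x : Set.Icc α β) : f x = x :=
    Subtype.ext (by simp [f, x.2.1, x.2.2])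
  have hr : IsLatticeCong fun x y => θ (f x) (f y) := hθ.comap
    (fun x y => Subtype.ext <| by simp [f, hα.inf_sup, inf_inf_distrib_right])
    (fun x y => Subtype.ext <| by simp [f, ← hβ.sup_inf_s11, sup_sup_distrib_right])
  obtain ⟨x, y, hxy, hne⟩ : ∃ x y, θ x y ∧ x ≠ y := by
    by_contra! h
    exact hne fun a b => ⟨h a b, fun h => h ▸ hθ.1.refl a⟩
  have hrp : θ (f p.1) (f p.2) := by
    obtain ⟨v, huv, hv⟩ := exists_covBy_le_of_lt (inf_lt_sup.2 (Subtype.coe_injective.ne hne))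
    refine ((hp _ v (le_inf x.2.1 y.2.1) huv (hv.trans (sup_le x.2.2 y.2.2))).cong_iff hr).2 ?_
    have hxy' : θ (x ⊓ y) (x ⊔ y) := hθ.1.trans
      (by simpa using (hθ.2 _ _ _ _ (hθ.1.refl x) (hθ.1.symm hxy)).1)
      (by simpa using (hθ.2 _ _ _ _ (hθ.1.refl x) hxy).2)
    have := (hr.2 (x ⊓ y : L) (x ⊔ y : L) v v (by
      change θ (f ↑(x ⊓ y)) (f ↑(x ⊔ y))
      rwa [hf, hf]) (hr.1.refl v)).1
    rwa [inf_eq_left.2 huv.le, inf_eq_right.2 hv] at this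
  obtain ⟨m, ⟨hαm, hmβ, hm⟩, hmax⟩ :=
    wellFounded_gt.has_min {z : L | α ≤ z ∧ z ≤ β ∧ θ (f α) (f z)} ⟨α, le_rfl, hαβ.le, hθ.1.refl _⟩
  obtain rfl : m = β := by
    by_contra hne
    obtain ⟨w, hmw, hw⟩ := exists_covBy_le_of_lt (lt_of_le_of_ne hmβ hne)
    exact hmax w ⟨hαm.trans hmw.le, hw, hθ.1.trans hm
      (((hp m w hαm hmw hw).cong_iff hr).1 hrp)⟩ hmw.lt
  have htop (x : Set.Icc α m) : θ x (f m) := by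
    have := (hr.2 _ _ _ _ hm (hr.1.refl (x : L))).2
    rwa [sup_eq_right.2 x.2.1, sup_eq_left.2 x.2.2, hf] at this
  exact fun a b => hθ.1.trans (htop a) (hθ.1.symm (htop b))

variable [IsModularLattice L]

/-- If `I[α, β]` is simple then all its prime intervals are projective. -/
lemma SimpleLattice.projectiveIntervals {α β a b c d : L} (h : SimpleLattice (Set.Icc α β))
    (ha : α ≤ a) (hab : a ⋖ b) (hb : b ≤ β) (hc : α ≤ c) (hcd : c ⋖ d) (hd : d ≤ β) :
    ProjectiveIntervals (a, b) (c, d) := by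
  have hr := (primesProjectiveCon (a, b)).isLatticeCong.comap
    (f := ((↑) : Set.Icc α β → L)) (fun _ _ => rfl) (fun _ _ => rfl)
  rcases h.2 _ hr with h | h
  · refine absurd ((h ⟨a, ha, hab.le.trans hb⟩ ⟨b, ha.trans hab.le, hb⟩).1 ?_) ?_
    · exact (primesProjectiveCon_iff hab.le).2 (.of_covBy hab .refl)
    · exact fun h => hab.lt.ne (congrArg Subtype.val h)
  · exact (primesProjectiveCon_iff hcd.le).1
      (h ⟨c, hc, hcd.le.trans hd⟩ ⟨d, hc.trans hcd.le, hd⟩) c d le_rfl hcd le_rfl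

/-- Under (AP), every cutting element `α ≠ ⊤` has a next cutting element `β` such that
`I[α, β]` is simple. -/
lemma AP.exists_cuts_simpleLattice [OrderTop L] [WellFoundedLT L] [WellFoundedGT L] (hL : AP L)
    {α : L} (hα : Cuts α) (hne : α ≠ ⊤) :
    ∃ β, α < β ∧ Cuts β ∧ SimpleLattice (Set.Icc α β) := by
  obtain ⟨a, ha, -⟩ := exists_covBy_le_of_lt hne.lt_top
  have hpa : PrimesProjectiveTo (α, a) α a := .of_covBy ha .refl
  obtain ⟨β, ⟨hαβ, hβ⟩, hmax⟩ :=
    wellFounded_gt.has_min {z : L | α ≤ z ∧ PrimesProjectiveTo (α, a) α z} ⟨a, ha.le, hpa⟩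
  have hle {w v : L} (hw : w ≤ β) (hwv : w ≤ v) (h : PrimesProjectiveTo (α, a) w v) : v ≤ β := by
    have hβv : PrimesProjectiveTo (α, a) β (v ⊔ β) := by
      simpa [hw] using h.sup_right hwv β
    have := hmax _ ⟨hαβ.trans le_sup_right, hβ.trans hαβ le_sup_right hβv⟩
    by_contra hv
    exact this (right_lt_sup.2 hv)
  have hαβ' : α < β := ha.lt.trans_le (hle hαβ ha.le hpa)
  have hcuts : Cuts β := by
    intro x
    rcases hα x with hx | hx
    · exact Or.inl (hx.trans hαβ)
    by_contra! h
    obtain ⟨u, hu, huβ⟩ := exists_covBy_le_of_lt (inf_lt_right.2 h.2)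
    obtain ⟨v, hv, hvx⟩ := exists_covBy_le_of_lt (inf_lt_left.2 h.1)
    have hpv := Relation.ReflTransGen.trans (hβ _ _ (le_inf hx hαβ) hu huβ) (hL _ _ _ hu hv)
    exact hv.lt.not_ge (le_inf hvx (hle inf_le_right hv.le (.of_covBy hv hpv)))
  exact ⟨β, hαβ', hcuts, simpleLattice_Icc hαβ' hα hcuts hβ⟩

end

/-- Theorem: a bounded modular lattice of finite height satisfies (AP) iff it
is a coalesced ordered sum of simple lattices. -/
theorem ap_iff_coalesced_ordered_sum_of_simple (L : Type*) [Lattice L] [BoundedOrder L]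
    [IsModularLattice L] (hht : FiniteHeight L) :
    AP L ↔ ∃ (n : ℕ) (α : Fin (n + 1) → L), StrictMono α ∧ α 0 = ⊥ ∧
      α (Fin.last n) = ⊤ ∧ (∀ i, Cuts (α i)) ∧
      ∀ i : Fin n, SimpleLattice (Set.Icc (α i.castSucc) (α i.succ)) := by
  have := hht.wellFoundedLT_s11
  have := hht.wellFoundedGT_s11
  constructor
  · intro hL
    suffices h : ∀ a : L, Cuts a → ∃ (n : ℕ) (α : Fin (n + 1) → L), StrictMono α ∧ α 0 = a ∧
        α (Fin.last n) = ⊤ ∧ (∀ i, Cuts (α i)) ∧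
        ∀ i : Fin n, SimpleLattice (Set.Icc (α i.castSucc) (α i.succ)) from
      h ⊥ fun _ => Or.inr bot_le
    intro a
    induction a using WellFoundedGT.induction with | _ a ih
    intro ha
    by_cases hne : a = ⊤
    · exact ⟨0, fun _ => a, Subsingleton.strictMono (α := Fin 1) _, rfl, hne, fun _ => ha, fun i => i.elim0⟩
    · obtain ⟨b, hab, hb, hs⟩ := hL.exists_cuts_simpleLattice ha hne
      obtain ⟨n, α, hmono, h0, hlast, hcuts, hsimple⟩ := ih b hab hb
      refine ⟨n + 1, Fin.cons a α, ?_, rfl, ?_, ?_, ?_⟩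
      · exact Fin.strictMono_iff_lt_succ.2
          (Fin.cases (by simpa [h0] using hab) fun i => by simpa using hmono i.castSucc_lt_succ)
      · simpa [← Fin.succ_last] using hlast
      · exact Fin.cases (by simpa using ha) fun i => by simpa using hcuts i
      · refine Fin.cases ?_ fun i => ?_
        · rwa [← h0] at hs
        · exact hsimple i
  · rintro ⟨n, α, -, h0, hlast, hcuts, hsimple⟩ a b c hab hac
    obtain ⟨i, hi, hi'⟩ : ∃ i : Fin n, α i.castSucc ≤ a ∧ ¬ α i.succ ≤ a := by
      by_contra! h
      have hle (i : Fin (n + 1)) : α i ≤ a := Fin.induction (h0 ▸ bot_le) h i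
      exact (hab.lt.trans_le (le_top.trans (hlast ▸ hle (Fin.last n)))).false
    have hlt : a < α i.succ := lt_of_le_not_ge ((hcuts i.succ a).resolve_right hi') hi'
    have hle {d : L} (had : a ⋖ d) : d ≤ α i.succ :=
      (hcuts i.succ d).elim id fun h => ((had.eq_or_eq hlt.le h).resolve_left hlt.ne').ge
    exact (hsimple i).projectiveIntervals hi hab (hle hab) hi hac (hle hac)
end

section
/- Let G be a group and let A, B, C, D be normal subgroups of G with A ≤ B and C ≤ D, such that the intervals I[A,B] and I[C,D] of the lattice of normal subgroups of G are projective. Then for every normal subgroup E of G, one has ⁅E,B⁆ ≤ A if and only if ⁅E,D⁆ ≤ C. -/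
/-- The lattice of normal subgroups of `G`. -/
instance NormalSubgroup.instLattice {G : Type*} [Group G] :
    Lattice {N : Subgroup G // N.Normal} :=
  Subtype.lattice (fun _ _ hA hB => @Subgroup.sup_normal _ _ _ _ hA hB)
    (fun _ _ hA hB => @Subgroup.normal_inf_normal _ _ _ _ hA hB)

instance NormalSubgroup.instBoundedOrder {G : Type*} [Group G] :
    BoundedOrder {N : Subgroup G // N.Normal} where
  top := ⟨⊤, inferInstance⟩
  le_top A := (le_top : A.1 ≤ ⊤)
  bot := ⟨⊥, inferInstance⟩
  bot_le A := (bot_le : ⊥ ≤ A.1)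

open scoped commutatorElement in
/-- A normal subgroup `C` containing `⁅E, B⁆` also contains `⁅E, B ⊔ C⁆`. -/
theorem Subgroup.commutator_sup_le_right {G : Type*} [Group G] {E B C : Subgroup G}
    [C.Normal] (h : ⁅E, B⁆ ≤ C) : ⁅E, B ⊔ C⁆ ≤ C := by
  rw [Subgroup.commutator_le]
  intro e he x hx
  obtain ⟨b, hb, c, hc, rfl⟩ := Subgroup.mem_sup_of_normal_right.mp hx
  have hC : C.Normal := inferInstance
  have hec : ⁅e, c⁆ ∈ C := by
    rw [commutatorElement_def]
    exact C.mul_mem (hC.conj_mem c hc e) (C.inv_mem hc)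
  have hmul : ⁅e, b * c⁆ = ⁅e, b⁆ * (b * ⁅e, c⁆ * b⁻¹) := by
    simp only [commutatorElement_def]
    group
  rw [hmul]
  exact C.mul_mem (h (Subgroup.commutator_mem_commutator he hb)) (hC.conj_mem _ hec b)

theorem TransposedUp.commutator_le_iff {G : Type*} [Group G]
    {p q : {N : Subgroup G // N.Normal} × {N : Subgroup G // N.Normal}}
    (h : TransposedUp p q) (E : Subgroup G) :
    ⁅E, p.2.1⁆ ≤ p.1.1 ↔ ⁅E, q.2.1⁆ ≤ q.1.1 := by
  have hp : p.1.1 = p.2.1 ⊓ q.1.1 := congrArg Subtype.val h.1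
  have hq : q.2.1 = p.2.1 ⊔ q.1.1 := congrArg Subtype.val h.2
  have := p.2.2
  have := q.1.2
  rw [hp, hq]
  constructor
  · exact fun hE => Subgroup.commutator_sup_le_right (hE.trans inf_le_right)
  · exact fun hE => le_inf (Subgroup.commutator_le_right _ _)
      ((Subgroup.commutator_mono le_rfl le_sup_left).trans hE)

theorem ProjectiveIntervals.commutator_le_iff {G : Type*} [Group G]
    {p q : {N : Subgroup G // N.Normal} × {N : Subgroup G // N.Normal}}
    (h : ProjectiveIntervals p q) (E : Subgroup G) :
    ⁅E, p.2.1⁆ ≤ p.1.1 ↔ ⁅E, q.2.1⁆ ≤ q.1.1 := by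
  induction h with
  | refl => exact Iff.rfl
  | tail _ hstep ih =>
    rcases hstep with hup | hdown
    · exact ih.trans (hup.commutator_le_iff E)
    · exact ih.trans (hdown.commutator_le_iff E).symm

/-- Lemma (instance for groups): if the intervals `I[A,B]` and `I[C,D]` of the
lattice of normal subgroups of `G` are projective, then for every normal
subgroup `E`, `⁅E,B⁆ ≤ A` iff `⁅E,D⁆ ≤ C`. -/
theorem commutator_le_iff_of_projective (G : Type*) [Group G]
    (A B C D : Subgroup G) (hA : A.Normal) (hB : B.Normal) (hC : C.Normal) (hD : D.Normal)
    (hAB : A ≤ B) (hCD : C ≤ D)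
    (hproj : ProjectiveIntervals
      ((⟨A, hA⟩ : {N : Subgroup G // N.Normal}), (⟨B, hB⟩ : {N : Subgroup G // N.Normal}))
      ((⟨C, hC⟩ : {N : Subgroup G // N.Normal}), (⟨D, hD⟩ : {N : Subgroup G // N.Normal})))
    (E : Subgroup G) (hE : E.Normal) :
    ⁅E, B⁆ ≤ A ↔ ⁅E, D⁆ ≤ C :=
  hproj.commutator_le_iff E
end

section
/- Let G be a group and let A, B, C, D be normal subgroups of G with A ≤ B and C ≤ D, such that the intervals I[A,B] and I[C,D] of the lattice of normal subgroups of G are projective. Then ⁅B,B⁆ ≤ A if and only if ⁅D,D⁆ ≤ C. -/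
/-- If `B` is abelian modulo a normal subgroup `C`, then so is `B ⊔ C`. -/
theorem Subgroup.commutator_sup_self_le_iff {G : Type*} [Group G] (B C : Subgroup G)
    [C.Normal] : ⁅B ⊔ C, B ⊔ C⁆ ≤ C ↔ ⁅B, B⁆ ≤ C := by
  refine ⟨(Subgroup.commutator_mono le_sup_left le_sup_left).trans, fun h => ?_⟩
  have hC : C.map (QuotientGroup.mk' C) = ⊥ :=
    (Subgroup.map_eq_bot_iff _).2 (QuotientGroup.ker_mk' C).ge
  have key (H : Subgroup G) : ⁅H, H⁆ ≤ C ↔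
      ⁅H.map (QuotientGroup.mk' C), H.map (QuotientGroup.mk' C)⁆ = ⊥ := by
    rw [← Subgroup.map_commutator, Subgroup.map_eq_bot_iff, QuotientGroup.ker_mk']
  rw [key] at h ⊢
  rwa [Subgroup.map_sup, hC, sup_bot_eq]

theorem TransposedUp.commutator_self_le_iff {G : Type*} [Group G]
    {p q : {N : Subgroup G // N.Normal} × {N : Subgroup G // N.Normal}}
    (h : TransposedUp p q) :
    ⁅p.2.1, p.2.1⁆ ≤ p.1.1 ↔ ⁅q.2.1, q.2.1⁆ ≤ q.1.1 := by
  have : p.2.1.Normal := p.2.2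
  have : q.1.1.Normal := q.1.2
  have h₁ : p.1.1 = p.2.1 ⊓ q.1.1 := congrArg Subtype.val h.1
  have h₂ : q.2.1 = p.2.1 ⊔ q.1.1 := congrArg Subtype.val h.2
  rw [h₁, h₂, Subgroup.commutator_sup_self_le_iff, le_inf_iff]
  exact and_iff_right (Subgroup.commutator_le_left _ _)

theorem ProjectiveIntervals.commutator_self_le_iff {G : Type*} [Group G]
    {p q : {N : Subgroup G // N.Normal} × {N : Subgroup G // N.Normal}}
    (h : ProjectiveIntervals p q) :
    ⁅p.2.1, p.2.1⁆ ≤ p.1.1 ↔ ⁅q.2.1, q.2.1⁆ ≤ q.1.1 := by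
  induction h with
  | refl => exact Iff.rfl
  | tail _ h ih =>
    exact ih.trans (h.elim (fun h => h.commutator_self_le_iff)
      (fun h => h.commutator_self_le_iff.symm))

/-- Lemma (instance for groups): if the intervals `I[A,B]` and `I[C,D]` of the
lattice of normal subgroups of `G` are projective, then `⁅B,B⁆ ≤ A` iff
`⁅D,D⁆ ≤ C`. -/
theorem commutator_self_le_iff_of_projective (G : Type*) [Group G]
    (A B C D : Subgroup G) (hA : A.Normal) (hB : B.Normal) (hC : C.Normal) (hD : D.Normal)
    (hAB : A ≤ B) (hCD : C ≤ D)
    (hproj : ProjectiveIntervals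
      ((⟨A, hA⟩ : {N : Subgroup G // N.Normal}), (⟨B, hB⟩ : {N : Subgroup G // N.Normal}))
      ((⟨C, hC⟩ : {N : Subgroup G // N.Normal}), (⟨D, hD⟩ : {N : Subgroup G // N.Normal}))) :
    ⁅B, B⁆ ≤ A ↔ ⁅D, D⁆ ≤ C := by
  exact hproj.commutator_self_le_iff
end

section
/- Let G be a finite group whose lattice L of normal subgroups is a simple lattice with at least 3 elements. Then for all normal subgroups M, N of G such that M covers N in L (i.e., N < M and no normal subgroup lies strictly between them), one has ⁅M,M⁆ ≤ N. -/
/-- The commutator with a fixed subgroup of a join lies in a normal subgroup as soon as both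
commutators do. -/
theorem Subgroup.commutator_sup_le_of_le {G : Type*} [Group G] {A B Y N : Subgroup G}
    [hN : N.Normal] (hA : ⁅A, Y⁆ ≤ N) (hB : ⁅B, Y⁆ ≤ N) : ⁅A ⊔ B, Y⁆ ≤ N := by
  have key : ∀ X : Subgroup G, ⁅X, Y⁆ ≤ N ↔
      X ≤ (Subgroup.centralizer (Y.map (QuotientGroup.mk' N) : Set (G ⧸ N))).comap
        (QuotientGroup.mk' N) := by
    intro X
    rw [← Subgroup.map_le_iff_le_comap, ← Subgroup.commutator_eq_bot_iff_le_centralizer,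
      ← Subgroup.map_commutator, Subgroup.map_eq_bot_iff, QuotientGroup.ker_mk']
  rw [key] at hA hB ⊢
  exact sup_le hA hB

/-- If `M` covers `N` among the normal subgroups and `X ≤ M` commutes with `Y` modulo `N`, then
`X ≤ N` or the whole of `M` commutes with `Y` modulo `N`. -/
theorem Subgroup.le_or_commutator_le_of_covBy {G : Type*} [Group G] {M N X Y : Subgroup G}
    {hM : M.Normal} {hN : N.Normal} [hX : X.Normal]
    (hcov : (⟨N, hN⟩ : {N : Subgroup G // N.Normal}) ⋖ (⟨M, hM⟩ : {N : Subgroup G // N.Normal}))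
    (hXM : X ≤ M) (hXY : ⁅X, Y⁆ ≤ N) : X ≤ N ∨ ⁅M, Y⁆ ≤ N := by
  have hNM : N ≤ M := hcov.le
  have hXN : (X ⊔ N).Normal := Subgroup.sup_normal X N
  rcases hcov.eq_or_eq (c := ⟨X ⊔ N, hXN⟩) (le_sup_right : N ≤ X ⊔ N)
    (sup_le hXM hNM : X ⊔ N ≤ M) with h | h
  · left
    exact sup_eq_right.mp (congrArg Subtype.val h)
  · right
    have h' : X ⊔ N = M := congrArg Subtype.val h
    rw [← h']
    exact Subgroup.commutator_sup_le_of_le hXY (Subgroup.commutator_le_left N Y)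

/-- A covering pair of normal subgroups with nonabelian quotient is meet-prime: if `A ⊓ B`
commutes with `M` modulo `N`, then so does `A` or `B`. -/
theorem Subgroup.commutator_le_or_of_inf {G : Type*} [Group G] {M N A B : Subgroup G}
    {hM : M.Normal} {hN : N.Normal} [hA : A.Normal] [hB : B.Normal]
    (hcov : (⟨N, hN⟩ : {N : Subgroup G // N.Normal}) ⋖ (⟨M, hM⟩ : {N : Subgroup G // N.Normal}))
    (hMM : ¬ ⁅M, M⁆ ≤ N) (h : ⁅A ⊓ B, M⁆ ≤ N) : ⁅A, M⁆ ≤ N ∨ ⁅B, M⁆ ≤ N := by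
  have hAM : ⁅A, M⁆ ≤ M := Subgroup.commutator_le_right A M
  have hBM : ⁅B, M⁆ ≤ M := Subgroup.commutator_le_right B M
  have hAB : ⁅⁅A, M⁆, ⁅B, M⁆⁆ ≤ A ⊓ B :=
    le_inf ((Subgroup.commutator_le_left _ _).trans (Subgroup.commutator_le_left A M))
      ((Subgroup.commutator_le_right _ _).trans (Subgroup.commutator_le_left B M))
  have hN' := (Subgroup.le_or_commutator_le_of_covBy hcov
    ((Subgroup.commutator_le_left _ _).trans hAM)
    ((Subgroup.commutator_mono hAB le_rfl).trans h)).resolve_right hMM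
  refine (Subgroup.le_or_commutator_le_of_covBy hcov hAM hN').imp_right fun hMB => ?_
  rw [Subgroup.commutator_comm] at hMB
  exact (Subgroup.le_or_commutator_le_of_covBy hcov hBM hMB).resolve_right hMM

/-- Lemma (instance for finite groups): if the lattice of normal subgroups of
a finite group `G` is a simple lattice with at least 3 elements, then for
every covering pair `N ⋖ M` of normal subgroups one has `⁅M,M⁆ ≤ N`. -/
theorem commutator_le_of_covby (G : Type*) [Group G] [Finite G]
    (hsimple : SimpleLattice {N : Subgroup G // N.Normal})
    (hcard : 3 ≤ Nat.card {N : Subgroup G // N.Normal})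
    (M N : Subgroup G) (hM : M.Normal) (hN : N.Normal)
    (hcov : (⟨N, hN⟩ : {N : Subgroup G // N.Normal}) ⋖ (⟨M, hM⟩ : {N : Subgroup G // N.Normal})) :
    ⁅M, M⁆ ≤ N := by
  by_contra hMM
  have hcong : IsLatticeCong fun A B : {N : Subgroup G // N.Normal} =>
      (⁅A.1, M⁆ ≤ N ↔ ⁅B.1, M⁆ ≤ N) := by
    have hinf : ∀ A B : {N : Subgroup G // N.Normal},
        ⁅(A ⊓ B).1, M⁆ ≤ N ↔ ⁅A.1, M⁆ ≤ N ∨ ⁅B.1, M⁆ ≤ N := fun A B =>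
      have := A.2
      have := B.2
      ⟨Subgroup.commutator_le_or_of_inf hcov hMM, fun h => h.elim
        (Subgroup.commutator_mono (inf_le_left : A.1 ⊓ B.1 ≤ A.1) le_rfl).trans
        (Subgroup.commutator_mono (inf_le_right : A.1 ⊓ B.1 ≤ B.1) le_rfl).trans⟩
    have hsup : ∀ A B : {N : Subgroup G // N.Normal},
        ⁅(A ⊔ B).1, M⁆ ≤ N ↔ ⁅A.1, M⁆ ≤ N ∧ ⁅B.1, M⁆ ≤ N := fun A B =>
      ⟨fun h => ⟨(Subgroup.commutator_mono (le_sup_left : A.1 ≤ A.1 ⊔ B.1) le_rfl).trans h,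
        (Subgroup.commutator_mono (le_sup_right : B.1 ≤ A.1 ⊔ B.1) le_rfl).trans h⟩,
        fun h => Subgroup.commutator_sup_le_of_le h.1 h.2⟩
    refine ⟨⟨fun _ => Iff.rfl, Iff.symm, Iff.trans⟩, fun a b c d hab hcd => ⟨?_, ?_⟩⟩
    · exact (hinf a c).trans ((or_congr hab hcd).trans (hinf b d).symm)
    · exact (hsup a c).trans ((and_congr hab hcd).trans (hsup b d).symm)
  rcases hsimple.2 _ hcong with h | h
  · have hinj : Function.Injective fun A : {N : Subgroup G // N.Normal} => ⁅A.1, M⁆ ≤ N :=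
      fun A B hAB => (h A B).mp (iff_of_eq hAB)
    have hle := Nat.card_le_card_of_injective _ hinj
    rw [Nat.card_eq_fintype_card (α := Prop), Fintype.card_prop] at hle
    omega
  · exact hMM ((h ⟨N, hN⟩ ⟨M, hM⟩).mp (Subgroup.commutator_le_left N M))
end

section
/- Let G be a finite group whose lattice of normal subgroups is a simple lattice with at least 3 elements. Then G is nilpotent. -/
/-- A monotone deflationary operator `f` with `f (a ⊔ b) ≤ f a ⊔ b` identifies two elements when
some iterate of `f` maps each of them below the other; this is a lattice congruence. -/
theorem isLatticeCong_iterate {L : Type*} [Lattice L] {f : L → L} (hmono : Monotone f)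
    (hle : ∀ a, f a ≤ a) (hsup : ∀ a b, f (a ⊔ b) ≤ f a ⊔ b) :
    IsLatticeCong fun a b => ∃ n, f^[n] a ≤ b ∧ f^[n] b ≤ a := by
  have hanti : ∀ {m n : ℕ} (a : L), m ≤ n → f^[n] a ≤ f^[m] a := fun a h =>
    antitone_nat_of_succ_le (f := fun n => f^[n] a)
      (fun n => by simpa only [Function.iterate_succ_apply'] using hle _) h
  have hiter_sup : ∀ (n : ℕ) (a b : L), f^[n] (a ⊔ b) ≤ f^[n] a ⊔ b := by
    intro n a b
    induction n with
    | zero => rfl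
    | succ n ih =>
      simp only [Function.iterate_succ_apply']
      exact (hmono ih).trans (hsup _ _)
  have htrans : ∀ {m n : ℕ} {a b c : L}, f^[m] a ≤ b → f^[n] b ≤ c → f^[n + m] a ≤ c := by
    intro m n a b c hab hbc
    rw [Function.iterate_add_apply]
    exact (hmono.iterate n hab).trans hbc
  have hjoin : ∀ {m n : ℕ} {a b c d : L}, f^[m] a ≤ b → f^[n] c ≤ d →
      f^[n + m] (a ⊔ c) ≤ b ⊔ d := by
    intro m n a b c d hab hcd
    refine htrans (b := c ⊔ b) ((hiter_sup m a c).trans ?_) ((hiter_sup n c b).trans ?_)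
    · exact sup_le (hab.trans le_sup_right) le_sup_left
    · exact sup_le (hcd.trans le_sup_right) le_sup_left
  have hmeet : ∀ {m n : ℕ} {a b c d : L}, f^[m] a ≤ b → f^[n] c ≤ d →
      f^[n + m] (a ⊓ c) ≤ b ⊓ d := fun {m n a b c d} hab hcd =>
    le_inf
      ((hanti _ (Nat.le_add_left m n)).trans ((hmono.iterate m inf_le_left).trans hab))
      ((hanti _ (Nat.le_add_right n m)).trans ((hmono.iterate n inf_le_right).trans hcd))
  refine ⟨⟨fun a => ⟨0, le_rfl, le_rfl⟩, fun ⟨n, h₁, h₂⟩ => ⟨n, h₂, h₁⟩, ?_⟩, ?_⟩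
  · rintro a b c ⟨m, hab, hba⟩ ⟨n, hbc, hcb⟩
    exact ⟨n + m, htrans hab hbc, Nat.add_comm m n ▸ htrans hcb hba⟩
  · rintro a b c d ⟨m, hab, hba⟩ ⟨n, hcd, hdc⟩
    exact ⟨⟨n + m, hmeet hab hcd, hmeet hba hdc⟩, ⟨n + m, hjoin hab hcd, hjoin hba hdc⟩⟩

/-- On a simple bounded lattice, an operator as in `isLatticeCong_iterate` is the identity or
nilpotent. -/
theorem SimpleLattice.eq_self_or_iterate_top_eq_bot {L : Type*} [Lattice L] [BoundedOrder L]
    (hL : SimpleLattice L) {f : L → L} (hmono : Monotone f) (hle : ∀ a, f a ≤ a)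
    (hsup : ∀ a b, f (a ⊔ b) ≤ f a ⊔ b) : (∀ a, f a = a) ∨ ∃ n, f^[n] ⊤ = ⊥ := by
  refine (hL.2 _ (isLatticeCong_iterate hmono hle hsup)).imp (fun h a => ?_) fun h => ?_
  · exact (h _ _).1 ⟨1, (hle _).trans (hle a), le_rfl⟩
  · obtain ⟨n, hn, -⟩ := h ⊤ ⊥
    exact ⟨n, le_bot_iff.1 hn⟩

/-- A simple bounded lattice in which meets distribute over joins has no elements besides
`⊥` and `⊤`. -/
theorem SimpleLattice.eq_bot_or_eq_top_of_inf_sup_le {L : Type*} [Lattice L] [BoundedOrder L]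
    (hL : SimpleLattice L) (hdist : ∀ a b c : L, (a ⊔ b) ⊓ c ≤ a ⊓ c ⊔ b ⊓ c) (a : L) :
    a = ⊥ ∨ a = ⊤ := by
  have hdist' : ∀ b c : L, (b ⊔ c) ⊓ a = b ⊓ a ⊔ c ⊓ a := fun b c =>
    (hdist b c a).antisymm (sup_le (inf_le_inf_right a le_sup_left)
      (inf_le_inf_right a le_sup_right))
  have hcong : IsLatticeCong fun b c : L => b ⊓ a = c ⊓ a := by
    refine ⟨⟨fun _ => rfl, Eq.symm, Eq.trans⟩, fun b c d e h₁ h₂ => ⟨?_, ?_⟩⟩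
    · beta_reduce at h₁ h₂ ⊢
      rw [inf_inf_distrib_right, h₁, h₂, ← inf_inf_distrib_right]
    · beta_reduce at h₁ h₂ ⊢
      rw [hdist', h₁, h₂, ← hdist']
  rcases hL.2 _ hcong with h | h
  · exact Or.inr ((h a ⊤).1 (by simp))
  · exact Or.inl (by simpa using h ⊤ ⊥)

namespace NormalSubgroup

variable {G : Type*} [Group G]

/-- The commutator of two normal subgroups, as a normal subgroup. -/
def comm (A B : {N : Subgroup G // N.Normal}) : {N : Subgroup G // N.Normal} :=
  haveI := A.2
  haveI := B.2
  ⟨⁅A.1, B.1⁆, inferInstance⟩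

theorem comm_mono {A B C D : {N : Subgroup G // N.Normal}} (h₁ : A ≤ C) (h₂ : B ≤ D) :
    comm A B ≤ comm C D :=
  Subgroup.commutator_mono h₁ h₂

theorem comm_comm (A B : {N : Subgroup G // N.Normal}) : comm A B = comm B A :=
  Subtype.ext (Subgroup.commutator_comm _ _)

theorem comm_le_left (A B : {N : Subgroup G // N.Normal}) : comm A B ≤ A :=
  haveI := A.2
  Subgroup.commutator_le_left A.1 B.1

theorem comm_le_right (A B : {N : Subgroup G // N.Normal}) : comm A B ≤ B :=
  comm_comm A B ▸ comm_le_left B A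

open scoped commutatorElement in
theorem sup_comm_le (A B C : {N : Subgroup G // N.Normal}) :
    comm (A ⊔ B) C ≤ comm A C ⊔ comm B C := by
  have := A.2
  have := B.2
  have hN := (comm A C ⊔ comm B C).2
  refine Subgroup.commutator_le.2 fun x hx c hc => ?_
  obtain ⟨a, ha, b, hb, rfl⟩ := Subgroup.mem_sup_of_normal_left.1 hx
  have hac : ⁅a, c⁆ ∈ (comm A C ⊔ comm B C).1 :=
    (le_sup_left : comm A C ≤ _) (Subgroup.commutator_mem_commutator ha hc)
  have hbc : ⁅b, c⁆ ∈ (comm A C ⊔ comm B C).1 :=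
    (le_sup_right : comm B C ≤ _) (Subgroup.commutator_mem_commutator hb hc)
  have hmul : ⁅a * b, c⁆ = a * ⁅b, c⁆ * a⁻¹ * ⁅a, c⁆ := by
    simp only [commutatorElement_def]
    group
  rw [hmul]
  exact mul_mem (hN.conj_mem _ hbc a) hac

theorem comm_self_sup_le (A B : {N : Subgroup G // N.Normal}) :
    comm (A ⊔ B) (A ⊔ B) ≤ comm A A ⊔ B := by
  refine (sup_comm_le _ _ _).trans (sup_le ?_ ((comm_le_left _ _).trans le_sup_right))
  rw [comm_comm]
  refine (sup_comm_le _ _ _).trans (sup_le le_sup_left ((comm_le_left _ _).trans le_sup_right))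

theorem iterate_comm_top (n : ℕ) :
    ((fun A : {N : Subgroup G // N.Normal} => comm A ⊤)^[n] ⊤).1 =
      Subgroup.lowerCentralSeries (⊤ : Subgroup G) n := by
  induction n with
  | zero => rfl
  | succ n ih =>
    rw [Function.iterate_succ_apply']
    exact congrArg (⁅·, (⊤ : Subgroup G)⁆) ih

end NormalSubgroup

open NormalSubgroup

/-- Lemma (instance for finite groups): a finite group whose lattice of
normal subgroups is a simple lattice with at least 3 elements is nilpotent. -/
theorem isNilpotent_of_simple_lattice (G : Type*) [Group G] [Finite G]
    (hsimple : SimpleLattice {N : Subgroup G // N.Normal})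
    (hcard : 3 ≤ Nat.card {N : Subgroup G // N.Normal}) :
    Group.IsNilpotent G := by
  have hthree : ¬ ∀ A : {N : Subgroup G // N.Normal}, A = ⊥ ∨ A = ⊤ := by
    intro h
    have hsub : (Set.univ : Set {N : Subgroup G // N.Normal}) ⊆ {⊥, ⊤} := fun A _ => h A
    have := Set.ncard_le_ncard hsub
    have := Set.ncard_insert_le (⊥ : {N : Subgroup G // N.Normal}) {⊤}
    rw [Set.ncard_singleton] at this
    rw [← Set.ncard_univ] at hcard
    omega
  have hcentral := hsimple.eq_self_or_iterate_top_eq_bot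
    (f := fun A => comm A ⊤) (fun _ _ h => comm_mono h le_rfl) (fun A => comm_le_left A ⊤)
    fun A B => (sup_comm_le A B ⊤).trans (sup_le_sup_left (comm_le_left B ⊤) _)
  have hderived := hsimple.eq_self_or_iterate_top_eq_bot
    (f := fun A => comm A A) (fun _ _ h => comm_mono h h) (fun A => comm_le_left A A)
    comm_self_sup_le
  rcases hcentral with hperfect | ⟨n, hn⟩
  · exfalso
    rcases hderived with hidem | ⟨n, hn⟩
    · refine hthree (hsimple.eq_bot_or_eq_top_of_inf_sup_le fun A B C => ?_)
      calc (A ⊔ B) ⊓ C = comm ((A ⊔ B) ⊓ C) ((A ⊔ B) ⊓ C) := (hidem _).symm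
        _ ≤ comm (A ⊔ B) C := comm_mono inf_le_left inf_le_right
        _ ≤ comm A C ⊔ comm B C := sup_comm_le A B C
        _ ≤ A ⊓ C ⊔ B ⊓ C := sup_le_sup (le_inf (comm_le_left A C) (comm_le_right A C))
            (le_inf (comm_le_left B C) (comm_le_right B C))
    · rw [Function.iterate_fixed (f := fun A => comm A A) (hperfect ⊤) n] at hn
      have := hsimple.1
      exact top_ne_bot hn
  · refine Subgroup.nilpotent_iff_lowerCentralSeries.2 ⟨n, ?_⟩
    rw [← iterate_comm_top, hn]
    rfl
end

section
/- Let G be a finite group whose lattice of normal subgroups is a simple lattice with at least 3 elements. Then there exist a prime number p and a natural number n such that |G| = p^n. -/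
namespace Subgroup

variable {G : Type*} [Group G]

theorem relIndex_dvd_of_normal_of_le_right (N : Subgroup G) [N.Normal] {K L : Subgroup G}
    (h : K ≤ L) : N.relIndex K ∣ N.relIndex L := by
  rw [← relIndex_sup_right K N, ← relIndex_sup_right L N]
  exact Dvd.intro _ (relIndex_mul_relIndex N (K ⊔ N) (L ⊔ N) le_sup_right (sup_le_sup_right h N))

theorem relIndex_inf_inf_dvd_mul (A B C D : Subgroup G) [A.Normal] [C.Normal] :
    (A ⊓ C).relIndex (B ⊓ D) ∣ A.relIndex B * C.relIndex D := by
  rw [← relIndex_inf_mul_relIndex A C (B ⊓ D)]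
  exact mul_dvd_mul (A.relIndex_dvd_of_normal_of_le_right (inf_le_right.trans inf_le_left))
    (C.relIndex_dvd_of_normal_of_le_right inf_le_right)

theorem relIndex_sup_sup_dvd_mul (A B C D : Subgroup G) [A.Normal] [B.Normal] [C.Normal] :
    (A ⊔ C).relIndex (B ⊔ D) ∣ A.relIndex B * C.relIndex D := by
  have hN : (A ⊔ C).Normal := sup_normal A C
  have hBN : (B ⊔ (A ⊔ C)).Normal := sup_normal B (A ⊔ C)
  have key : (A ⊔ C).relIndex (B ⊔ D) =
      (A ⊔ C).relIndex B * (B ⊔ (A ⊔ C)).relIndex D := by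
    rw [← relIndex_sup_right (B ⊔ D) (A ⊔ C), ← relIndex_sup_right B (A ⊔ C),
      ← relIndex_sup_right D (B ⊔ (A ⊔ C)),
      relIndex_mul_relIndex _ _ _ le_sup_right le_sup_right]
    congr 1
    ac_rfl
  rw [key]
  exact mul_dvd_mul (relIndex_dvd_of_le_left B le_sup_left)
    (relIndex_dvd_of_le_left D (le_sup_right.trans le_sup_right))

theorem relIndex_dvd_relIndex_mul_relIndex (A B C : Subgroup G) [A.Normal] :
    A.relIndex C ∣ A.relIndex B * B.relIndex C := by
  refine (relIndex_dvd_of_le_left C (inf_le_left : A ⊓ B ≤ A)).trans ?_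
  rw [← relIndex_inf_mul_relIndex A B C]
  exact mul_dvd_mul_right (A.relIndex_dvd_of_normal_of_le_right inf_le_left) _

theorem commutator_le_iff_map_le_centralizer (A B N : Subgroup G) [N.Normal] :
    ⁅A, B⁆ ≤ N ↔
      A.map (QuotientGroup.mk' N) ≤ centralizer (B.map (QuotientGroup.mk' N) : Set (G ⧸ N)) := by
  rw [← commutator_eq_bot_iff_le_centralizer, ← map_commutator, map_eq_bot_iff,
    QuotientGroup.ker_mk']

theorem commutator_sup_le {A B C N : Subgroup G} [N.Normal] (hB : ⁅A, B⁆ ≤ N)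
    (hC : ⁅A, C⁆ ≤ N) : ⁅A, B ⊔ C⁆ ≤ N := by
  rw [commutator_comm, commutator_le_iff_map_le_centralizer] at hB hC ⊢
  rw [map_sup]
  exact sup_le hB hC

/-- The elements of exponent `p` of an abelian normal subgroup. -/
def normalTorsionBy (A : Subgroup G) (hA : A ≤ centralizer (A : Set G)) (p : ℕ) :
    Subgroup G where
  carrier := {x | x ∈ A ∧ x ^ p = 1}
  one_mem' := ⟨A.one_mem, one_pow p⟩
  mul_mem' {x y} hx hy := by
    have hxy : Commute x y := (mem_centralizer_iff.mp (hA hy.1)) x hx.1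
    exact ⟨A.mul_mem hx.1 hy.1, by rw [hxy.mul_pow, hx.2, hy.2, one_mul]⟩
  inv_mem' hx := ⟨A.inv_mem hx.1, by rw [inv_pow, hx.2, inv_one]⟩

theorem normalTorsionBy_normal (A : Subgroup G) [hN : A.Normal]
    (hA : A ≤ centralizer (A : Set G)) (p : ℕ) : (A.normalTorsionBy hA p).Normal where
  conj_mem x hx g :=
    ⟨hN.conj_mem x hx.1 g, by rw [conj_pow, hx.2, mul_one, mul_inv_cancel]⟩

/-- A nontrivial abelian normal section `A / N` contains a nontrivial normal `p`-section. -/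
theorem exists_normal_relIndex_eq_prime_pow [Finite G] {A N : Subgroup G} [A.Normal] [N.Normal]
    (hcomm : ⁅A, A⁆ ≤ N) (hAN : ¬ A ≤ N) :
    ∃ (p : ℕ) (K : Subgroup G), p.Prime ∧ K.Normal ∧ N < K ∧ ∃ n, N.relIndex K = p ^ n := by
  let π := QuotientGroup.mk' N
  have hπ : Function.Surjective π := QuotientGroup.mk'_surjective N
  have hker : π.ker = N := QuotientGroup.ker_mk' N
  have hcent := (commutator_le_iff_map_le_centralizer A A N).mp hcomm
  have hnormal : (A.map π).Normal := Normal.map inferInstance π hπ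
  have hcard : Nat.card (A.map π) ≠ 1 := by
    rwa [Ne, card_eq_one, map_eq_bot_iff, hker]
  obtain ⟨p, hp, hpdvd⟩ := Nat.exists_prime_and_dvd hcard
  have : Fact p.Prime := ⟨hp⟩
  obtain ⟨x, hx⟩ := exists_prime_orderOf_dvd_card' p hpdvd
  let T := (A.map π).normalTorsionBy hcent p
  have hT : T.Normal := normalTorsionBy_normal _ hcent p
  have hxT : (x : G ⧸ N) ∈ T := ⟨x.2, by rw [← hx, ← coe_pow, pow_orderOf_eq_one, coe_one]⟩
  have hTp : IsPGroup p T := fun y => ⟨1, Subtype.ext (by simpa using y.2.2)⟩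
  obtain ⟨n, hn⟩ := IsPGroup.iff_card.mp hTp
  have hidx : N.relIndex (T.comap π) = p ^ n := by
    rw [← hn, ← map_comap_eq_self_of_surjective hπ T, ← relIndex_ker, hker,
      map_comap_eq_self_of_surjective hπ T]
  refine ⟨p, T.comap π, hp, hT.comap π, lt_of_le_not_ge ?_ fun hle => ?_, n, hidx⟩
  · exact hker.ge.trans (ker_le_comap π T)
  · have hbot : T = ⊥ := by
      rw [← map_comap_eq_self_of_surjective hπ T, map_eq_bot_iff, hker]
      exact hle
    rw [hbot, mem_bot, OneMemClass.coe_eq_one] at hxT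
    rw [hxT, orderOf_one] at hx
    exact hp.one_lt.ne hx

end Subgroup

/-- Normal subgroups are related if both relative indices divide a power of `p`. -/
def NormalSubgroup.PowRel {G : Type*} [Group G] (p : ℕ) (A B : {N : Subgroup G // N.Normal}) :
    Prop :=
  (∃ n, A.1.relIndex B.1 ∣ p ^ n) ∧ ∃ n, B.1.relIndex A.1 ∣ p ^ n

theorem NormalSubgroup.isLatticeCong_powRel {G : Type*} [Group G] (p : ℕ) :
    IsLatticeCong (NormalSubgroup.PowRel (G := G) p) := by
  have mul {k l m : ℕ} (hm : m ∣ k * l) : (∃ n, k ∣ p ^ n) → (∃ n, l ∣ p ^ n) →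
      ∃ n, m ∣ p ^ n := fun ⟨i, hi⟩ ⟨j, hj⟩ =>
    ⟨i + j, hm.trans (pow_add p i j ▸ mul_dvd_mul hi hj)⟩
  refine ⟨⟨fun A => ?_, fun h => ⟨h.2, h.1⟩, ?_⟩, ?_⟩
  · have h : ∃ n, A.1.relIndex A.1 ∣ p ^ n := ⟨0, by simp⟩
    exact ⟨h, h⟩
  · rintro ⟨A, hA⟩ ⟨B, hB⟩ ⟨C, hC⟩ hAB hBC
    exact ⟨mul (A.relIndex_dvd_relIndex_mul_relIndex B C) hAB.1 hBC.1,
      mul (C.relIndex_dvd_relIndex_mul_relIndex B A) hBC.2 hAB.2⟩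
  · rintro ⟨A, hA⟩ ⟨B, hB⟩ ⟨C, hC⟩ ⟨D, hD⟩ hAB hCD
    exact ⟨⟨mul (A.relIndex_inf_inf_dvd_mul B C D) hAB.1 hCD.1,
        mul (B.relIndex_inf_inf_dvd_mul A D C) hAB.2 hCD.2⟩,
      ⟨mul (A.relIndex_sup_sup_dvd_mul B C D) hAB.1 hCD.1,
        mul (B.relIndex_sup_sup_dvd_mul A D C) hAB.2 hCD.2⟩⟩

theorem SimpleLattice.card_le_two_of_distrib {L : Type*} [Lattice L] [BoundedOrder L]
    (hL : SimpleLattice L) (hdist : ∀ a b c : L, a ⊓ (b ⊔ c) ≤ (a ⊓ b) ⊔ (a ⊓ c)) :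
    Nat.card L ≤ 2 := by
  have hsup (a b c : L) : (a ⊔ b) ⊓ c = (a ⊓ c) ⊔ (b ⊓ c) := by
    simp only [inf_comm _ c]
    exact (hdist c a b).antisymm le_inf_sup
  have hmem (c : L) : c = ⊤ ∨ c = ⊥ := by
    have hcong : IsLatticeCong fun a b : L => a ⊓ c = b ⊓ c := by
      refine ⟨⟨fun _ => rfl, Eq.symm, Eq.trans⟩, fun a b d e hab hde => ⟨?_, ?_⟩⟩
      · beta_reduce at hab hde ⊢
        rw [inf_inf_distrib_right, hab, hde, ← inf_inf_distrib_right]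
      · beta_reduce at hab hde ⊢
        rw [hsup, hsup, hab, hde]
    rcases hL.2 _ hcong with h | h
    · exact Or.inl ((h c ⊤).mp (by simp))
    · exact Or.inr (by simpa using h ⊤ ⊥)
  have hsurj : Function.Surjective fun b : Bool => if b then (⊤ : L) else ⊥ := fun c =>
    (hmem c).elim (fun h => ⟨true, by simp [h]⟩) fun h => ⟨false, by simp [h]⟩
  simpa using Nat.card_le_card_of_surjective _ hsurj

/-- Lemma (instance for finite groups): a finite group whose lattice of
normal subgroups is a simple lattice with at least 3 elements has prime power
order. -/
theorem card_prime_pow_of_simple_lattice (G : Type*) [Group G] [Finite G]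
    (hsimple : SimpleLattice {N : Subgroup G // N.Normal})
    (hcard : 3 ≤ Nat.card {N : Subgroup G // N.Normal}) :
    ∃ (p n : ℕ), p.Prime ∧ Nat.card G = p ^ n := by
  by_cases htotal : ∃ p : ℕ, p.Prime ∧ ∀ A B, NormalSubgroup.PowRel (G := G) p A B
  · obtain ⟨p, hp, htot⟩ := htotal
    obtain ⟨n, hn⟩ := (htot ⊥ ⊤).1
    have hdvd : Nat.card G ∣ p ^ n := by
      have hidx : (⊥ : Subgroup G).relIndex ⊤ ∣ p ^ n := hn
      simpa using hidx
    obtain ⟨m, -, hm⟩ := (Nat.dvd_prime_pow hp).mp hdvd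
    exact ⟨p, m, hp, hm⟩
  have hperfect (A N : Subgroup G) (hA : A.Normal) (hN : N.Normal) (hcomm : ⁅A, A⁆ ≤ N) :
      A ≤ N := by
    by_contra hAN
    obtain ⟨p, K, hp, hK, hlt, n, hn⟩ := Subgroup.exists_normal_relIndex_eq_prime_pow hcomm hAN
    rcases hsimple.2 _ (NormalSubgroup.isLatticeCong_powRel p) with h | h
    · have hrel : NormalSubgroup.PowRel p ⟨N, hN⟩ ⟨K, hK⟩ :=
        ⟨⟨n, hn.dvd⟩, 0, by simp [Subgroup.relIndex_eq_one.mpr hlt.le]⟩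
      exact hlt.ne (congrArg Subtype.val ((h _ _).mp hrel))
    · exact htotal ⟨p, hp, h⟩
  have hcard' := hsimple.card_le_two_of_distrib (by
    rintro ⟨A, hA⟩ ⟨B, hB⟩ ⟨C, hC⟩
    change A ⊓ (B ⊔ C) ≤ (A ⊓ B) ⊔ (A ⊓ C)
    have hD : ((A ⊓ B) ⊔ (A ⊓ C)).Normal := Subgroup.sup_normal _ _
    refine hperfect _ _ inferInstance hD
      ((Subgroup.commutator_mono inf_le_left inf_le_right).trans
        (Subgroup.commutator_sup_le ?_ ?_))
    · exact (Subgroup.commutator_le_inf A B).trans le_sup_left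
    · exact (Subgroup.commutator_le_inf A C).trans le_sup_right)
  lia
end
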